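/- Let f, g ∈ ℂ[z₁,…,zₙ] be nonconstant square-free homogeneous polynomials such that every irreducible factor p of f satisfies Sing V(p) ⊆ {0}. If there exists a bi-Lipschitz homeomorphism φ : (ℂⁿ, V(f), 0) → (ℂⁿ, V(g), 0), then every irreducible factor q of g satisfies Sing V(q) ⊆ {0}, and deg f = deg g. -/

import Mathlib

noncomputable section

/-- `ℂⁿ` with the Euclidean metric. -/
abbrev En (n : ℕ) := EuclideanSpace ℂ (Fin n)

/-- The zero set `V(p) ⊆ ℂⁿ` of a polynomial `p ∈ ℂ[z₁,…,zₙ]`. -/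
def pV {n : ℕ} (p : MvPolynomial (Fin n) ℂ) : Set (En n) :=
  {x | MvPolynomial.eval (x : Fin n → ℂ) p = 0}

/-- The singular set `Sing V(p) = {x ∈ V(p) : ∂p/∂z₁(x) = ⋯ = ∂p/∂zₙ(x) = 0}`. -/
def SingV {n : ℕ} (p : MvPolynomial (Fin n) ℂ) : Set (En n) :=
  {x | MvPolynomial.eval (x : Fin n → ℂ) p = 0 ∧
       ∀ i, MvPolynomial.eval (x : Fin n → ℂ) (MvPolynomial.pderiv i p) = 0}

/-- A bi-Lipschitz homeomorphism of germs `φ : (ℂⁿ, X, 0) → (ℂⁿ, Y, 0)`. -/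
def BiLipGermHomeo {n : ℕ} (X Y : Set (En n)) : Prop :=
  ∃ (U U' : Set (En n)) (φ ψ : En n → En n) (K : NNReal),
    IsOpen U ∧ IsOpen U' ∧ (0 : En n) ∈ U ∧ (0 : En n) ∈ U' ∧
    φ 0 = 0 ∧
    Set.MapsTo φ U U' ∧ Set.MapsTo ψ U' U ∧
    Set.LeftInvOn ψ φ U ∧ Set.RightInvOn ψ φ U' ∧
    LipschitzOnWith K φ U ∧ LipschitzOnWith K ψ U' ∧
    φ '' (X ∩ U) = Y ∩ U'

set_option linter.all false
open MeasureTheory Set Metric Filter Topology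

section Degree
variable {E : Type*} [NormedAddCommGroup E] [NormedSpace ℝ E] [FiniteDimensional ℝ E]

noncomputable def cof (E : Type*) [NormedAddCommGroup E] [NormedSpace ℝ E] [FiniteDimensional ℝ E]
    (i : Fin (Module.finrank ℝ E)) : C(E, ℝ) :=
  ⟨fun x => (Module.finBasis ℝ E).repr x i,
    ((Module.finBasis ℝ E).coord i).continuous_of_finiteDimensional⟩

theorem cof_approx {K : Set E} (hK : IsCompact K) (f : C(E, ℝ)) {ε : ℝ} (hε : 0 < ε) :
    ∃ P : MvPolynomial (Fin (Module.finrank ℝ E)) ℝ,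
      ∀ x ∈ K, ‖MvPolynomial.eval (fun i => cof E i x) P - f x‖ < ε := by
  have hs : ((MvPolynomial.aeval (cof E) :
      MvPolynomial _ ℝ →ₐ[ℝ] C(E, ℝ)).range).SeparatesPoints := by
    intro x y hxy
    have : ∃ i, cof E i x ≠ cof E i y := by
      by_contra! h
      exact hxy ((Module.finBasis ℝ E).repr.injective (Finsupp.ext h))
    obtain ⟨i, hi⟩ := this
    exact ⟨_, ⟨_, ⟨MvPolynomial.X i, rfl⟩, rfl⟩, by simpa using hi⟩
  obtain ⟨g, ⟨P, hP⟩, hg⟩ :=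
    ContinuousMap.exists_mem_subalgebra_near_continuous_of_isCompact_of_separatesPoints
      hs f hK hε
  refine ⟨P, fun x hx => ?_⟩
  have := hg x hx
  rw [← hP] at this
  convert this using 3
  change _ = ContinuousMap.evalAlgHom ℝ ℝ x ((MvPolynomial.aeval (cof E)) P)
  rw [← AlgHom.comp_apply, MvPolynomial.comp_aeval]
  rw [← MvPolynomial.coe_aeval_eq_eval]
  rfl

theorem cof_contDiff (P : MvPolynomial (Fin (Module.finrank ℝ E)) ℝ) :
    ContDiff ℝ 1 (fun x : E => MvPolynomial.eval (fun i => cof E i x) P) := by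
  induction P using MvPolynomial.induction_on with
  | C a => simpa using contDiff_const
  | add p q hp hq => simpa using hp.add hq
  | mul_X p i hp =>
    simp only [map_mul, MvPolynomial.eval_X]
    refine hp.mul ?_
    exact (LinearMap.toContinuousLinearMap ((Module.finBasis ℝ E).coord i)).contDiff

theorem approxE {K : Set E} (hK : IsCompact K) (f : E → E) (hf : ContinuousOn f K)
    {ε : ℝ} (hε : 0 < ε) : ∃ g : E → E, ContDiff ℝ 1 g ∧ ∀ x ∈ K, ‖g x - f x‖ < ε := by
  set b := Module.finBasis ℝ E
  have hex : ∀ i, ∃ F : C(E, ℝ), ∀ x ∈ K, F x = b.repr (f x) i := by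
    intro i
    obtain ⟨F, hF⟩ := ContinuousMap.exists_restrict_eq hK.isClosed
      (⟨fun x : K => b.repr (f x) i, by
        have h1 := (cof E i).continuous
        exact h1.comp (continuousOn_iff_continuous_domRestrict.1 hf)⟩ : C(K, ℝ))
    exact ⟨F, fun x hx => DFunLike.congr_fun hF ⟨x, hx⟩⟩
  choose F hF using hex
  set M := ∑ i, ‖b i‖ with hM
  have hM0 : 0 ≤ M := Finset.sum_nonneg fun i _ => norm_nonneg _
  have hδ : 0 < ε / (M + 1) := by positivity
  choose P hP using fun i => cof_approx hK (F i) hδ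
  refine ⟨fun x => ∑ i, MvPolynomial.eval (fun i => cof E i x) (P i) • b i, ?_, ?_⟩
  · exact ContDiff.sum fun i _ => (cof_contDiff (P i)).smul contDiff_const
  · intro x hx
    have : f x = ∑ i, F i x • b i := by
      conv_lhs => rw [← b.sum_repr (f x)]
      exact Finset.sum_congr rfl fun i _ => by rw [hF i x hx]
    rw [this, ← Finset.sum_sub_distrib]
    calc _ ≤ ∑ i, ‖MvPolynomial.eval (fun i => cof E i x) (P i) • b i - F i x • b i‖ :=
          norm_sum_le _ _
      _ ≤ ∑ i, ε / (M + 1) * ‖b i‖ := by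
          refine Finset.sum_le_sum fun i _ => ?_
          rw [← sub_smul, norm_smul]
          exact mul_le_mul_of_nonneg_right (hP i x hx).le (norm_nonneg _)
      _ = ε * (M / (M + 1)) := by rw [← Finset.mul_sum]; ring
      _ < ε := by
          have : M / (M + 1) < 1 := by rw [div_lt_one (by positivity)]; linarith
          nlinarith

theorem det_pos_of (A : E →L[ℝ] E) {l : ℝ} (h : ‖A‖ < l) :
    0 < (l • ContinuousLinearMap.id ℝ E + A).det := by
  have hl : 0 < l := (norm_nonneg _).trans_lt h
  set D : ℝ → ℝ := fun s => (l • ContinuousLinearMap.id ℝ E + s • A).det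
  have hc : Continuous D := by
    apply ContinuousLinearMap.continuous_det.comp; fun_prop
  have h0 : 0 < D 0 := by
    simp only [D, zero_smul, add_zero, ContinuousLinearMap.det]
    simp only [ContinuousLinearMap.toLinearMap_smul, ContinuousLinearMap.coe_id]
    rw [LinearMap.det_smul, LinearMap.det_id]; positivity
  by_contra! h1
  have h1' : D 1 ≤ 0 := by simpa [D] using h1
  obtain ⟨s, hs, hs0⟩ := intermediate_value_Icc' zero_le_one hc.continuousOn ⟨h1', h0.le⟩
  obtain ⟨v, hv, hv0⟩ := Submodule.exists_mem_ne_zero_of_ne_bot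
    (LinearMap.bot_lt_ker_of_det_eq_zero hs0).ne'
  have h2 : l • v = - (s • A v) := by
    rw [eq_neg_iff_add_eq_zero]; simpa using hv
  have h3 : l * ‖v‖ ≤ ‖A‖ * ‖v‖ := by
    calc l * ‖v‖ = ‖l • v‖ := by rw [norm_smul, Real.norm_of_nonneg hl.le]
      _ = s * ‖A v‖ := by rw [h2, norm_neg, norm_smul, Real.norm_of_nonneg hs.1]
      _ ≤ 1 * (‖A‖ * ‖v‖) := mul_le_mul hs.2 (A.le_opNorm v) (norm_nonneg _) zero_le_one
      _ = _ := one_mul _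
  exact absurd (le_of_mul_le_mul_right h3 (norm_pos_iff.2 hv0)) (not_le.2 h)

variable [MeasurableSpace E] [BorelSpace E] (μ : Measure E) [μ.IsAddHaarMeasure]

theorem cov_big {f : E → E} (hf : ContDiff ℝ 1 f) {R : ℝ} (hR : ∀ x, R ≤ ‖x‖ → f x = 0)
    {l : NNReal} (hl : ∃ C < l, LipschitzWith C f) (ρ : E → ℝ) :
    ∫ x in ball 0 R, ρ (l • x + f x) * (l • ContinuousLinearMap.id ℝ E + fderiv ℝ f x).det ∂μ
     = ∫ y in ball 0 (l * R), ρ y ∂μ := by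
  obtain ⟨C, hC, hlip⟩ := hl
  have hl0 : (0 : ℝ) < l := by exact_mod_cast (zero_le).trans_lt hC
  have hl0' : l ≠ 0 := by rintro rfl; simp at hl0
  set T : E → E := fun x => l • x + f x with hT
  have hinj : Function.Injective T := by
    intro x y hxy
    by_contra hne
    have h1 : (l : ℝ) * ‖x - y‖ ≤ C * ‖x - y‖ := by
      calc (l : ℝ) * ‖x - y‖ = ‖l • (x - y)‖ := by rw [NNReal.smul_def, norm_smul]; simp
        _ = ‖f y - f x‖ := by
          congr 1; rw [smul_sub]; simp only [hT] at hxy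
          rw [sub_eq_sub_iff_add_eq_add, hxy, add_comm]
        _ ≤ C * ‖y - x‖ := hlip.norm_sub_le _ _
        _ = _ := by rw [norm_sub_rev]
    have h2 : (l : ℝ) ≤ C := le_of_mul_le_mul_right h1 (norm_pos_iff.2 (sub_ne_zero.2 hne))
    exact absurd hC (not_lt.2 (by exact_mod_cast h2))
  have hsurj : Function.Surjective T := by
    intro z
    have hc : ContractingWith (C / l) (fun y => l⁻¹ • (z - f y)) := by
      refine ⟨by rw [div_lt_one (by exact_mod_cast hl0)]; exact hC, ?_⟩
      refine LipschitzWith.of_dist_le_mul fun x y => ?_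
      rw [dist_eq_norm, ← smul_sub, sub_sub_sub_cancel_left, NNReal.smul_def, norm_smul]
      have := hlip.norm_sub_le y x
      rw [dist_eq_norm, norm_sub_rev x y]
      calc _ ≤ ‖((l⁻¹ : NNReal) : ℝ)‖ * (C * ‖y - x‖) := by gcongr
        _ = _ := by simp; ring
    have h := hc.fixedPoint_isFixedPt
    refine ⟨ContractingWith.fixedPoint _ hc, ?_⟩
    simp only [Function.IsFixedPt] at h
    set y := ContractingWith.fixedPoint _ hc
    simp only [hT]
    nth_rewrite 1 [← h]
    rw [smul_smul, mul_inv_cancel₀ hl0', one_smul, sub_add_cancel]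
  have himg : T '' ball 0 R = ball 0 (l * R) := by
    have hout : ∀ x, R ≤ ‖x‖ → T x = l • x := fun x hx => by simp [hT, hR x hx]
    have hn : ∀ x : E, ‖l • x‖ = l * ‖x‖ := fun x => by rw [NNReal.smul_def, norm_smul]; simp
    ext y; constructor
    · rintro ⟨x, hx, rfl⟩
      rw [mem_ball_zero_iff] at hx ⊢
      by_contra! h
      have hle : R ≤ ‖l⁻¹ • T x‖ := by
        rw [NNReal.smul_def, norm_smul]
        simp only [NNReal.coe_inv, norm_inv, NNReal.norm_eq]
        rwa [inv_mul_eq_div, le_div_iff₀ hl0, mul_comm]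
      have h2 : T (l⁻¹ • T x) = T x := by
        rw [hout _ hle, smul_smul, mul_inv_cancel₀ hl0', one_smul]
      rw [hinj h2] at hle
      exact absurd hx (not_lt.2 hle)
    · intro hy
      obtain ⟨x, rfl⟩ := hsurj y
      refine ⟨x, ?_, rfl⟩
      rw [mem_ball_zero_iff] at hy ⊢
      by_contra! h
      rw [hout x h, hn] at hy
      nlinarith
  have hd : ∀ x, HasFDerivAt T (l • ContinuousLinearMap.id ℝ E + fderiv ℝ f x) x := fun x => by
    have h1 : HasFDerivAt (fun x : E => l • x) (l • ContinuousLinearMap.id ℝ E) x :=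
      (hasFDerivAt_id x).const_smul l
    exact h1.add (hf.differentiable (by norm_num) x).hasFDerivAt
  rw [← himg, integral_image_eq_integral_abs_det_fderiv_smul μ measurableSet_ball
    (fun x _ => (hd x).hasFDerivWithinAt) hinj.injOn]
  refine setIntegral_congr_fun measurableSet_ball fun x _ => ?_
  have hp : 0 < (l • ContinuousLinearMap.id ℝ E + fderiv ℝ f x).det := by
    rw [NNReal.smul_def]
    exact det_pos_of _ ((norm_fderiv_le_of_lipschitz ℝ hlip).trans_lt (by exact_mod_cast hC))
  simp only [smul_eq_mul, abs_of_pos hp]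
  rw [mul_comm]

theorem poly_param {f : E → E} (hf : ContDiff ℝ 1 f) (R : ℝ)
    (P : MvPolynomial (Fin (Module.finrank ℝ E)) ℝ) :
    ∃ Q : Polynomial ℝ, ∀ l : ℝ, ∫ x in ball 0 R, MvPolynomial.eval (fun i => cof E i (l • x + f x)) P
      * (l • ContinuousLinearMap.id ℝ E + fderiv ℝ f x).det ∂μ = Q.eval l := by
  set b := Module.finBasis ℝ E with hb
  let M : Matrix (Fin (Module.finrank ℝ E)) (Fin (Module.finrank ℝ E)) C(E, ℝ) := fun i j =>
    ⟨fun x => b.repr (fderiv ℝ f x (b j)) i, by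
      have := hf.continuous_fderiv (by norm_num)
      exact (cof E i).continuous.comp (by fun_prop)⟩
  let fc : Fin (Module.finrank ℝ E) → C(E, ℝ) := fun i =>
    ⟨fun x => cof E i (f x), (cof E i).continuous.comp hf.continuous⟩
  let Q0 : Polynomial C(E, ℝ) :=
    MvPolynomial.aeval (fun i => Polynomial.X * Polynomial.C (cof E i) + Polynomial.C (fc i)) P
    * Matrix.det (Matrix.scalar _ Polynomial.X + M.map Polynomial.C)
  let ev : ℝ → E → (Polynomial C(E, ℝ) →ₐ[ℝ] ℝ) := fun l x =>
    (ContinuousMap.evalAlgHom ℝ ℝ x).comp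
      ((Polynomial.aeval (algebraMap ℝ C(E, ℝ) l) : Polynomial C(E, ℝ) →ₐ[C(E, ℝ)] C(E, ℝ)).restrictScalars ℝ)
  have evX : ∀ l x, ev l x Polynomial.X = l := fun l x => by simp [ev]
  have evC : ∀ l x a, ev l x (Polynomial.C a) = a x := fun l x a => by simp [ev]
  have key : ∀ l x, ev l x Q0 = MvPolynomial.eval (fun i => cof E i (l • x + f x)) P
      * (l • ContinuousLinearMap.id ℝ E + fderiv ℝ f x).det := by
    intro l x
    simp only [Q0, map_mul]
    congr 1
    · rw [← AlgHom.comp_apply, MvPolynomial.comp_aeval, ← MvPolynomial.coe_aeval_eq_eval]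
      change MvPolynomial.aeval _ P = MvPolynomial.aeval _ P
      congr 2
      funext i
      simp only [map_add, map_mul, evX, evC]
      change l * b.repr x i + b.repr (f x) i = b.repr (l • x + f x) i
      simp
    · rw [AlgHom.map_det, ContinuousLinearMap.det, ← LinearMap.det_toMatrix b]
      congr 1
      ext i j
      simp only [AlgHom.mapMatrix_apply, Matrix.map_apply, Matrix.add_apply, map_add, evC,
        LinearMap.toMatrix_apply]
      simp only [Matrix.scalar_apply, Matrix.diagonal_apply]
      by_cases hij : i = j
      · subst hij; simp [evX, M]; rfl
      · simp [hij, M]; rfl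
  refine ⟨∑ k ∈ Finset.range (Q0.natDegree + 1),
    Polynomial.monomial k (∫ x in ball 0 R, Q0.coeff k x ∂μ), fun l => ?_⟩
  simp_rw [← key]
  have : ∀ x, ev l x Q0 = ∑ k ∈ Finset.range (Q0.natDegree + 1), Q0.coeff k x * l ^ k := by
    intro x
    conv_lhs => rw [Q0.as_sum_range_C_mul_X_pow]
    simp [evX, evC]
  simp_rw [this, Polynomial.eval_finsetSum, Polynomial.eval_monomial]
  rw [integral_finsetSum]
  · exact Finset.sum_congr rfl fun k _ => integral_mul_const _ _
  · intro k _
    exact (((Q0.coeff k).continuous.mul continuous_const).continuousOn.integrableOn_compact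
      (isCompact_closedBall 0 R)).mono_set ball_subset_closedBall

theorem lemmaZ_poly {f : E → E} (hf : ContDiff ℝ 1 f) {R : ℝ} (hR : ∀ x, R ≤ ‖x‖ → f x = 0)
    (hE : 0 < Module.finrank ℝ E) (P : MvPolynomial (Fin (Module.finrank ℝ E)) ℝ) :
    ∫ x in ball 0 R, MvPolynomial.eval (fun i => cof E i (f x)) P * (fderiv ℝ f x).det ∂μ = 0 := by
  obtain ⟨Q, hQ⟩ := poly_param μ hf R P
  obtain ⟨Q', hQ'⟩ := poly_param μ (contDiff_const (c := (0 : E))) R P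
  have hcs : HasCompactSupport f := HasCompactSupport.of_support_subset_isCompact
    (isCompact_closedBall 0 R) fun x hx => by
      rw [mem_closedBall_zero_iff]; by_contra! h; exact hx (hR x h.le)
  obtain ⟨C, hC⟩ := hf.lipschitzWith_of_hasCompactSupport hcs (by norm_num)
  have hev : ∀ l : NNReal, C < l → Q.eval (l : ℝ) = Q'.eval (l : ℝ) := by
    intro l hl
    have e1 := cov_big μ hf hR (l := l) ⟨C, hl, hC⟩
      (fun y => MvPolynomial.eval (fun i => cof E i y) P)
    have e2 := cov_big μ (contDiff_const (c := (0 : E))) (R := R) (fun _ _ => rfl) (l := l)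
      ⟨0, (zero_le).trans_lt hl, LipschitzWith.const _⟩
      (fun y => MvPolynomial.eval (fun i => cof E i y) P)
    rw [← hQ, ← hQ']
    exact e1.trans e2.symm
  have hQQ : Q = Q' := by
    apply Polynomial.eq_of_infinite_eval_eq
    refine Set.Infinite.mono (s := Ioi (C : ℝ)) ?_ (Ioi_infinite _)
    intro l hl
    have hl0 : 0 ≤ l := C.2.trans (le_of_lt hl)
    exact hev ⟨l, hl0⟩ hl
  have h0 := hQ 0
  have h0' := hQ' 0
  rw [hQQ, ← h0'] at h0
  simp only [zero_smul, zero_add, fderiv_fun_const, Pi.zero_apply] at h0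
  rw [h0]
  have : ContinuousLinearMap.det (0 : E →L[ℝ] E) = 0 := by
    simp only [ContinuousLinearMap.det]
    simp [LinearMap.det_zero, hE.ne']
  simp [this]

theorem lemmaZ {f : E → E} (hf : ContDiff ℝ 1 f) {R : ℝ} (hR : ∀ x, R ≤ ‖x‖ → f x = 0)
    (hE : 0 < Module.finrank ℝ E) (ρ : E → ℝ) (hρ : Continuous ρ) :
    ∫ x in ball 0 R, ρ (f x) * (fderiv ℝ f x).det ∂μ = 0 := by
  have hdc : Continuous fun x => (fderiv ℝ f x).det :=
    ContinuousLinearMap.continuous_det.comp (hf.continuous_fderiv (by norm_num))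
  have hint : ∀ g : E → ℝ, Continuous g → IntegrableOn g (ball 0 R) μ := fun g hg =>
    (hg.continuousOn.integrableOn_compact (isCompact_closedBall 0 R)).mono_set ball_subset_closedBall
  set M := ∫ x in ball 0 R, |(fderiv ℝ f x).det| ∂μ
  have hM : 0 ≤ M := integral_nonneg fun _ => abs_nonneg _
  have hK : IsCompact (f '' closedBall 0 R) := (isCompact_closedBall 0 R).image hf.continuous
  rw [← abs_eq_zero]
  refine le_antisymm (le_of_forall_pos_le_add fun ε hε => ?_) (abs_nonneg _)
  obtain ⟨P, hP⟩ := cof_approx hK ⟨ρ, hρ⟩ (ε := ε / (M + 1)) (by positivity)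
  have hPc : Continuous fun x => MvPolynomial.eval (fun i => cof E i (f x)) P :=
    (cof_contDiff P).continuous.comp hf.continuous
  have h1 : ∫ x in ball 0 R, ρ (f x) * (fderiv ℝ f x).det ∂μ
      = ∫ x in ball 0 R, (ρ (f x) - MvPolynomial.eval (fun i => cof E i (f x)) P)
        * (fderiv ℝ f x).det ∂μ := by
    simp_rw [sub_mul]
    have i1 : IntegrableOn (fun x => ρ (f x) * (fderiv ℝ f x).det) (ball 0 R) μ :=
      hint _ ((hρ.comp hf.continuous).mul hdc)
    have i2 : IntegrableOn (fun x => MvPolynomial.eval (fun i => cof E i (f x)) P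
      * (fderiv ℝ f x).det) (ball 0 R) μ := hint _ (hPc.mul hdc)
    rw [integral_sub i1 i2, lemmaZ_poly μ hf hR hE P, sub_zero]
  rw [h1, zero_add]
  calc _ ≤ ∫ x in ball 0 R, |(ρ (f x) - MvPolynomial.eval (fun i => cof E i (f x)) P)
        * (fderiv ℝ f x).det| ∂μ := abs_integral_le_integral_abs
    _ ≤ ∫ x in ball 0 R, ε / (M + 1) * |(fderiv ℝ f x).det| ∂μ := by
        refine setIntegral_mono_on (hint _ ?_) (hint _ (by fun_prop)) measurableSet_ball ?_
        · exact (((hρ.comp hf.continuous).sub hPc).mul hdc).abs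
        · intro x hx
          rw [abs_mul]
          refine mul_le_mul_of_nonneg_right ?_ (abs_nonneg _)
          rw [abs_sub_comm]
          exact (hP _ ⟨x, ball_subset_closedBall hx, rfl⟩).le
    _ = ε * (M / (M + 1)) := by rw [integral_const_mul]; ring
    _ ≤ ε := by
        have : M / (M + 1) ≤ 1 := by rw [div_le_one (by positivity)]; linarith
        nlinarith

end Degree

section Degree2
variable {E : Type*} [NormedAddCommGroup E] [NormedSpace ℝ E] [FiniteDimensional ℝ E]

open scoped Manifold ContDiff in
theorem smooth_cut {s t : Set E} (hs : IsClosed s) (ht : IsClosed t) (hd : Disjoint s t) :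
    ∃ χ : E → ℝ, ContDiff ℝ 1 χ ∧ (∀ x ∈ s, ∀ᶠ y in 𝓝 x, χ y = 0) ∧
      (∀ x ∈ t, ∀ᶠ y in 𝓝 x, χ y = 1) ∧ ∀ x, χ x ∈ Icc (0 : ℝ) 1 := by
  obtain ⟨f, h0, h1, h2⟩ := exists_contMDiffMap_zero_one_nhds_of_isClosed (n := ⊤) 𝓘(ℝ, E) hs ht hd
  refine ⟨f, (contMDiff_iff_contDiff.1 f.contMDiff).of_le (by exact_mod_cast le_top),
    fun x hx => ?_, fun x hx => ?_, h2⟩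
  · exact (eventually_nhdsSet_iff_forall.1 h0) x hx
  · exact (eventually_nhdsSet_iff_forall.1 h1) x hx

variable [MeasurableSpace E] [BorelSpace E] (μ : Measure E) [μ.IsAddHaarMeasure]

noncomputable def bmp (x : E) : ℝ := (∫ y : E, max 0 (1/2 - ‖y‖) ∂μ)⁻¹ * max 0 (1/2 - ‖x‖)

theorem bmp_cont : Continuous (bmp μ) := by unfold bmp; fun_prop

theorem bmp_nonneg (x : E) : 0 ≤ bmp μ x :=
  mul_nonneg (inv_nonneg.2 (integral_nonneg fun _ => le_max_left _ _)) (le_max_left _ _)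

theorem bmp_zero {x : E} (hx : 1/2 ≤ ‖x‖) : bmp μ x = 0 := by
  simp only [bmp]; rw [max_eq_left (by linarith), mul_zero]

theorem bmp_int : ∫ x, bmp μ x ∂μ = 1 := by
  unfold bmp
  rw [integral_const_mul]
  refine inv_mul_cancel₀ (ne_of_gt ?_)
  have hc : Continuous fun y : E => max 0 (1/2 - ‖y‖) := by fun_prop
  refine hc.integral_pos_of_hasCompactSupport_nonneg_nonzero
    (x := 0) ?_ (fun _ => le_max_left _ _) (by norm_num)
  refine HasCompactSupport.of_support_subset_isCompact (isCompact_closedBall 0 1) fun x hx => ?_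
  rw [mem_closedBall_zero_iff]; by_contra! h
  exact hx (max_eq_left (by linarith))

noncomputable def Ig (Ω : Set E) (g : E → E) : ℝ := ∫ x in Ω, bmp μ (g x) * (fderiv ℝ g x).det ∂μ

theorem Ig_cont {g : E → E} (hg : ContDiff ℝ 1 g) :
    Continuous fun x => bmp μ (g x) * (fderiv ℝ g x).det :=
  ((bmp_cont μ).comp hg.continuous).mul
    (ContinuousLinearMap.continuous_det.comp (hg.continuous_fderiv (by norm_num)))

theorem Ig_integrable {g : E → E} (hg : ContDiff ℝ 1 g) {Ω : Set E} (hb : Bornology.IsBounded Ω) :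
    IntegrableOn (fun x => bmp μ (g x) * (fderiv ℝ g x).det) Ω μ :=
  ((Ig_cont μ hg).continuousOn.integrableOn_compact hb.isCompact_closure).mono_set subset_closure

theorem Ig_homotopy (hE : 0 < Module.finrank ℝ E) {Ω : Set E} (hΩ : IsOpen Ω)
    (hb : Bornology.IsBounded Ω)
    {g0 g1 : E → E} (h0 : ContDiff ℝ 1 g0) (h1 : ContDiff ℝ 1 g1)
    (h : ∀ x ∈ frontier Ω, ∀ t ∈ Icc (0 : ℝ) 1, 1 ≤ ‖(1 - t) • g0 x + t • g1 x‖) :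
    Ig μ Ω g0 = Ig μ Ω g1 := by
  obtain ⟨R, hR⟩ := hb.isCompact_closure.isBounded.subset_ball 0
  set A : Set E := Prod.snd '' {p : ℝ × E | p ∈ Icc (0 : ℝ) 1 ×ˢ closure Ω ∧
    ‖(1 - p.1) • g0 p.2 + p.1 • g1 p.2‖ ≤ 1/2} with hA
  have hAc : IsCompact A := by
    refine IsCompact.image ?_ continuous_snd
    have := h0.continuous; have := h1.continuous
    have hcl : IsClosed {p : ℝ × E | ‖(1 - p.1) • g0 p.2 + p.1 • g1 p.2‖ ≤ 1/2} :=
      isClosed_le (by fun_prop) continuous_const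
    exact (isCompact_Icc.prod hb.isCompact_closure).inter_right hcl
  have hAΩ : A ⊆ Ω := by
    rintro x ⟨⟨t, y⟩, ⟨⟨ht, hy⟩, hn⟩, rfl⟩
    by_contra hx
    have : y ∈ frontier Ω := by rw [hΩ.frontier_eq]; exact ⟨hy, hx⟩
    have := h y this t ht
    simp only at hn
    linarith
  obtain ⟨χ, hχ, χ0, χ1, χI⟩ := smooth_cut hΩ.isClosed_compl hAc.isClosed
    (disjoint_left.2 fun x hx hxA => hx (hAΩ hxA))
  obtain ⟨θ, hθ, θ0, θ1, θI⟩ := smooth_cut (isOpen_ball (x := (0:E)) (ε := R)).isClosed_compl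
    (isClosed_closure (s := Ω)) (disjoint_left.2 fun x hx hxA => hx (hR hxA))
  set f0 : E → E := fun x => θ x • g0 x with hf0
  set f1 : E → E := fun x => θ x • g0 x + χ x • (g1 x - g0 x) with hf1
  have cf0 : ContDiff ℝ 1 f0 := hθ.smul h0
  have cf1 : ContDiff ℝ 1 f1 := (hθ.smul h0).add (hχ.smul (h1.sub h0))
  have out : ∀ x, R ≤ ‖x‖ → x ∈ (ball (0:E) R)ᶜ := fun x hx => by simpa using hx
  have out' : ∀ x, R ≤ ‖x‖ → x ∈ Ωᶜ := fun x hx hx' =>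
    out x hx (hR (subset_closure hx'))
  have z0 : Ig μ (ball 0 R) f0 = 0 := lemmaZ μ cf0
    (fun x hx => by simp [hf0, (θ0 x (out x hx)).self_of_nhds]) hE _ (bmp_cont μ)
  have z1 : Ig μ (ball 0 R) f1 = 0 := lemmaZ μ cf1
    (fun x hx => by
      simp [hf1, (θ0 x (out x hx)).self_of_nhds, (χ0 x (out' x hx)).self_of_nhds]) hE _ (bmp_cont μ)
  have sub : Ω ⊆ ball 0 R := subset_closure.trans hR
  have split : ∀ {f : E → E}, ContDiff ℝ 1 f → Ig μ (ball 0 R) f = Ig μ Ω f + Ig μ (ball 0 R \ Ω) f := by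
    intro f hf
    unfold Ig
    rw [← setIntegral_union disjoint_sdiff_right (measurableSet_ball.diff hΩ.measurableSet)
      (Ig_integrable μ hf hb) (Ig_integrable μ hf (isBounded_ball.subset sdiff_subset)),
      union_sdiff_cancel sub]
  have e2 : Ig μ (ball 0 R \ Ω) f0 = Ig μ (ball 0 R \ Ω) f1 := by
    refine setIntegral_congr_fun (measurableSet_ball.diff hΩ.measurableSet) fun x hx => ?_
    have : f0 =ᶠ[𝓝 x] f1 := (χ0 x hx.2).mono fun y hy => by simp [hf0, hf1, hy]
    simp only [this.eq_of_nhds, this.fderiv_eq]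
  have e0 : Ig μ Ω f0 = Ig μ Ω g0 := by
    refine setIntegral_congr_fun hΩ.measurableSet fun x hx => ?_
    have : f0 =ᶠ[𝓝 x] g0 := (θ1 x (subset_closure hx)).mono fun y hy => by simp [hf0, hy]
    simp only [this.eq_of_nhds, this.fderiv_eq]
  have e1 : Ig μ Ω f1 = Ig μ Ω g1 := by
    refine setIntegral_congr_fun hΩ.measurableSet fun x hx => ?_
    have hθx := θ1 x (subset_closure hx)
    by_cases hxA : x ∈ A
    · have : f1 =ᶠ[𝓝 x] g1 := by
        filter_upwards [hθx, χ1 x hxA] with y hy hy'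
        simp [hf1, hy, hy']
      simp only [this.eq_of_nhds, this.fderiv_eq]
    · have hn : ∀ t ∈ Icc (0:ℝ) 1, 1/2 ≤ ‖(1 - t) • g0 x + t • g1 x‖ := by
        intro t ht; by_contra! h'
        exact hxA ⟨(t, x), ⟨⟨ht, subset_closure hx⟩, h'.le⟩, rfl⟩
      have b1 : bmp μ (f1 x) = 0 := by
        apply bmp_zero
        convert hn (χ x) (χI x) using 2
        simp only [hf1, hθx.self_of_nhds]; module
      have b2 : bmp μ (g1 x) = 0 := by
        apply bmp_zero
        simpa using hn 1 (by simp)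
      simp only [b1, b2, zero_mul]
  have := split cf0; have := split cf1
  linarith

def IsDeg (Ω : Set E) (f : E → E) (d : ℝ) : Prop :=
  ∃ c : ℝ, 0 < c ∧ ∃ g, ContDiff ℝ 1 g ∧ (∀ x ∈ frontier Ω, ‖g x - c • f x‖ + 1 ≤ c * ‖f x‖) ∧
    Ig μ Ω g = d

theorem isDeg_unique (hE : 0 < Module.finrank ℝ E) {Ω : Set E} (hΩ : IsOpen Ω)
    (hb : Bornology.IsBounded Ω) {f : E → E} {d d' : ℝ} (h : IsDeg μ Ω f d) (h' : IsDeg μ Ω f d') :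
    d = d' := by
  obtain ⟨c, hc, g, hg, hgf, rfl⟩ := h
  obtain ⟨c', hc', g', hg', hgf', rfl⟩ := h'
  refine Ig_homotopy μ hE hΩ hb hg hg' fun x hx t ht => ?_
  have h1 := hgf x hx
  have h2 := hgf' x hx
  have t0 := ht.1
  have t1 : 0 ≤ 1 - t := by linarith [ht.2]
  have e : ((1 - t) * c + t * c') • f x = ((1 - t) • g x + t • g' x)
     - ((1 - t) • (g x - c • f x) + t • (g' x - c' • f x)) := by module
  have n1 : ‖((1 - t) * c + t * c') • f x‖ = ((1 - t) * c + t * c') * ‖f x‖ := by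
    rw [norm_smul, Real.norm_of_nonneg (by positivity)]
  have n2 : ‖(1 - t) • (g x - c • f x) + t • (g' x - c' • f x)‖ ≤
      (1 - t) * ‖g x - c • f x‖ + t * ‖g' x - c' • f x‖ := by
    refine (norm_add_le _ _).trans ?_
    rw [norm_smul, norm_smul, Real.norm_of_nonneg t0, Real.norm_of_nonneg t1]
  have n3 := norm_sub_le ((1 - t) • g x + t • g' x)
    ((1 - t) • (g x - c • f x) + t • (g' x - c' • f x))
  rw [← e, n1] at n3
  nlinarith

open Classical in
noncomputable def deg (Ω : Set E) (f : E → E) : ℝ :=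
  if h : ∃ d, IsDeg μ Ω f d then h.choose else 0

theorem IsDeg.deg_eq (hE : 0 < Module.finrank ℝ E) {Ω : Set E} (hΩ : IsOpen Ω)
    (hb : Bornology.IsBounded Ω) {f : E → E} {d : ℝ} (h : IsDeg μ Ω f d) : deg μ Ω f = d := by
  have hex : ∃ d, IsDeg μ Ω f d := ⟨d, h⟩
  rw [deg, dif_pos hex]
  exact isDeg_unique μ hE hΩ hb hex.choose_spec h

theorem norm_lb {X F : Type*} [TopologicalSpace X] [NormedAddCommGroup F] {K : Set X}
    (hK : IsCompact K) {f : X → F} (hf : ContinuousOn f K) (h0 : ∀ x ∈ K, f x ≠ 0) :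
    ∃ m > 0, ∀ x ∈ K, m ≤ ‖f x‖ := by
  rcases K.eq_empty_or_nonempty with rfl | hne
  · exact ⟨1, one_pos, by simp⟩
  · obtain ⟨x, hx, hmin⟩ := hK.exists_isMinOn hne hf.norm
    exact ⟨‖f x‖, norm_pos_iff.2 (h0 x hx), fun y hy => hmin hy⟩

theorem exists_approx_deg {K : Set E} (hK : IsCompact K) {f : E → E} (hf : ContinuousOn f K)
    {K0 : Set E} (hK0 : IsCompact K0) (hs : K0 ⊆ K) (h0 : ∀ x ∈ K0, f x ≠ 0) :
    ∃ c : ℝ, 0 < c ∧ ∃ g, ContDiff ℝ 1 g ∧ (∀ x ∈ K0, ‖g x - c • f x‖ + 1 ≤ c * ‖f x‖) := by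
  obtain ⟨m, hm, hmf⟩ := norm_lb hK0 (hf.mono hs) h0
  obtain ⟨g, hg, hgf⟩ := approxE hK (fun x => (2 / m) • f x) (hf.const_smul _) one_pos
  refine ⟨2 / m, by positivity, g, hg, fun x hx => ?_⟩
  have h1 := hgf x (hs hx)
  have h2 : 2 ≤ 2 / m * ‖f x‖ := by
    rw [div_mul_eq_mul_div, le_div_iff₀ hm]; linarith [hmf x hx]
  linarith

theorem frontier_compact {Ω : Set E} (hb : Bornology.IsBounded Ω) : IsCompact (frontier Ω) :=
  hb.isCompact_closure.of_isClosed_subset isClosed_frontier frontier_subset_closure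

theorem deg_homotopy (hE : 0 < Module.finrank ℝ E) {Ω : Set E} (hΩ : IsOpen Ω)
    (hb : Bornology.IsBounded Ω) (H : ℝ → E → E)
    (hc : ContinuousOn (fun p : ℝ × E => H p.1 p.2) (Icc (0 : ℝ) 1 ×ˢ frontier Ω))
    (h0 : ∀ t ∈ Icc (0 : ℝ) 1, ∀ x ∈ frontier Ω, H t x ≠ 0) :
    deg μ Ω (H 0) = deg μ Ω (H 1) := by
  have hF := frontier_compact hb
  have hcomp := isCompact_Icc (a := (0:ℝ)) (b := 1) |>.prod hF
  obtain ⟨m, hm, hmf⟩ := norm_lb hcomp hc (fun p hp => h0 p.1 hp.1 p.2 hp.2)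
  have huc := hcomp.uniformContinuousOn_of_continuous hc
  set c := 3 / m with hcdef
  have hcp : 0 < c := by positivity
  obtain ⟨δ, hδ, hδf⟩ := Metric.uniformContinuousOn_iff.1 huc (1 / c) (by positivity)
  have loc : ∀ s ∈ Icc (0:ℝ) 1, ∀ t ∈ Icc (0:ℝ) 1, |s - t| < δ → deg μ Ω (H s) = deg μ Ω (H t) := by
    intro s hs t ht hst
    have hcs : ContinuousOn (H s) (frontier Ω) :=
      hc.comp (Continuous.continuousOn (by fun_prop : Continuous fun x : E => (s, x)))
        (fun x hx => ⟨hs, hx⟩)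
    obtain ⟨g, hg, hgf⟩ := approxE hF (fun x => c • H s x) (hcs.const_smul _) one_pos
    have hcm : ∀ u ∈ Icc (0:ℝ) 1, ∀ x ∈ frontier Ω, 3 ≤ c * ‖H u x‖ := by
      intro u hu x hx
      have := hmf (u, x) ⟨hu, hx⟩
      simp only at this
      rw [hcdef, div_mul_eq_mul_div, le_div_iff₀ hm]; linarith
    have d1 : IsDeg μ Ω (H s) (Ig μ Ω g) := ⟨c, hcp, g, hg, fun x hx => by
      have := hgf x hx; have := hcm s hs x hx; linarith, rfl⟩
    have d2 : IsDeg μ Ω (H t) (Ig μ Ω g) := ⟨c, hcp, g, hg, fun x hx => by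
      have h1 := hgf x hx; have h2 := hcm t ht x hx
      have h3 := hδf (s, x) ⟨hs, hx⟩ (t, x) ⟨ht, hx⟩ (by simpa [Prod.dist_eq, Real.dist_eq] using hst)
      simp only [dist_eq_norm] at h3
      have h4 : ‖g x - c • H t x‖ ≤ ‖g x - c • H s x‖ + c * ‖H s x - H t x‖ := by
        calc ‖g x - c • H t x‖ = ‖(g x - c • H s x) + c • (H s x - H t x)‖ := by congr 1; module
          _ ≤ _ := by
            refine (norm_add_le _ _).trans ?_
            rw [norm_smul, Real.norm_of_nonneg hcp.le]
      have h5 : c * ‖H s x - H t x‖ ≤ 1 := by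
        have := mul_le_mul_of_nonneg_left h3.le hcp.le
        rwa [mul_one_div_cancel hcp.ne'] at this
      linarith, rfl⟩
    rw [d1.deg_eq μ hE hΩ hb, d2.deg_eq μ hE hΩ hb]
  obtain ⟨N, hN⟩ := exists_nat_one_div_lt hδ
  have hN1 : (0:ℝ) < N + 1 := by positivity
  have step : ∀ k : ℕ, k ≤ N + 1 → deg μ Ω (H 0) = deg μ Ω (H (k / (N + 1))) := by
    intro k
    induction k with
    | zero => simp
    | succ k ih =>
      intro hk
      have hk' : (k : ℝ) + 1 ≤ N + 1 := by exact_mod_cast hk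
      rw [ih (by omega)]
      refine loc _ ⟨by positivity, ?_⟩ _ ⟨by positivity, ?_⟩ ?_
      · rw [div_le_one hN1]; linarith
      · rw [div_le_one hN1]; push_cast; linarith
      · rw [← sub_div]; push_cast
        rw [sub_add_cancel_left, abs_div, abs_neg, abs_one, abs_of_pos hN1]; exact hN
  have := step (N + 1) le_rfl
  rwa [Nat.cast_add, Nat.cast_one, div_self hN1.ne'] at this

theorem deg_eq_zero (hE : 0 < Module.finrank ℝ E) {Ω : Set E} (hΩ : IsOpen Ω)
    (hb : Bornology.IsBounded Ω) {f : E → E} (hf : ContinuousOn f (closure Ω))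
    (h0 : ∀ x ∈ closure Ω, f x ≠ 0) : deg μ Ω f = 0 := by
  obtain ⟨c, hc, g, hg, hgf⟩ := exists_approx_deg hb.isCompact_closure hf hb.isCompact_closure
    subset_rfl h0
  have : IsDeg μ Ω f 0 := by
    refine ⟨c, hc, g, hg, fun x hx => hgf x (frontier_subset_closure hx), ?_⟩
    refine setIntegral_eq_zero_of_forall_eq_zero fun x hx => ?_
    rw [bmp_zero, zero_mul]
    have h1 := hgf x (subset_closure hx)
    have h2 := norm_sub_norm_le (c • f x) (g x)
    rw [norm_sub_rev, norm_smul, Real.norm_of_nonneg hc.le] at h2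
    linarith
  exact this.deg_eq μ hE hΩ hb

theorem deg_add (hE : 0 < Module.finrank ℝ E) {Ω Ω1 Ω2 : Set E} (hΩ : IsOpen Ω)
    (hΩ1 : IsOpen Ω1) (hΩ2 : IsOpen Ω2) (s1 : Ω1 ⊆ Ω) (s2 : Ω2 ⊆ Ω) (hd : Disjoint Ω1 Ω2)
    (hb : Bornology.IsBounded Ω) {f : E → E} (hf : ContinuousOn f (closure Ω))
    (h0 : ∀ x ∈ closure Ω, x ∉ Ω1 → x ∉ Ω2 → f x ≠ 0) :
    deg μ Ω f = deg μ Ω1 f + deg μ Ω2 f := by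
  set K0 := closure Ω \ (Ω1 ∪ Ω2)
  have hK0 : IsCompact K0 := hb.isCompact_closure.diff (hΩ1.union hΩ2)
  obtain ⟨c, hc, g, hg, hgf⟩ := exists_approx_deg hb.isCompact_closure hf hK0
    sdiff_subset fun x hx => h0 x hx.1 (fun h => hx.2 (.inl h)) (fun h => hx.2 (.inr h))
  have f0 : frontier Ω ⊆ K0 := fun x hx => ⟨hx.1, fun h => by
    rw [hΩ.frontier_eq] at hx; exact hx.2 (h.elim (fun h => s1 h) fun h => s2 h)⟩
  have f1 : frontier Ω1 ⊆ K0 := fun x hx => ⟨closure_mono s1 hx.1, fun h => by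
    rw [hΩ1.frontier_eq] at hx
    exact h.elim hx.2 fun h => (hd.closure_left hΩ2).le_bot ⟨hx.1, h⟩⟩
  have f2 : frontier Ω2 ⊆ K0 := fun x hx => ⟨closure_mono s2 hx.1, fun h => by
    rw [hΩ2.frontier_eq] at hx
    exact h.elim (fun h => (hd.closure_right hΩ1).le_bot ⟨h, hx.1⟩) hx.2⟩
  have d0 : IsDeg μ Ω f (Ig μ Ω g) := ⟨c, hc, g, hg, fun x hx => hgf x (f0 hx), rfl⟩
  have d1 : IsDeg μ Ω1 f (Ig μ Ω1 g) := ⟨c, hc, g, hg, fun x hx => hgf x (f1 hx), rfl⟩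
  have d2 : IsDeg μ Ω2 f (Ig μ Ω2 g) := ⟨c, hc, g, hg, fun x hx => hgf x (f2 hx), rfl⟩
  rw [d0.deg_eq μ hE hΩ hb, d1.deg_eq μ hE hΩ1 (hb.subset s1), d2.deg_eq μ hE hΩ2 (hb.subset s2)]
  unfold Ig
  rw [← setIntegral_union hd hΩ2.measurableSet (Ig_integrable μ hg (hb.subset s1))
    (Ig_integrable μ hg (hb.subset s2))]
  refine setIntegral_eq_of_subset_of_forall_sdiff_eq_zero hΩ.measurableSet (union_subset s1 s2) ?_
  intro x hx
  have h1 := hgf x ⟨subset_closure hx.1, hx.2⟩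
  rw [bmp_zero, zero_mul]
  have h2 := norm_sub_norm_le (c • f x) (g x)
  rw [norm_sub_rev, norm_smul, Real.norm_of_nonneg hc.le] at h2
  linarith

theorem deg_sub_const (hE : 0 < Module.finrank ℝ E) {Ω : Set E} (hΩ : IsOpen Ω)
    (hb : Bornology.IsBounded Ω) {a : E} (ha : a ∈ Ω) : deg μ Ω (fun x => x - a) = 1 := by
  obtain ⟨r, hr, hrΩ⟩ := Metric.isOpen_iff.1 hΩ a ha
  have hfar : ∀ x, x ∉ Ω → r ≤ ‖x - a‖ := fun x hx => by
    by_contra! h; exact hx (hrΩ (by rwa [mem_ball, dist_eq_norm]))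
  have hrp : 0 < 1 / r := by positivity
  have hdet : ∀ x, (fderiv ℝ (fun x : E => (1/r) • (x - a)) x).det = (1/r) ^ Module.finrank ℝ E := by
    intro x
    have : HasFDerivAt (fun x : E => (1/r) • (x - a)) ((1/r) • ContinuousLinearMap.id ℝ E) x :=
      ((hasFDerivAt_id x).sub_const a).const_smul _
    rw [this.fderiv, ContinuousLinearMap.det]
    simp only [ContinuousLinearMap.toLinearMap_smul, ContinuousLinearMap.coe_id]
    rw [LinearMap.det_smul, LinearMap.det_id, mul_one]
  have : IsDeg μ Ω (fun x => x - a) 1 := by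
    refine ⟨1 / r, hrp, fun x => (1/r) • (x - a), by fun_prop, fun x hx => ?_, ?_⟩
    · rw [hΩ.frontier_eq] at hx
      rw [sub_self, norm_zero, zero_add, one_div_mul_eq_div, le_div_iff₀ hr, one_mul]
      exact hfar x hx.2
    · unfold Ig
      simp_rw [hdet]
      rw [setIntegral_eq_integral_of_forall_compl_eq_zero, integral_mul_const,
        integral_sub_right_eq_self (fun x => bmp μ ((1/r) • x)) a,
        Measure.integral_comp_smul, bmp_int, smul_eq_mul, mul_one, abs_of_pos (by positivity)]
      · exact inv_mul_cancel₀ (by positivity)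
      · intro x hx
        rw [bmp_zero, zero_mul]
        rw [norm_smul, Real.norm_of_nonneg hrp.le, one_div_mul_eq_div, le_div_iff₀ hr]
        linarith [hfar x hx]
  exact this.deg_eq μ hE hΩ hb

theorem deg_congr {Ω : Set E} {f f' : E → E} (h : EqOn f f' (frontier Ω)) :
    deg μ Ω f = deg μ Ω f' := by
  have : IsDeg μ Ω f = IsDeg μ Ω f' := by
    funext d
    unfold IsDeg
    apply propext
    refine exists_congr fun c => and_congr_right fun _ => exists_congr fun g =>
      and_congr_right fun _ => and_congr_left fun _ => forall₂_congr fun x hx => ?_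
    rw [h hx]
  unfold deg
  rw [this]

end Degree2

section Degree3
variable {E : Type*} [NormedAddCommGroup E] [NormedSpace ℝ E] [FiniteDimensional ℝ E]
variable [MeasurableSpace E] [BorelSpace E] (μ : Measure E) [μ.IsAddHaarMeasure]

theorem local_one {G : E → E} (hG : ContDiff ℝ 1 G) {V : Set E} (hV : IsOpen V)
    (hi : InjOn G V) (hb : ball 0 (1/2) ⊆ G '' V) :
    ∫ x in V, |bmp μ (G x) * (fderiv ℝ G x).det| ∂μ = 1 := by
  have h := integral_image_eq_integral_abs_det_fderiv_smul μ hV.measurableSet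
    (fun x _ => (hG.differentiable (by norm_num) x).hasFDerivAt.hasFDerivWithinAt) hi (bmp μ)
  rw [setIntegral_eq_integral_of_forall_compl_eq_zero, bmp_int] at h
  · rw [h]
    refine setIntegral_congr_fun hV.measurableSet fun x _ => ?_
    simp only [smul_eq_mul]
    rw [abs_mul, abs_of_nonneg (bmp_nonneg μ _), mul_comm]
  · intro y hy
    apply bmp_zero; by_contra! h'
    exact hy (hb (by simpa using h'))

end Degree3

section Degree4
variable {E : Type*} [NormedAddCommGroup E] [InnerProductSpace ℂ E] [FiniteDimensional ℂ E]
variable [MeasurableSpace E] [BorelSpace E] (μ : Measure E) [μ.IsAddHaarMeasure]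

theorem det_real_nonneg (A : E →L[ℂ] E) : 0 ≤ (A.restrictScalars ℝ).det := by
  have : (A.restrictScalars ℝ).det = Algebra.norm ℝ (LinearMap.det (A : E →ₗ[ℂ] E)) := by
    rw [← LinearMap.det_restrictScalars]; rfl
  rw [this, Algebra.norm_complex_apply]
  exact Complex.normSq_nonneg _

theorem deg_conj_ne_one (hE : 0 < Module.finrank ℝ E) {h : E → E} (hh : ContDiff ℂ 1 h) {m : ℕ}
    (hm : 2 ≤ m) (hhom : ∀ (c : ℂ) x, h (c • x) = c ^ m • h x) (h0 : ∀ x, x ≠ 0 → h x ≠ 0)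
    (J : E →L[ℝ] E) (hJ : ∀ x, J (J x) = x) {ε : ℝ} (hε : 0 < ε) :
    deg μ (ball 0 ε) (fun x => J (h x)) ≠ 1 := by
  haveI : FiniteDimensional ℝ E := FiniteDimensional.complexToReal E
  have hhR : ContDiff ℝ 1 h := hh.restrict_scalars ℝ
  set g : E → E := fun x => J (h x) with hg
  have hgc : ContDiff ℝ 1 g := J.contDiff.comp hhR
  have hbΩ : Bornology.IsBounded (ball (0:E) ε) := isBounded_ball
  have hJ0 : ∀ y, J y = 0 → y = 0 := fun y hy => by rw [← hJ y, hy, map_zero]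
  have hfr : ∀ x ∈ frontier (ball (0:E) ε), g x ≠ 0 := by
    intro x hx hgx
    rw [frontier_ball _ hε.ne'] at hx
    refine h0 x ?_ (hJ0 _ hgx)
    rintro rfl; simp at hx; exact hε.ne hx
  obtain ⟨r0, hr0, hr0g⟩ := norm_lb (frontier_compact hbΩ) hgc.continuous.continuousOn hfr
  have hdg : ∀ x, fderiv ℝ g x = J.comp ((fderiv ℂ h x).restrictScalars ℝ) := by
    intro x
    have h1 : HasFDerivAt h ((fderiv ℂ h x).restrictScalars ℝ) x :=
      (hh.differentiable (by norm_num) x).hasFDerivAt.restrictScalars ℝ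
    exact (J.hasFDerivAt.comp x h1).fderiv
  have hdetg : ∀ x, (fderiv ℝ g x).det = J.det * ((fderiv ℂ h x).restrictScalars ℝ).det := by
    intro x; rw [hdg]; simp only [ContinuousLinearMap.det]; rw [← LinearMap.det_comp]; rfl
  have hJdet : J.det ≠ 0 := by
    have h1 : (J : E →ₗ[ℝ] E) ∘ₗ (J : E →ₗ[ℝ] E) = LinearMap.id := by ext x; exact hJ x
    have h2 := congrArg LinearMap.det h1
    rw [LinearMap.det_comp, LinearMap.det_id] at h2
    intro h3; rw [ContinuousLinearMap.det] at h3; rw [h3] at h2; simp at h2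
  have hdeg : ∀ (c : ℝ) (w : E), 0 < c → c * ‖w‖ + 1 ≤ c * r0 →
      deg μ (ball 0 ε) g = Ig μ (ball 0 ε) (fun x => c • (g x - w)) := by
    intro c w hc hcw
    refine IsDeg.deg_eq μ hE isOpen_ball hbΩ ⟨c, hc, _, by fun_prop, fun x hx => ?_, rfl⟩
    have : c • (g x - w) - c • g x = -(c • w) := by module
    rw [this, norm_neg, norm_smul, Real.norm_of_nonneg hc.le]
    have := mul_le_mul_of_nonneg_left (hr0g x hx) hc.le
    linarith
  have hdetG : ∀ (c : ℝ) (w x : E), (fderiv ℝ (fun x => c • (g x - w)) x).det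
      = c ^ Module.finrank ℝ E * (J.det * ((fderiv ℂ h x).restrictScalars ℝ).det) := by
    intro c w x
    rw [← hdetg]
    have : fderiv ℝ (fun x => c • (g x - w)) x = c • fderiv ℝ g x :=
      (((hgc.differentiable (by norm_num) x).hasFDerivAt.sub_const w).const_smul c).fderiv
    rw [this]; simp only [ContinuousLinearMap.det, ContinuousLinearMap.toLinearMap_smul]
    rw [LinearMap.det_smul]
  by_cases hD : ∀ x, ((fderiv ℂ h x).restrictScalars ℝ).det = 0
  · rw [hdeg (1 / r0) 0 (by positivity) (by simp [hr0.ne'])]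
    unfold Ig
    simp only [hdetG, hD, mul_zero, integral_zero]; norm_num
  push Not at hD
  obtain ⟨x0', hx0'⟩ := hD
  have hscale : ∀ (c : ℂ), c ≠ 0 → ∀ x, fderiv ℂ h (c • x) = c ^ (m - 1) • fderiv ℂ h x := by
    intro c hc x
    have e1 : HasFDerivAt (fun y => h (c • y)) ((fderiv ℂ h (c • x)).comp (c • ContinuousLinearMap.id ℂ E)) x :=
      (hh.differentiable (by norm_num) (c • x)).hasFDerivAt.comp x ((hasFDerivAt_id x).const_smul c)
    have e2 : HasFDerivAt (fun y => h (c • y)) (c ^ m • fderiv ℂ h x) x := by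
      simp_rw [hhom]
      exact (hh.differentiable (by norm_num) x).hasFDerivAt.const_smul _
    have e3 := e1.unique e2
    ext v
    have := DFunLike.congr_fun e3 v
    simp at this ⊢
    have hm' : c ^ m = c * c ^ (m - 1) := by rw [← pow_succ']; congr 1; omega
    rw [hm', mul_smul] at this
    exact smul_right_injective E hc this
  have hx00 : x0' ≠ 0 := by
    rintro rfl
    have e := hscale 2 two_ne_zero 0
    rw [smul_zero] at e
    have e' : ((1:ℂ) - 2 ^ (m-1)) • fderiv ℂ h 0 = 0 := by
      rw [sub_smul, ← e, one_smul, sub_self]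
    rcases smul_eq_zero.1 e' with e'' | e''
    · have : (2:ℂ)^(m-1) = ((2 ^ (m-1) : ℕ) : ℂ) := by push_cast; rfl
      rw [this, sub_eq_zero, eq_comm, Nat.cast_eq_one] at e''
      have := Nat.one_lt_two_pow (n := m-1) (by omega)
      omega
    · apply hx0'; rw [e'']
      change LinearMap.det ((0 : E →ₗ[ℂ] E).restrictScalars ℝ) = 0
      simp [LinearMap.det_zero, hE.ne']
  obtain ⟨l, hl0, hlε, hlw⟩ : ∃ l : ℝ, 0 < l ∧ ‖l • x0'‖ < ε ∧ ‖g (l • x0')‖ < r0 / 2 := by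
    have c1 : Tendsto (fun l : ℝ => ‖l • x0'‖) (𝓝[>] 0) (𝓝 0) := by
      have : Continuous fun l : ℝ => ‖l • x0'‖ := by fun_prop
      have h := (this.continuousWithinAt (s := Ioi 0) (x := 0)).tendsto
      simpa using h
    have g0 : g 0 = 0 := by
      have := hhom 0 0; rw [zero_smul, zero_pow (by omega), zero_smul] at this
      simp [hg, this]
    have c2 : Tendsto (fun l : ℝ => ‖g (l • x0')‖) (𝓝[>] 0) (𝓝 0) := by
      have : Continuous fun l : ℝ => ‖g (l • x0')‖ := by
        have := hgc.continuous; fun_prop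
      have h := (this.continuousWithinAt (s := Ioi 0) (x := 0)).tendsto
      simpa [g0] using h
    have : ∀ᶠ l in 𝓝[>] (0:ℝ), l ∈ Ioi (0:ℝ) := self_mem_nhdsWithin
    obtain ⟨l, ⟨h2, h3⟩, h1⟩ := (((c1.eventually_lt_const hε).and
      (c2.eventually_lt_const (half_pos hr0))).and this).exists
    exact ⟨l, h1, h2, h3⟩
  set x0 := l • x0' with hx0
  have hx0ne : x0 ≠ 0 := smul_ne_zero hl0.ne' hx00
  have hx0d : (fderiv ℝ g x0).det ≠ 0 := by
    rw [hdetg]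
    refine mul_ne_zero hJdet ?_
    have : x0 = (l : ℂ) • x0' := by rw [hx0]; exact (Complex.coe_smul l x0').symm
    rw [this, hscale _ (by exact_mod_cast hl0.ne')]
    have e : (((l : ℂ) ^ (m-1) • fderiv ℂ h x0').restrictScalars ℝ) =
        ((l ^ (m - 1) : ℝ) • (fderiv ℂ h x0').restrictScalars ℝ) := by
      ext v; simp [← Complex.ofReal_pow]
    rw [e]; simp only [ContinuousLinearMap.det, ContinuousLinearMap.toLinearMap_smul]
    rw [LinearMap.det_smul]
    exact mul_ne_zero (by positivity) hx0'
  set ω : ℂ := Complex.exp (2 * Real.pi * Complex.I / m) with hω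
  have hprim := Complex.isPrimitiveRoot_exp m (by omega)
  have hω1 : ω ≠ 1 := hprim.ne_one (by omega)
  have hωm : ω ^ m = 1 := hprim.pow_eq_one
  have hωn : ‖ω‖ = 1 := hprim.norm'_eq_one (by omega)
  have hω0 : ω ≠ 0 := by intro h; rw [h, norm_zero] at hωn; exact zero_ne_one hωn
  have hgω : ∀ x, g (ω • x) = g x := fun x => by simp [hg, hhom, hωm]
  have hne : ω • x0 ≠ x0 := by
    intro h
    have : (ω - 1) • x0 = 0 := by rw [sub_smul, h, one_smul, sub_self]
    exact (smul_ne_zero (sub_ne_zero.2 hω1) hx0ne) this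
  let A : E ≃L[ℝ] E := ContinuousLinearEquiv.ofBijective (fderiv ℝ g x0)
    (LinearMap.ker_eq_bot.2 ((LinearMap.equivOfDetNeZero _ hx0d).injective))
    (LinearMap.range_eq_top.2 ((LinearMap.equivOfDetNeZero _ hx0d).surjective))
  have hst : HasStrictFDerivAt g (A : E →L[ℝ] E) x0 :=
    hgc.contDiffAt.hasStrictFDerivAt (by norm_num)
  set Φ := hst.toOpenPartialHomeomorph g
  have hΦ : ∀ x, Φ x = g x := fun x => by simp [Φ]
  have hcω : Continuous fun x : E => ω • x := continuous_const_smul _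
  obtain ⟨U0, U1, hU0, hU1, hxU0, hxU1, hdisj⟩ := t2_separation hne
  set V0 : Set E := Φ.source ∩ (U1 ∩ ((fun x => ω • x) ⁻¹' U0 ∩ ball 0 ε)) with hV0
  have hV0o : IsOpen V0 := Φ.open_source.inter (hU1.inter ((hU0.preimage hcω).inter isOpen_ball))
  have hxV0 : x0 ∈ V0 := ⟨hst.mem_toOpenPartialHomeomorph_source, hxU1, hxU0, by simpa using hlε⟩
  set V1 : Set E := (fun x => ω⁻¹ • x) ⁻¹' V0 with hV1
  have hV1o : IsOpen V1 := hV0o.preimage (continuous_const_smul _)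
  have hV1mem : ∀ x ∈ V0, ω • x ∈ V1 := fun x hx => by
    simp only [hV1, mem_preimage, smul_smul, inv_mul_cancel₀ hω0, one_smul]; exact hx
  have hV01 : Disjoint V0 V1 := disjoint_left.2 fun x h0 h1 => by
    have : x ∈ U0 := by
      have := h1.2.2.1
      simpa only [mem_preimage, smul_smul, mul_inv_cancel₀ hω0, one_smul] using this
    exact hdisj.le_bot ⟨this, h0.2.1⟩
  have hV0s : V0 ⊆ ball 0 ε := fun x hx => hx.2.2.2
  have hV1s : V1 ⊆ ball 0 ε := fun x hx => by
    have : ω⁻¹ • x ∈ ball (0:E) ε := hx.2.2.2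
    simpa [norm_smul, hωn] using this
  have hi0 : InjOn g V0 := fun x hx y hy hxy => Φ.injOn hx.1 hy.1 (by rw [hΦ, hΦ, hxy])
  have hi1 : InjOn g V1 := fun x hx y hy hxy => by
    have : g (ω⁻¹ • x) = g (ω⁻¹ • y) := by
      rw [← hgω, ← hgω (ω⁻¹ • y)]
      simpa only [smul_smul, mul_inv_cancel₀ hω0, one_smul] using hxy
    exact smul_right_injective E (inv_ne_zero hω0) (hi0 hx hy this)
  have himo : IsOpen (g '' V0) := by
    have : g '' V0 = Φ '' V0 := image_congr fun x _ => (hΦ x).symm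
    rw [this]; exact Φ.isOpen_image_of_subset_source hV0o inter_subset_left
  obtain ⟨r, hr, hrV⟩ := Metric.isOpen_iff.1 himo (g x0) ⟨x0, hxV0, rfl⟩
  set c := 1 / r + 2 / r0 with hc
  have hcp : 0 < c := by positivity
  have hcr : 1/2 ≤ c * r := by
    have : c * r = 1 + 2 / r0 * r := by rw [hc, add_mul, one_div_mul_cancel hr.ne']
    have : 0 ≤ 2 / r0 * r := by positivity
    linarith
  have hcr0 : c * ‖g x0‖ + 1 ≤ c * r0 := by
    have h1 : 2 ≤ c * r0 := by
      have : c * r0 = r0 / r + 2 := by rw [hc]; field_simp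
      have : 0 ≤ r0 / r := by positivity
      linarith
    have := mul_le_mul_of_nonneg_left hlw.le hcp.le
    linarith
  rw [hdeg c (g x0) hcp hcr0]
  set G : E → E := fun x => c • (g x - g x0) with hGdef
  have hGc : ContDiff ℝ 1 G := by fun_prop
  have hcne : c ≠ 0 := hcp.ne'
  have hGi : ∀ V, InjOn g V → InjOn G V := fun V hV x hx y hy hxy =>
    hV hx hy (sub_left_injective (smul_right_injective E hcne hxy))
  have hGb0 : ball 0 (1/2) ⊆ G '' V0 := by
    intro y hy
    have : g x0 + c⁻¹ • y ∈ ball (g x0) r := by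
      rw [mem_ball, dist_eq_norm, add_sub_cancel_left, norm_smul, norm_inv,
        Real.norm_of_nonneg hcp.le, inv_mul_lt_iff₀ hcp]
      rw [mem_ball_zero_iff] at hy; linarith
    obtain ⟨x, hx, hxe⟩ := hrV this
    exact ⟨x, hx, by simp [hGdef, hxe, smul_smul, hcne]⟩
  have hGb1 : ball 0 (1/2) ⊆ G '' V1 := by
    intro y hy
    obtain ⟨x, hx, hxe⟩ := hGb0 hy
    exact ⟨ω • x, hV1mem x hx, by simp only [hGdef, hgω]; exact hxe⟩
  have I0 := local_one μ hGc hV0o (hGi _ hi0) hGb0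
  have I1 := local_one μ hGc hV1o (hGi _ hi1) hGb1
  have hint := (Ig_integrable μ hGc hbΩ).abs
  have hge : 2 ≤ ∫ x in ball 0 ε, |bmp μ (G x) * (fderiv ℝ G x).det| ∂μ := by
    calc (2:ℝ) = ∫ x in V0 ∪ V1, |bmp μ (G x) * (fderiv ℝ G x).det| ∂μ := by
          rw [setIntegral_union hV01 hV1o.measurableSet (IntegrableOn.mono_set hint hV0s) (IntegrableOn.mono_set hint hV1s), I0, I1]
          norm_num
      _ ≤ _ := setIntegral_mono_set hint (ae_of_all _ fun _ => abs_nonneg _)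
          (union_subset hV0s hV1s).eventuallyLE
  have hsgn : |J.det| * |Ig μ (ball 0 ε) G| = |J.det| * ∫ x in ball 0 ε, |bmp μ (G x) * (fderiv ℝ G x).det| ∂μ := by
    unfold Ig
    rw [← abs_mul, ← integral_const_mul, ← integral_const_mul]
    simp_rw [← abs_mul]
    have hpos : ∀ x, 0 ≤ J.det * (bmp μ (G x) * (fderiv ℝ G x).det) := by
      intro x
      rw [hdetG]
      have h1 := det_real_nonneg (fderiv ℂ h x)
      have h2 := bmp_nonneg μ (G x)
      have : J.det * (bmp μ (G x) * (c ^ Module.finrank ℝ E * (J.det * ((fderiv ℂ h x).restrictScalars ℝ).det)))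
        = (J.det * J.det) * (bmp μ (G x) * (c ^ Module.finrank ℝ E * ((fderiv ℂ h x).restrictScalars ℝ).det)) := by ring
      rw [this]
      have := mul_self_nonneg J.det
      positivity
    simp_rw [abs_of_nonneg (hpos _)]
    exact abs_of_nonneg (integral_nonneg hpos)
  have := mul_left_cancel₀ (abs_ne_zero.2 hJdet) hsgn
  intro hone
  rw [hone, abs_one] at this
  linarith

end Degree4

noncomputable section Idx
variable {E : Type*} [NormedAddCommGroup E] [InnerProductSpace ℂ E] [FiniteDimensional ℂ E]

structure HomIso (q : E → ℂ) (e : ℕ) : Prop where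
  cd : ContDiff ℂ 2 q
  he : 1 ≤ e
  hom : ∀ (c : ℂ) x, q (c • x) = c ^ e * q x
  nd : ∀ x, x ≠ 0 → fderiv ℂ q x ≠ 0

def gr (q : E → ℂ) (x : E) : E := (InnerProductSpace.toDual ℂ E).symm (fderiv ℂ q x)

theorem inner_gr (q : E → ℂ) (x v : E) : inner ℂ (gr q x) v = fderiv ℂ q x v := by
  simp [gr]

theorem fderiv_gr (q : E → ℂ) (x : E) : fderiv ℂ q x (gr q x) = ((‖gr q x‖ ^ 2 : ℝ) : ℂ) := by
  rw [← inner_gr, inner_self_eq_norm_sq_to_K]; norm_cast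

def kap (q : E → ℂ) (e : ℕ) (x : E) : E :=
  x - ((e : ℂ) * q x / ((‖gr q x‖ ^ 2 : ℝ) : ℂ)) • gr q x

def mm (e : ℕ) (w : ℂ) : ℂ := Complex.exp (-(Complex.log w / e))
def rr (q : E → ℂ) (e : ℕ) (x : E) : E := mm e (q x) • x
def ss (q : E → ℂ) (e : ℕ) (t : ℝ) (x : E) : E := rr q e (x - t • kap q e x)

variable {q : E → ℂ} {e : ℕ}

namespace HomIso

theorem diff (h : HomIso q e) (x : E) : HasFDerivAt q (fderiv ℂ q x) x :=
  (h.cd.differentiable (by norm_num) x).hasFDerivAt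

theorem cont (h : HomIso q e) : Continuous q := h.cd.continuous

theorem zero (h : HomIso q e) : q 0 = 0 := by
  have := h.hom 0 0; have h1 := h.he
  rw [zero_smul, zero_pow (by omega), zero_mul] at this; exact this

theorem euler (h : HomIso q e) (x : E) : fderiv ℂ q x x = e * q x := by
  have e1 : HasDerivAt (fun c : ℂ => q (c • x)) (fderiv ℂ q ((1:ℂ) • x) ((1:ℂ) • x)) 1 :=
    (h.diff ((1:ℂ) • x)).comp_hasDerivAt (1:ℂ) ((hasDerivAt_id (1:ℂ)).smul_const x)
  have e2 : HasDerivAt (fun c : ℂ => q (c • x)) ((e * 1 ^ (e-1)) * q x) 1 := by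
    simp_rw [h.hom]
    exact (hasDerivAt_pow e (1:ℂ)).mul_const _
  have := e1.unique e2
  simpa using this

theorem gr_cont (h : HomIso q e) : Continuous (gr q) :=
  (InnerProductSpace.toDual ℂ E).symm.continuous.comp (h.cd.continuous_fderiv (by norm_num))

theorem gr_ne (h : HomIso q e) {x : E} (hx : x ≠ 0) : gr q x ≠ 0 := by
  simp [gr, h.nd x hx]

theorem gr_norm (h : HomIso q e) (x : E) : ‖gr q x‖ = ‖fderiv ℂ q x‖ := by simp [gr]

theorem fderiv_smul (h : HomIso q e) {c : ℂ} (hc : c ≠ 0) (x : E) :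
    fderiv ℂ q (c • x) = c ^ (e - 1) • fderiv ℂ q x := by
  have e1 : HasFDerivAt (fun y => q (c • y)) ((fderiv ℂ q (c • x)).comp (c • ContinuousLinearMap.id ℂ E)) x :=
    (h.diff (c • x)).comp x ((hasFDerivAt_id x).const_smul c)
  have e2 : HasFDerivAt (fun y => q (c • y)) (c ^ e • fderiv ℂ q x) x := by
    simp_rw [h.hom]
    exact (h.diff x).const_mul _
  have e3 := e1.unique e2
  ext v
  have := DFunLike.congr_fun e3 v
  simp at this ⊢
  have hm' : c ^ e = c * c ^ (e - 1) := by rw [← pow_succ']; congr 1; have := h.he; omega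
  rw [hm', mul_assoc] at this
  exact mul_left_cancel₀ hc this

theorem gr_lb (h : HomIso q e) : ∃ c > 0, ∀ x, c * ‖x‖ ^ (e-1) ≤ ‖gr q x‖ ∨ x = 0 := by
  haveI : ProperSpace E := FiniteDimensional.proper ℂ E
  obtain ⟨m, hm, hm'⟩ := norm_lb (isCompact_sphere (0:E) 1) h.gr_cont.continuousOn
    (fun x hx => h.gr_ne (by rintro rfl; simp at hx))
  refine ⟨m, hm, fun x => ?_⟩
  by_cases hx : x = 0
  · exact Or.inr hx
  left
  have hn : ‖x‖ ≠ 0 := norm_ne_zero_iff.2 hx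
  have h1 := hm' (((‖x‖⁻¹ : ℝ) : ℂ) • x) (by simp [norm_smul, hn])
  rw [h.gr_norm, h.fderiv_smul (by simpa using hx), norm_smul, ← h.gr_norm] at h1
  simp at h1
  rw [inv_mul_eq_div, le_div_iff₀ (by positivity)] at h1
  exact h1

theorem dkap (h : HomIso q e) {x : E} (hx : x ≠ 0) : fderiv ℂ q x (kap q e x) = 0 := by
  have hg : ((‖gr q x‖ ^ 2 : ℝ) : ℂ) ≠ 0 := by
    have := norm_ne_zero_iff.2 (h.gr_ne hx); exact_mod_cast pow_ne_zero 2 this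
  rw [kap, map_sub, map_smul, h.euler, fderiv_gr, smul_eq_mul, div_mul_cancel₀ _ hg, sub_self]

theorem kap_cont (h : HomIso q e) : ContinuousOn (kap q e) {0}ᶜ := by
  unfold kap
  have h1 := h.gr_cont; have h2 := h.cont
  refine ContinuousOn.sub continuousOn_id (ContinuousOn.smul (ContinuousOn.div (by fun_prop) (by fun_prop) ?_) h1.continuousOn)
  intro x hx
  have := norm_ne_zero_iff.2 (h.gr_ne hx); exact_mod_cast pow_ne_zero 2 this

theorem norm_sub_kap (h : HomIso q e) {x : E} (hx : x ≠ 0) (t : ℝ) :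
    ‖x - t • kap q e x‖ ^ 2 = ‖x‖ ^ 2 - 2 * t * ‖kap q e x‖ ^ 2 + t ^ 2 * ‖kap q e x‖ ^ 2 := by
  set k := kap q e x with hk
  have hgk : inner ℂ (gr q x) k = 0 := by rw [inner_gr]; exact h.dkap hx
  have hxk : inner ℂ x k = inner ℂ k k := by
    conv_rhs => rw [hk, kap]
    rw [inner_sub_left, inner_smul_left, ← kap, ← hk, hgk, mul_zero, sub_zero]
  have h1 : t • k = (t : ℂ) • k := (Complex.coe_smul t k).symm
  rw [h1, @norm_sub_sq ℂ, inner_smul_right, hxk, inner_self_eq_norm_sq_to_K, norm_smul]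
  have : RCLike.re ((t:ℂ) * ((‖k‖:ℂ))^2) = t * ‖k‖^2 := by
    rw [← Complex.ofReal_pow, ← Complex.ofReal_mul]; exact Complex.ofReal_re _
  erw [this]
  rw [mul_pow, Complex.norm_real, Real.norm_eq_abs, sq_abs]; ring

theorem par (h : HomIso q e) {x : E} {c : ℂ} (hx : x = c • gr q x) : e * ‖q x‖ = ‖gr q x‖ * ‖x‖ := by
  have h1 := h.euler x
  have h2 : fderiv ℂ q x x = c * ((‖gr q x‖ ^ 2 : ℝ) : ℂ) := by
    exact (congrArg (fderiv ℂ q x) hx).trans (by rw [map_smul, fderiv_gr, smul_eq_mul])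
  have h3 : ‖x‖ = ‖c‖ * ‖gr q x‖ := by conv_lhs => rw [hx, norm_smul]
  have h4 := congrArg norm (h1.symm.trans h2)
  simp at h4
  rw [h4, h3]; ring

theorem exists_R0 (h : HomIso q e) : ∃ R0 : ℝ, 1 ≤ R0 ∧ ∀ (x : E) (c : ℂ), R0 ≤ ‖x‖ →
    x = c • gr q x → 1 < ‖q x‖ := by
  obtain ⟨c, hc, hcb⟩ := h.gr_lb
  refine ⟨max 1 ((e + 1) / c), le_max_left _ _, fun x a hx hxa => ?_⟩
  have hx1 : 1 ≤ ‖x‖ := (le_max_left _ _).trans hx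
  have hx0 : x ≠ 0 := by rintro rfl; simp at hx1; linarith
  have h1 := (hcb x).resolve_right hx0
  have h2 := h.par hxa
  have h3 : (e + 1) / c ≤ ‖x‖ := (le_max_right _ _).trans hx
  rw [div_le_iff₀ hc] at h3
  have h4 : 1 ≤ ‖x‖ ^ (e-1) := one_le_pow₀ hx1
  have h5 : (e:ℝ) * 1 < e * ‖q x‖ := by
    rw [h2]
    calc (e:ℝ) * 1 < ‖x‖ * c := by linarith
      _ ≤ (c * ‖x‖ ^ (e-1)) * ‖x‖ := by nlinarith [mul_le_mul_of_nonneg_left h4 hc.le]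
      _ ≤ _ := by gcongr
  exact lt_of_mul_lt_mul_left h5 (by positivity)

end HomIso

theorem mm_pow (he : 1 ≤ e) {w : ℂ} (hw : w ≠ 0) : mm e w ^ e * w = 1 := by
  have he' : (e:ℂ) ≠ 0 := by exact_mod_cast (by omega : e ≠ 0)
  rw [mm, ← Complex.exp_nat_mul]
  nth_rewrite 2 [← Complex.exp_log hw]
  rw [← Complex.exp_add]
  have : (e:ℂ) * -(Complex.log w / e) + Complex.log w = 0 := by field_simp; ring
  rw [this, Complex.exp_zero]

theorem mm_one : mm e 1 = 1 := by simp [mm]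
theorem mm_ne (w : ℂ) : mm e w ≠ 0 := Complex.exp_ne_zero _

theorem slit_of {w : ℂ} (hw : ‖w - 1‖ ≤ 1/2) : w ∈ Complex.slitPlane := by
  left
  have h1 := (Complex.abs_re_le_norm (w - 1)).trans hw
  rw [abs_le] at h1; simp at h1; linarith [h1.1]

theorem re_of {w : ℂ} (hw : ‖w - 1‖ ≤ 1/2) : 0 < w.re := by
  have h1 := (Complex.abs_re_le_norm (w - 1)).trans hw
  rw [abs_le] at h1; simp at h1; linarith [h1.1]

theorem mm_cont (e : ℕ) : ContinuousOn (mm e) (closedBall 1 (1/2)) := by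
  intro w hw
  have := slit_of (w := w) (by simpa [dist_eq_norm] using hw)
  unfold mm
  have h1 := continuousAt_clog this
  exact (ContinuousAt.cexp (by fun_prop)).continuousWithinAt

theorem mm_lip (e : ℕ) : ∃ C, 0 < C ∧ ∀ w : ℂ, ‖w - 1‖ ≤ 1/2 → ‖mm e w - 1‖ ≤ C * ‖w - 1‖ := by
  have hd : ∀ w ∈ closedBall (1:ℂ) (1/2), HasDerivWithinAt (mm e) (mm e w * -(w⁻¹ / e)) (closedBall 1 (1/2)) w := by
    intro w hw
    have := slit_of (w := w) (by simpa [dist_eq_norm] using hw)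
    exact (((Complex.hasDerivAt_log this).div_const _).neg.cexp).hasDerivWithinAt
  have hc : ContinuousOn (fun w => mm e w * -(w⁻¹ / e)) (closedBall 1 (1/2)) := by
    refine (mm_cont e).mul (((continuousOn_inv₀.mono ?_).div_const _).neg)
    intro w hw h0
    have := slit_of (w := w) (by simpa [dist_eq_norm] using hw)
    rw [mem_singleton_iff] at h0
    rw [h0] at this; simp at this
  obtain ⟨C, hC⟩ := (isCompact_closedBall (1:ℂ) (1/2)).exists_bound_of_continuousOn hc
  refine ⟨max C 1, by positivity, fun w hw => ?_⟩
  have := (convex_closedBall (1:ℂ) (1/2)).norm_image_sub_le_of_norm_hasDerivWithin_le hd hC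
    (mem_closedBall_self (by norm_num)) (by simpa [dist_eq_norm] using hw : w ∈ closedBall (1:ℂ) (1/2))
  rw [mm_one] at this
  exact this.trans (by gcongr; exact le_max_left _ _)

namespace HomIso

theorem rr_F (h : HomIso q e) {x : E} (hx : ‖q x - 1‖ ≤ 1/2) : q (rr q e x) = 1 := by
  rw [rr, h.hom]
  refine mm_pow h.he ?_
  have := re_of hx
  intro h0; rw [h0] at this; simp at this

theorem rr_self {x : E} (hx : q x = 1) : rr q e x = x := by simp [rr, hx, mm_one]

theorem rr_cont (h : HomIso q e) : ContinuousOn (rr q e) {x | ‖q x - 1‖ ≤ 1/2} := by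
  unfold rr
  refine ContinuousOn.smul ((mm_cont e).comp h.cont.continuousOn fun x hx => ?_) continuousOn_id
  simpa [dist_eq_norm] using hx

theorem taylor (h : HomIso q e) (ρ : ℝ) : ∃ C, 0 < C ∧ ∀ x y : E, ‖x‖ ≤ ρ → ‖y‖ ≤ ρ →
    ‖q y - q x - fderiv ℂ q x (y - x)‖ ≤ C * ‖y - x‖ ^ 2 := by
  haveI : ProperSpace E := FiniteDimensional.proper ℂ E
  have hc1 : ContDiff ℂ 1 (fderiv ℂ q) := h.cd.fderiv_right (by norm_num)
  obtain ⟨C, hC⟩ := (isCompact_closedBall (0:E) ρ).exists_bound_of_continuousOn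
    (hc1.continuous_fderiv (by norm_num)).continuousOn
  refine ⟨max C 1, by positivity, fun x y hx hy => ?_⟩
  have hseg : segment ℝ x y ⊆ closedBall 0 ρ := (convex_closedBall (0:E) ρ).segment_subset
    (by simpa using hx) (by simpa using hy)
  have hl : ∀ z ∈ segment ℝ x y, ‖fderiv ℂ q z - fderiv ℂ q x‖ ≤ max C 1 * ‖y - x‖ := by
    intro z hz
    have h1 := (convex_segment x y).norm_image_sub_le_of_norm_hasFDerivWithin_le (𝕜 := ℂ)
      (fun w _ => (hc1.differentiable (by norm_num) w).hasFDerivAt.hasFDerivWithinAt)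
      (fun w hw => hC w (hseg hw)) (left_mem_segment ℝ x y) hz
    refine h1.trans ?_
    gcongr
    · exact le_max_left _ _
    · obtain ⟨a, b, ha, hb, hab, rfl⟩ := hz
      have : a • x + b • y - x = b • (y - x) := by
        have : a = 1 - b := by linarith
        rw [this]; module
      rw [this, norm_smul, Real.norm_of_nonneg hb]
      have := norm_nonneg (y - x); nlinarith
  have := (convex_segment x y).norm_image_sub_le_of_norm_hasFDerivWithin_le' (𝕜 := ℂ)
    (fun w _ => (h.diff w).hasFDerivWithinAt) hl (left_mem_segment ℝ x y) (right_mem_segment ℝ x y)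
  refine this.trans (le_of_eq (by ring))

theorem ne0 (h : HomIso q e) {x : E} (hx : q x = 1) : x ≠ 0 := by
  rintro rfl; rw [h.zero] at hx; exact zero_ne_one hx

theorem exists_tau (h : HomIso q e) (ρ : ℝ) (hρ : 0 ≤ ρ) : ∃ τ : ℝ, 0 < τ ∧ ∀ t, 0 ≤ t → t ≤ τ → ∀ x, q x = 1 → ‖x‖ ≤ ρ →
    ‖q (x - t • kap q e x) - 1‖ ≤ 1/2 ∧ ‖mm e (q (x - t • kap q e x)) - 1‖ ≤ 1/2 ∧
    ‖ss q e t x‖ ^ 2 ≤ ‖x‖ ^ 2 - t * ‖kap q e x‖ ^ 2 := by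
  obtain ⟨C, hC, hCt⟩ := h.taylor (2 * ρ)
  obtain ⟨D, hD, hDm⟩ := mm_lip e
  set τ := min 1 (min (1 / (2 * C * (ρ+1)^2)) (min (1 / (2 * D * C * (ρ+1)^2)) (1 / (1 + 3 * D * C * ρ ^ 2)))) with hτ
  have hτp : 0 < τ := by positivity
  have hτ1 : τ ≤ 1 := min_le_left _ _
  have hτ2 : τ ≤ 1 / (2 * C * (ρ+1)^2) := (min_le_right _ _).trans (min_le_left _ _)
  have hτ3 : τ ≤ 1 / (2 * D * C * (ρ+1)^2) := (min_le_right _ _).trans ((min_le_right _ _).trans (min_le_left _ _))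
  have hτ4 : τ ≤ 1 / (1 + 3 * D * C * ρ ^ 2) := (min_le_right _ _).trans ((min_le_right _ _).trans (min_le_right _ _))
  refine ⟨τ, hτp, fun t ht0 htτ x hx hxρ => ?_⟩
  have ht1 : t ≤ 1 := htτ.trans hτ1
  have hx0 := h.ne0 hx
  set k := kap q e x with hk
  have hkx : ‖k‖ ≤ ‖x‖ := by
    have h1 := h.norm_sub_kap hx0 1
    rw [← hk] at h1
    have : 0 ≤ ‖x - (1:ℝ) • k‖ ^ 2 := by positivity
    have : ‖k‖ ^ 2 ≤ ‖x‖ ^ 2 := by linarith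
    exact (pow_le_pow_iff_left₀ (norm_nonneg _) (norm_nonneg _) (by norm_num)).1 this
  have hn := h.norm_sub_kap hx0 t
  rw [← hk] at hn
  set y := x - t • k with hy
  have hyx : ‖y‖ ^ 2 ≤ ‖x‖ ^ 2 := by nlinarith [sq_nonneg ‖k‖, mul_nonneg ht0 (sq_nonneg ‖k‖)]
  have hyx' : ‖y‖ ≤ ‖x‖ := (pow_le_pow_iff_left₀ (norm_nonneg _) (norm_nonneg _) (by norm_num)).1 hyx
  have hT := hCt x y (by linarith) (by linarith [norm_nonneg x])
  have hyxk : y - x = -((t : ℂ) • k) := by rw [hy, Complex.coe_smul]; abel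
  rw [hyxk, map_neg, map_smul, h.dkap hx0, smul_zero, neg_zero, sub_zero, hx, norm_neg, norm_smul,
    Complex.norm_real, Real.norm_of_nonneg ht0] at hT
  have hkρ : ‖k‖ ≤ ρ + 1 := by linarith
  have hk2 : ‖k‖ ^ 2 ≤ (ρ+1)^2 := by gcongr
  have htk : (t * ‖k‖) ^ 2 ≤ τ * (ρ+1)^2 := by
    rw [mul_pow]
    have : t ^ 2 ≤ τ := by nlinarith
    gcongr
  have b1 : ‖q y - 1‖ ≤ 1/2 := by
    refine hT.trans ?_
    calc C * (t * ‖k‖)^2 ≤ C * (1 / (2 * C * (ρ+1)^2) * (ρ+1)^2) := by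
          gcongr; exact htk.trans (by gcongr)
      _ = 1/2 := by field_simp
  have b2 : ‖mm e (q y) - 1‖ ≤ D * (C * (t * ‖k‖)^2) := (hDm _ b1).trans (by gcongr)
  have b3 : D * (C * (t * ‖k‖)^2) ≤ 1/2 := by
    calc D * (C * (t * ‖k‖)^2) ≤ D * (C * (1 / (2 * D * C * (ρ+1)^2) * (ρ+1)^2)) := by
          gcongr; exact htk.trans (by gcongr)
      _ = 1/2 := by field_simp
  refine ⟨b1, b2.trans b3, ?_⟩
  have e1 : ‖ss q e t x‖ = ‖mm e (q y)‖ * ‖y‖ := by rw [ss, rr, ← hk, ← hy, norm_smul]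
  set A := D * (C * (t * ‖k‖)^2) with hA
  have hA0 : 0 ≤ A := by positivity
  have hmA : ‖mm e (q y)‖ ≤ 1 + A := by
    have := norm_add_le (mm e (q y) - 1) 1; simp at this; linarith
  have hm2 : ‖mm e (q y)‖ ^ 2 ≤ 1 + 3 * A := by
    have : ‖mm e (q y)‖ ^ 2 ≤ (1 + A)^2 := by gcongr
    nlinarith
  have hxρ2 : ‖y‖ ^ 2 ≤ ρ ^ 2 := by have := hyx'.trans hxρ; gcongr
  rw [e1, mul_pow]
  calc ‖mm e (q y)‖ ^ 2 * ‖y‖ ^ 2 ≤ (1 + 3 * A) * ‖y‖ ^ 2 := by gcongr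
    _ ≤ ‖y‖ ^ 2 + 3 * A * ρ ^ 2 := by nlinarith
    _ = ‖x‖ ^ 2 - t * ‖k‖ ^ 2 - t * ‖k‖^2 * (1 - t * (1 + 3 * D * C * ρ ^ 2)) := by rw [hn, hA]; ring
    _ ≤ _ := by
      have : t * (1 + 3 * D * C * ρ ^ 2) ≤ 1 := by
        rw [le_div_iff₀ (by positivity)] at hτ4
        refine le_trans ?_ hτ4
        gcongr
      have : 0 ≤ t * ‖k‖^2 * (1 - t * (1 + 3 * D * C * ρ ^ 2)) := mul_nonneg (by positivity) (by linarith)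
      linarith

end HomIso
end Idx

noncomputable section Idx2
variable {E : Type*} [NormedAddCommGroup E] [InnerProductSpace ℂ E] [FiniteDimensional ℂ E]
variable {q : E → ℂ} {e : ℕ}

def FK (q : E → ℂ) (ρ : ℝ) : Set E := {x | q x = 1 ∧ ‖x‖ ≤ ρ}

def Fac (q : E → ℂ) (e : ℕ) (ρ τ : ℝ) : Prop :=
  0 < τ ∧ ∀ t, 0 ≤ t → t ≤ τ → ∀ x, q x = 1 → ‖x‖ ≤ ρ →
    ‖q (x - t • kap q e x) - 1‖ ≤ 1/2 ∧ ‖mm e (q (x - t • kap q e x)) - 1‖ ≤ 1/2 ∧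
    ‖ss q e t x‖ ^ 2 ≤ ‖x‖ ^ 2 - t * ‖kap q e x‖ ^ 2

variable {ρ τ : ℝ}

theorem FK_compact (h : HomIso q e) (ρ : ℝ) : IsCompact (FK q ρ) := by
  haveI : ProperSpace E := FiniteDimensional.proper ℂ E
  have : FK q ρ = closedBall 0 ρ ∩ q ⁻¹' {1} := by ext x; simp [FK, and_comm]
  rw [this]
  exact (isCompact_closedBall _ _).inter_right (isClosed_singleton.preimage h.cont)

theorem ss_F (h : HomIso q e) (hF : Fac q e ρ τ) {t : ℝ} (h0 : 0 ≤ t) (h1 : t ≤ τ) {x : E}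
    (hx : x ∈ FK q ρ) : ss q e t x ∈ FK q ρ ∧ ‖ss q e t x‖ ≤ ‖x‖ := by
  obtain ⟨f1, f2, f3⟩ := hF.2 t h0 h1 x hx.1 hx.2
  have : ‖ss q e t x‖ ≤ ‖x‖ := by
    refine (pow_le_pow_iff_left₀ (norm_nonneg _) (norm_nonneg _) two_ne_zero).1 (f3.trans ?_)
    have : 0 ≤ t * ‖kap q e x‖ ^ 2 := by positivity
    linarith
  exact ⟨⟨h.rr_F f1, this.trans hx.2⟩, this⟩

theorem ss_eq (h : HomIso q e) (hF : Fac q e ρ τ) {t : ℝ} (h0 : 0 < t) (h1 : t ≤ τ) {x : E}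
    (hx : x ∈ FK q ρ) (hn : ‖x‖ ≤ ‖ss q e t x‖) : kap q e x = 0 := by
  obtain ⟨f1, f2, f3⟩ := hF.2 t h0.le h1 x hx.1 hx.2
  have : ‖x‖^2 ≤ ‖ss q e t x‖^2 := by gcongr
  have h2 : t * ‖kap q e x‖ ^ 2 ≤ 0 := by linarith
  have h3 : ‖kap q e x‖ ^ 2 ≤ 0 := by
    by_contra! h4; have := mul_pos h0 h4; linarith
  have := pow_eq_zero_iff (two_ne_zero) |>.1 (le_antisymm h3 (by positivity))
  simpa using this

theorem ss_fix {t : ℝ} {x : E} (hx : q x = 1) (hk : kap q e x = 0) : ss q e t x = x := by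
  rw [ss, hk, smul_zero, sub_zero, HomIso.rr_self hx]

theorem ss_zero {x : E} (hx : q x = 1) : ss q e 0 x = x := by
  rw [ss, zero_smul, sub_zero, HomIso.rr_self hx]

theorem ss_cont (h : HomIso q e) (hF : Fac q e ρ τ) :
    ContinuousOn (fun p : ℝ × E => ss q e p.1 p.2) (Icc 0 τ ×ˢ FK q ρ) := by
  unfold ss
  refine h.rr_cont.comp (ContinuousOn.sub continuousOn_snd (continuousOn_fst.smul
    (h.kap_cont.comp continuousOn_snd ?_))) ?_
  · rintro ⟨t, x⟩ ⟨_, hx⟩; exact h.ne0 hx.1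
  · rintro ⟨t, x⟩ ⟨ht, hx⟩; exact (hF.2 t ht.1 ht.2 x hx.1 hx.2).1

theorem ss_cont' (h : HomIso q e) (hF : Fac q e ρ τ) {t : ℝ} (h0 : 0 ≤ t) (h1 : t ≤ τ) :
    ContinuousOn (ss q e t) (FK q ρ) :=
  (ss_cont h hF).comp (f := fun x => (t, x)) (by fun_prop) fun x hx => ⟨⟨h0, h1⟩, hx⟩

theorem it_maps (h : HomIso q e) (hF : Fac q e ρ τ) (j : ℕ) : MapsTo (ss q e τ)^[j] (FK q ρ) (FK q ρ) :=
  MapsTo.iterate (fun x hx => (ss_F h hF hF.1.le le_rfl hx).1) j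

theorem it_cont (h : HomIso q e) (hF : Fac q e ρ τ) (j : ℕ) : ContinuousOn (ss q e τ)^[j] (FK q ρ) :=
  ContinuousOn.iterate (ss_cont' h hF hF.1.le le_rfl) (fun x hx => (ss_F h hF hF.1.le le_rfl hx).1) j

theorem it_norm (h : HomIso q e) (hF : Fac q e ρ τ) (j : ℕ) {x : E} (hx : x ∈ FK q ρ) :
    ‖(ss q e τ)^[j] x‖ ≤ ‖x‖ := by
  induction j with
  | zero => simp
  | succ j ih =>
    rw [Function.iterate_succ_apply']
    exact (ss_F h hF hF.1.le le_rfl (it_maps h hF j hx)).2.trans ih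

theorem it_eq (h : HomIso q e) (hF : Fac q e ρ τ) {j : ℕ} (hj : 1 ≤ j) {x : E} (hx : x ∈ FK q ρ)
    (hn : ‖x‖ ≤ ‖(ss q e τ)^[j] x‖) : kap q e x = 0 := by
  obtain ⟨j, rfl⟩ : ∃ i, j = i + 1 := ⟨j - 1, by omega⟩
  rw [Function.iterate_succ_apply] at hn
  have h1 := ss_F h hF hF.1.le le_rfl hx
  exact ss_eq h hF hF.1 le_rfl hx (hn.trans (it_norm h hF j h1.1))

theorem it_fix {j : ℕ} {x : E} (hx : q x = 1) (hk : kap q e x = 0) : (ss q e τ)^[j] x = x :=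
  Function.iterate_fixed (ss_fix hx hk) j

theorem exists_N (h : HomIso q e) (hF : Fac q e ρ τ) {R : ℝ} (hR : 0 ≤ R)
    (hk : ∀ x, q x = 1 → R ≤ ‖x‖ → kap q e x ≠ 0) :
    ∃ N : ℕ, 1 ≤ N ∧ ∀ x ∈ FK q ρ, ‖(ss q e τ)^[N] x‖ ≤ R := by
  have hcomp : IsCompact (FK q ρ ∩ {x | R ≤ ‖x‖}) :=
    (FK_compact h ρ).inter_right (isClosed_le continuous_const continuous_norm)
  obtain ⟨m, hm, hmb⟩ := norm_lb hcomp (h.kap_cont.mono fun x hx => h.ne0 hx.1.1)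
    (fun x hx => hk x hx.1.1 hx.2)
  have hτ := hF.1
  have key : ∀ j : ℕ, ∀ x ∈ FK q ρ, ‖(ss q e τ)^[j] x‖ ≤ R ∨ ‖(ss q e τ)^[j] x‖ ^ 2 ≤ ‖x‖^2 - j * (τ * m ^ 2) := by
    intro j x hx
    induction j with
    | zero => right; simp
    | succ j ih =>
      rw [Function.iterate_succ_apply']
      have hy := it_maps h hF j hx
      set y := (ss q e τ)^[j] x
      have h1 := ss_F h hF hF.1.le le_rfl hy
      rcases ih with ih | ih
      · exact Or.inl (h1.2.trans ih)
      by_cases hyR : ‖y‖ ≤ R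
      · exact Or.inl (h1.2.trans hyR)
      right
      push Not at hyR
      obtain ⟨_, _, f3⟩ := hF.2 τ hF.1.le le_rfl y hy.1 hy.2
      have := hmb y ⟨hy, hyR.le⟩
      have : τ * m ^ 2 ≤ τ * ‖kap q e y‖ ^ 2 := by gcongr
      push_cast; linarith
  obtain ⟨N, hN⟩ := exists_nat_gt (ρ ^ 2 / (τ * m ^ 2))
  rw [div_lt_iff₀ (by positivity)] at hN
  refine ⟨N + 1, by omega, fun x hx => ?_⟩
  rcases key (N+1) x hx with h1 | h1
  · exact h1
  exfalso
  have h2 : ‖x‖ ^ 2 ≤ ρ ^ 2 := by have := hx.2; gcongr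
  have h3 : 0 ≤ ‖(ss q e τ)^[N+1] x‖ ^ 2 := by positivity
  push_cast at h1
  nlinarith [mul_pos hτ (pow_pos hm 2)]

def Om (q : E → ℂ) (R : ℝ) : Set E := {x | ‖x‖ < R ∧ ‖q x - 1‖ < 1/2}

theorem Om_open (h : HomIso q e) (R : ℝ) : IsOpen (Om q R) :=
  (isOpen_lt continuous_norm continuous_const).inter (isOpen_lt (h.cont.sub continuous_const).norm continuous_const)

theorem Om_bdd (R : ℝ) : Bornology.IsBounded (Om q R) :=
  isBounded_ball.subset (fun x hx => by simpa using hx.1 : Om q R ⊆ ball 0 R)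

theorem Om_closure (h : HomIso q e) {R : ℝ} {x : E} (hx : x ∈ closure (Om q R)) : ‖x‖ ≤ R ∧ ‖q x - 1‖ ≤ 1/2 := by
  have hc : IsClosed {x : E | ‖x‖ ≤ R ∧ ‖q x - 1‖ ≤ 1/2} :=
    (isClosed_le continuous_norm continuous_const).inter (isClosed_le (h.cont.sub continuous_const).norm continuous_const)
  exact closure_minimal (fun x (hx : x ∈ Om q R) => (⟨hx.1.le, hx.2.le⟩ : ‖x‖ ≤ R ∧ ‖q x - 1‖ ≤ 1/2)) hc hx

theorem Om_frontier (h : HomIso q e) {R : ℝ} {x : E} (hx : x ∈ frontier (Om q R)) :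
    ‖x‖ ≤ R ∧ ‖q x - 1‖ ≤ 1/2 ∧ (q x = 1 → ‖x‖ = R) := by
  have h1 := Om_closure h hx.1
  refine ⟨h1.1, h1.2, fun hq => ?_⟩
  have h2 := hx.2
  rw [(Om_open h R).interior_eq] at h2
  by_contra h3
  exact h2 ⟨lt_of_le_of_ne h1.1 h3, by rw [hq]; norm_num⟩

variable [MeasurableSpace E] [BorelSpace E] (μ : Measure E) [μ.IsAddHaarMeasure]

theorem deg_H (h : HomIso q e) (hE : 0 < Module.finrank ℝ E) {R R' : ℝ} (hRR : R < R') (hRρ : R ≤ ρ)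
    (hρ : ∀ x, ‖x‖ ≤ R' → ‖q x - 1‖ ≤ 1/2 → ‖rr q e x‖ ≤ ρ)
    {k : E → E} (hk : ContinuousOn k (FK q ρ)) (hkm : MapsTo k (FK q ρ) (FK q R))
    (H : ℝ → E → E) (hH : ContinuousOn (fun p : ℝ × E => H p.1 p.2) (Icc 0 1 ×ˢ FK q R))
    (hHm : ∀ t ∈ Icc (0:ℝ) 1, ∀ x ∈ FK q R, H t x ∈ FK q ρ) :
    deg μ (Om q R') (fun x => x - k (H 0 (k (rr q e x)))) = deg μ (Om q R') (fun x => x - k (H 1 (k (rr q e x)))) := by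
  haveI : FiniteDimensional ℝ E := FiniteDimensional.complexToReal E
  have hr : ∀ x ∈ frontier (Om q R'), rr q e x ∈ FK q ρ := fun x hx => by
    have := Om_frontier h hx
    exact ⟨h.rr_F this.2.1, hρ x this.1 this.2.1⟩
  have hrc : ContinuousOn (rr q e) (frontier (Om q R')) := h.rr_cont.mono fun x hx => (Om_frontier h hx).2.1
  refine deg_homotopy μ hE (Om_open h R') (Om_bdd R') (fun t x => x - k (H t (k (rr q e x)))) ?_ ?_
  · refine continuousOn_snd.sub (hk.comp (hH.comp (f := fun p : ℝ × E => (p.1, k (rr q e p.2))) ?_ ?_) ?_)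
    · exact continuousOn_fst.prodMk (hk.comp (hrc.comp continuousOn_snd fun p hp => hp.2) fun p hp => hr _ hp.2)
    · exact fun p hp => ⟨hp.1, hkm (hr _ hp.2)⟩
    · exact fun p hp => hHm _ hp.1 _ (hkm (hr _ hp.2))
  · intro t ht x hx h0
    have hxk := sub_eq_zero.1 h0
    have := hkm (hHm t ht _ (hkm (hr x hx)))
    rw [← hxk] at this
    have h2 := (Om_frontier h hx).2.2 this.1
    linarith [this.2]

end Idx2

noncomputable section Idx3
variable {E : Type*} [NormedAddCommGroup E] [InnerProductSpace ℂ E] [FiniteDimensional ℂ E]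
variable {q : E → ℂ} {e : ℕ} {ρ τ : ℝ}

theorem kap_eq_zero {x : E} (hk : kap q e x = 0) : ∃ c : ℂ, x = c • gr q x := ⟨_, sub_eq_zero.1 hk⟩

theorem setup (h : HomIso q e) : ∃ R : ℝ, 1 ≤ R ∧ (∀ (x : E) (c : ℂ), R ≤ ‖x‖ → x = c • gr q x → 1 < ‖q x‖) ∧
    (∀ x, q x = 1 → R ≤ ‖x‖ → kap q e x ≠ 0) ∧
    ∃ ρ0, R ≤ ρ0 ∧ (∀ x, ‖x‖ ≤ R + 1 → ‖q x - 1‖ ≤ 1/2 → ‖rr q e x‖ ≤ ρ0) ∧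
    ∀ ρ, ρ0 ≤ ρ → ∃ τ, Fac q e ρ τ ∧ ∃ N : ℕ, 1 ≤ N ∧ MapsTo (ss q e τ)^[N] (FK q ρ) (FK q R) := by
  haveI : ProperSpace E := FiniteDimensional.proper ℂ E
  obtain ⟨R, hR1, hR⟩ := h.exists_R0
  have hkap : ∀ x, q x = 1 → R ≤ ‖x‖ → kap q e x ≠ 0 := by
    intro x hx hxR hk
    obtain ⟨c, hc⟩ := kap_eq_zero hk
    have := hR x c hxR hc
    rw [hx] at this; simp at this
  refine ⟨R, hR1, hR, hkap, ?_⟩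
  have hK : IsCompact {x : E | ‖x‖ ≤ R + 1 ∧ ‖q x - 1‖ ≤ 1/2} := by
    have : {x : E | ‖x‖ ≤ R + 1 ∧ ‖q x - 1‖ ≤ 1/2} = closedBall 0 (R+1) ∩ {x | ‖q x - 1‖ ≤ 1/2} := by ext; simp
    rw [this]
    exact (isCompact_closedBall _ _).inter_right (isClosed_le (h.cont.sub continuous_const).norm continuous_const)
  obtain ⟨B, hB⟩ := hK.exists_bound_of_continuousOn (h.rr_cont.mono fun x hx => hx.2)
  refine ⟨max R B, le_max_left _ _, fun x h1 h2 => (hB x ⟨h1, h2⟩).trans (le_max_right _ _), fun ρ hρ => ?_⟩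
  have hRρ : R ≤ ρ := (le_max_left _ _).trans hρ
  obtain ⟨τ, hτ, hf⟩ := h.exists_tau ρ (by linarith)
  refine ⟨τ, ⟨hτ, hf⟩, ?_⟩
  obtain ⟨N, hN, hNR⟩ := exists_N h ⟨hτ, hf⟩ (by linarith : 0 ≤ R) hkap
  exact ⟨N, hN, fun x hx => ⟨(it_maps h ⟨hτ, hf⟩ N hx).1, hNR x hx⟩⟩

variable [MeasurableSpace E] [BorelSpace E] (μ : Measure E) [μ.IsAddHaarMeasure]

theorem deg_zeta (h : HomIso q e) (hE : 0 < Module.finrank ℝ E) {R : ℝ} (hRρ : R ≤ ρ) (hF : Fac q e ρ τ)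
    (hρ : ∀ x, ‖x‖ ≤ R + 1 → ‖q x - 1‖ ≤ 1/2 → ‖rr q e x‖ ≤ ρ)
    {N : ℕ} (hN : 1 ≤ N) (hNm : MapsTo (ss q e τ)^[N] (FK q ρ) (FK q R)) {ζ : ℂ} (hζ : ζ ^ e = 1) (hζ1 : ζ ≠ 1)
    (hζn : ‖ζ‖ = 1) :
    deg μ (Om q (R+1)) (fun x => x - (ss q e τ)^[N] (ζ • (ss q e τ)^[N] (rr q e x))) = 0 := by
  haveI : FiniteDimensional ℝ E := FiniteDimensional.complexToReal E
  have hr : ∀ x ∈ closure (Om q (R+1)), rr q e x ∈ FK q ρ := fun x hx => by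
    have := Om_closure h hx
    exact ⟨h.rr_F this.2, hρ x this.1 this.2⟩
  have hz : MapsTo (fun x : E => ζ • x) (FK q ρ) (FK q ρ) := fun x hx =>
    ⟨by simp [h.hom, hζ, hx.1], by simp [norm_smul, hζn, hx.2]⟩
  refine deg_eq_zero μ hE (Om_open h _) (Om_bdd _) ?_ ?_
  · refine continuousOn_id.sub ((it_cont h hF N).comp (((it_cont h hF N).comp
      (h.rr_cont.mono fun x hx => (Om_closure h hx).2) hr).const_smul ζ) ?_)
    exact fun x hx => hz (it_maps h hF N (hr x hx))
  · intro x hx h0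
    have hxk := sub_eq_zero.1 h0
    have hxF : x ∈ FK q ρ := by rw [hxk]; exact it_maps h hF N (hz (it_maps h hF N (hr x hx)))
    rw [HomIso.rr_self hxF.1] at hxk
    set k := (ss q e τ)^[N]
    have n1 : ‖k x‖ ≤ ‖x‖ := it_norm h hF N hxF
    have hkx := it_maps h hF N hxF
    have n2 : ‖k (ζ • k x)‖ ≤ ‖ζ • k x‖ := it_norm h hF N (hz hkx)
    rw [← hxk, norm_smul, hζn, one_mul] at n2
    have k1 : k x = x := it_fix hxF.1 (it_eq h hF hN hxF n2)
    rw [k1] at hxk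
    have k2 : k (ζ • x) = ζ • x := it_fix (hz hxF).1 (it_eq h hF hN (hz hxF)
      (by have : ‖k (ζ • x)‖ = ‖x‖ := by rw [← hxk]
          rw [this, norm_smul, hζn, one_mul]))
    rw [k2] at hxk
    have : (1 - ζ) • x = 0 := by rw [sub_smul, one_smul, ← hxk, sub_self]
    rcases smul_eq_zero.1 this with h1 | h1
    · exact hζ1 (sub_eq_zero.1 h1).symm
    · exact h.ne0 hxF.1 h1

end Idx3

section Idx4
variable {E : Type*} [NormedAddCommGroup E] [InnerProductSpace ℂ E] [FiniteDimensional ℂ E]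
variable {q : E → ℂ} {e : ℕ} {ρ τ : ℝ}

theorem finrank_pos_of {x : E} (hx : x ≠ 0) : 0 < Module.finrank ℝ E := by
  haveI : FiniteDimensional ℝ E := FiniteDimensional.complexToReal E
  haveI : Nontrivial E := ⟨⟨x, 0, hx⟩⟩
  exact Module.finrank_pos

theorem no_contract (h : HomIso q e) (he : 2 ≤ e) (c : ℝ → E → E)
    (hc : ContinuousOn (fun p : ℝ × E => c p.1 p.2) (Icc 0 1 ×ˢ {x | q x = 1}))
    (hcm : ∀ t ∈ Icc (0:ℝ) 1, ∀ x, q x = 1 → q (c t x) = 1) (hc0 : ∀ x, q x = 1 → c 0 x = x)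
    {p : E} (hp : q p = 1) (hc1 : ∀ x, q x = 1 → c 1 x = p) : False := by
  letI : MeasurableSpace E := borel E
  haveI : BorelSpace E := ⟨rfl⟩
  haveI : FiniteDimensional ℝ E := FiniteDimensional.complexToReal E
  let μ : Measure E := Measure.addHaar
  have hE := finrank_pos_of (h.ne0 hp)
  obtain ⟨R, hR1, _, hkap, ρ0, hRρ0, hρ0, hset⟩ := setup h
  have hsub : Icc (0:ℝ) 1 ×ˢ FK q R ⊆ Icc 0 1 ×ˢ {x | q x = 1} := prod_mono_right fun x hx => hx.1
  obtain ⟨B, hB⟩ := (isCompact_Icc.prod (FK_compact h R)).exists_bound_of_continuousOn (hc.mono hsub)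
  set ρ := max (max ρ0 B) ‖p‖ with hρ
  have hρ0ρ : ρ0 ≤ ρ := (le_max_left _ _).trans (le_max_left _ _)
  obtain ⟨τ, hF, N, hN, hNm⟩ := hset ρ hρ0ρ
  have hprim := Complex.isPrimitiveRoot_exp e (by omega)
  set ζ := Complex.exp (2 * Real.pi * Complex.I / e)
  have hζ : ζ ^ e = 1 := hprim.pow_eq_one
  have hζ1 : ζ ≠ 1 := hprim.ne_one (by omega)
  have hζn : ‖ζ‖ = 1 := hprim.norm'_eq_one (by omega)
  have hρr : ∀ x, ‖x‖ ≤ R + 1 → ‖q x - 1‖ ≤ 1/2 → ‖rr q e x‖ ≤ ρ := fun x h1 h2 => (hρ0 x h1 h2).trans hρ0ρ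
  have d0 := deg_zeta μ h hE (hRρ0.trans hρ0ρ) hF hρr hN hNm hζ hζ1 hζn
  have dH := deg_H μ h hE (by linarith : R < R + 1) (hRρ0.trans hρ0ρ) hρr (it_cont h hF N) hNm
    (fun t x => ζ • c t x) ((hc.mono hsub).const_smul ζ)
    (fun t ht x hx => ⟨by rw [h.hom, hζ, one_mul]; exact hcm t ht x hx.1, by
      rw [norm_smul, hζn, one_mul]
      exact (hB (t, x) ⟨ht, hx⟩).trans ((le_max_right _ _).trans (le_max_left _ _))⟩)
  have hr : ∀ x ∈ frontier (Om q (R+1)), rr q e x ∈ FK q ρ := fun x hx => by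
    have := Om_frontier h hx
    exact ⟨h.rr_F this.2.1, hρr x this.1 this.2.1⟩
  rw [deg_congr μ (f' := fun x => x - (ss q e τ)^[N] (ζ • (ss q e τ)^[N] (rr q e x)))
    (fun x hx => by simp only []; rw [hc0 _ (it_maps h hF N (hr x hx)).1]), d0,
    deg_congr μ (f' := fun x => x - (ss q e τ)^[N] (ζ • p))
    (fun x hx => by simp only []; rw [hc1 _ (it_maps h hF N (hr x hx)).1]),
    deg_sub_const μ hE (Om_open h _) (Om_bdd _)] at dH
  · exact zero_ne_one dH
  · have := hNm (⟨by rw [h.hom, hζ, one_mul, hp], by rw [norm_smul, hζn, one_mul]; exact le_max_right _ _⟩ : ζ • p ∈ FK q ρ)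
    exact ⟨by linarith [this.2], by rw [this.1]; norm_num⟩

end Idx4

noncomputable section Idx5
variable {E : Type*} [NormedAddCommGroup E] [InnerProductSpace ℂ E] [FiniteDimensional ℂ E]
variable {q : E → ℂ} {e : ℕ} {ρ τ : ℝ}

def lam (e : ℕ) (w : ℂ) : ℂ := Complex.exp (Complex.log w / e)

theorem lam_mm (w : ℂ) : lam e w * mm e w = 1 := by
  rw [lam, mm, ← Complex.exp_add, add_neg_cancel, Complex.exp_zero]

theorem lam_pow (he : 1 ≤ e) {w : ℂ} (hw : w ≠ 0) : lam e w ^ e = w := by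
  have he' : (e:ℂ) ≠ 0 := by exact_mod_cast (by omega : e ≠ 0)
  rw [lam, ← Complex.exp_nat_mul, mul_div_cancel₀ _ he', Complex.exp_log hw]

theorem lam_re (he : 1 ≤ e) {w : ℂ} (hw : 0 < w.re) {j : ℕ} (hj : j ≤ e) : 0 < (lam e w ^ j).re := by
  rw [lam, ← Complex.exp_nat_mul, Complex.exp_re]
  refine mul_pos (Real.exp_pos _) ?_
  have he' : (0:ℝ) < e := by exact_mod_cast he
  have h1 : ((j:ℂ) * (Complex.log w / e)).im = (j / e : ℝ) * w.arg := by
    have : (j:ℂ) * (Complex.log w / e) = ((j / e : ℝ) : ℂ) * Complex.log w := by push_cast; ring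
    rw [this, Complex.im_ofReal_mul, Complex.log_im]
  rw [h1]
  have h2 : |w.arg| < Real.pi / 2 := Complex.abs_arg_lt_pi_div_two_iff.2 (Or.inl hw)
  have h3 : |(j / e : ℝ) * w.arg| < Real.pi / 2 := by
    rw [abs_mul, abs_of_nonneg (by positivity)]
    refine lt_of_le_of_lt ?_ h2
    have : (j / e : ℝ) ≤ 1 := by rw [div_le_one he']; exact_mod_cast hj
    exact mul_le_of_le_one_left (abs_nonneg _) this
  rw [abs_lt] at h3
  exact Real.cos_pos_of_mem_Ioo ⟨by linarith [h3.1], h3.2⟩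

def NN (q : E → ℂ) (e : ℕ) (x : E) : E :=
  ((‖gr q x‖ ^ 2 : ℝ) : ℂ) • x - ((e : ℂ) * q x) • gr q x + (q x - 1) • gr q x

theorem NN_eq (h : HomIso q e) {x : E} (hx : x ≠ 0) :
    NN q e x = ((‖gr q x‖ ^ 2 : ℝ) : ℂ) • kap q e x + (q x - 1) • gr q x := by
  have hg : ((‖gr q x‖ ^ 2 : ℝ) : ℂ) ≠ 0 := by
    have := norm_ne_zero_iff.2 (h.gr_ne hx); exact_mod_cast pow_ne_zero 2 this
  rw [NN, kap, smul_sub, smul_smul, mul_div_cancel₀ _ hg]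

variable [MeasurableSpace E] [BorelSpace E] (μ : Measure E) [μ.IsAddHaarMeasure]

theorem deg_iter (h : HomIso q e) (hE : 0 < Module.finrank ℝ E) {R : ℝ} (hF : Fac q e ρ τ)
    (hkap : ∀ x, q x = 1 → R ≤ ‖x‖ → kap q e x ≠ 0)
    (hρ : ∀ x, ‖x‖ ≤ R + 1 → ‖q x - 1‖ ≤ 1/2 → ‖rr q e x‖ ≤ ρ) (j : ℕ) :
    deg μ (Om q (R+1)) (fun x => x - (ss q e τ)^[j+1] (rr q e x)) =
      deg μ (Om q (R+1)) (fun x => x - ss q e τ (rr q e x)) := by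
  haveI : FiniteDimensional ℝ E := FiniteDimensional.complexToReal E
  have hr : ∀ x ∈ frontier (Om q (R+1)), rr q e x ∈ FK q ρ := fun x hx => by
    have := Om_frontier h hx
    exact ⟨h.rr_F this.2.1, hρ x this.1 this.2.1⟩
  have hrc : ContinuousOn (rr q e) (frontier (Om q (R+1))) := h.rr_cont.mono fun x hx => (Om_frontier h hx).2.1
  induction j with
  | zero => simp
  | succ j ih =>
    rw [← ih]
    have hτ := hF.1
    have ht : ∀ t ∈ Icc (0:ℝ) 1, 0 ≤ (1 - t) * τ ∧ (1 - t) * τ ≤ τ := fun t ht =>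
      ⟨mul_nonneg (by linarith [ht.2]) hτ.le, mul_le_of_le_one_left hτ.le (by linarith [ht.1])⟩
    have := deg_homotopy μ hE (Om_open h (R+1)) (Om_bdd (R+1))
      (fun t x => x - (ss q e τ)^[j+1] (ss q e ((1 - t) * τ) (rr q e x))) ?_ ?_
    · simp only [sub_zero, one_mul, sub_self, zero_mul] at this
      rw [deg_congr μ (f' := fun x => x - (ss q e τ)^[j+1] (ss q e τ (rr q e x))) (fun x hx => by
        simp only []; rw [Function.iterate_succ_apply]), this]
      refine deg_congr μ fun x hx => ?_
      beta_reduce; rw [ss_zero (hr x hx).1]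
    · refine continuousOn_snd.sub ((it_cont h hF (j+1)).comp ((ss_cont h hF).comp
        (f := fun p : ℝ × E => ((1 - p.1) * τ, rr q e p.2)) ?_ ?_) ?_)
      · exact (by fun_prop : ContinuousOn (fun p : ℝ × E => (1 - p.1) * τ) _).prodMk
          (hrc.comp continuousOn_snd fun p hp => hp.2)
      · exact fun p hp => ⟨ht _ hp.1, hr _ hp.2⟩
      · exact fun p hp => (ss_F h hF (ht _ hp.1).1 (ht _ hp.1).2 (hr _ hp.2)).1
    · intro t htt x hx h0
      have hxk := sub_eq_zero.1 h0
      have hs := ss_F h hF (ht t htt).1 (ht t htt).2 (hr x hx)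
      have hxF : x ∈ FK q ρ := by rw [hxk]; exact it_maps h hF _ hs.1
      rw [HomIso.rr_self hxF.1] at hxk hs
      have hxR := (Om_frontier h hx).2.2 hxF.1
      refine hkap x hxF.1 (by linarith) ?_
      have n1 := it_norm h hF (j+1) hs.1
      rw [← hxk] at n1
      have hk2 := it_eq h hF (by omega : 1 ≤ j + 1) hs.1 (by rw [← hxk]; exact hs.2)
      by_cases ht0 : (1 - t) * τ = 0
      · rwa [ht0, ss_zero hxF.1] at hk2
      · exact ss_eq h hF (lt_of_le_of_ne (ht t htt).1 (Ne.symm ht0)) (ht t htt).2 hxF n1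

theorem deg_step1 (h : HomIso q e) (hE : 0 < Module.finrank ℝ E) {R : ℝ} (hF : Fac q e ρ τ)
    (hkap : ∀ x, q x = 1 → R ≤ ‖x‖ → kap q e x ≠ 0)
    (hρ : ∀ x, ‖x‖ ≤ R + 1 → ‖q x - 1‖ ≤ 1/2 → ‖rr q e x‖ ≤ ρ) :
    deg μ (Om q (R+1)) (fun x => x - ss q e τ (rr q e x)) =
      deg μ (Om q (R+1)) (fun x => x - rr q e x + τ • kap q e (rr q e x)) := by
  haveI : FiniteDimensional ℝ E := FiniteDimensional.complexToReal E
  have hr : ∀ x ∈ frontier (Om q (R+1)), rr q e x ∈ FK q ρ := fun x hx => by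
    have := Om_frontier h hx
    exact ⟨h.rr_F this.2.1, hρ x this.1 this.2.1⟩
  have hrc : ContinuousOn (rr q e) (frontier (Om q (R+1))) := h.rr_cont.mono fun x hx => (Om_frontier h hx).2.1
  have hrc2 : ContinuousOn (fun p : ℝ × E => rr q e p.2) (Icc 0 1 ×ˢ frontier (Om q (R+1))) :=
    hrc.comp continuousOn_snd fun p hp => hp.2
  have hkc : ContinuousOn (fun p : ℝ × E => kap q e (rr q e p.2)) (Icc 0 1 ×ˢ frontier (Om q (R+1))) :=
    h.kap_cont.comp hrc2 fun p hp => h.ne0 (hr _ hp.2).1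
  have hsc : ContinuousOn (fun p : ℝ × E => ss q e τ (rr q e p.2)) (Icc 0 1 ×ˢ frontier (Om q (R+1))) :=
    (ss_cont' h hF hF.1.le le_rfl).comp hrc2 fun p hp => hr _ hp.2
  have := deg_homotopy μ hE (Om_open h (R+1)) (Om_bdd (R+1))
      (fun v x => x - rr q e x + τ • kap q e (rr q e x)
        - (1 - v) • (ss q e τ (rr q e x) - (rr q e x - τ • kap q e (rr q e x)))) ?_ ?_
  · simp only [sub_self, zero_smul, sub_zero, one_smul] at this
    rw [← this]
    congr 1; funext x; abel
  · exact ((continuousOn_snd.sub hrc2).add (hkc.const_smul τ)).sub ((by fun_prop : ContinuousOn (fun p : ℝ × E => 1 - p.1) _).smul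
      (hsc.sub (hrc2.sub (hkc.const_smul τ))))
  · intro v hv x hx h0
    have hxo := Om_frontier h hx
    have hq0 := (hr x hx).1
    have hne := h.ne0 hq0
    have hf := hF.2 τ hF.1.le le_rfl _ hq0 (hr x hx).2
    have hxr : x = lam e (q x) • rr q e x := by rw [rr, smul_smul, lam_mm, one_smul]
    have hdk := h.dkap hne
    have heu := h.euler (rr q e x)
    rw [hq0, mul_one] at heu
    set r := rr q e x with hrdef
    set l := lam e (q x) with hl
    set k := kap q e r with hk
    set y := r - τ • k with hy
    have hyc : y = r - (τ:ℂ) • k := by rw [hy, Complex.coe_smul]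
    have hss : ss q e τ r = mm e (q y) • y := by rw [ss, rr]
    set m := mm e (q y) with hm
    set a : ℂ := ((1 - v : ℝ) : ℂ) * (m - 1) with ha
    have he' : (e:ℂ) ≠ 0 := by have := h.he; exact_mod_cast (by omega : e ≠ 0)
    have eq1 : (l - 1) • r + (τ:ℂ) • k - a • y = 0 := by
      rw [← h0, hss, ← Complex.coe_smul, ← Complex.coe_smul]
      conv_rhs => rw [hxr]
      rw [ha]; module
    have eq2 : l - 1 = a := by
      have := congrArg (fderiv ℂ q r) eq1
      rw [hyc] at this
      simp only [map_sub, map_add, map_smul, map_zero, hdk, heu, smul_eq_mul, mul_zero, add_zero, sub_zero] at this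
      rw [← sub_mul] at this
      exact sub_eq_zero.1 ((mul_eq_zero.1 this).resolve_right he')
    have eq3 : ((1 + a) * τ) • k = 0 := by
      rw [← eq1, eq2, hyc]; module
    have ha1 : ‖a‖ ≤ 1/2 := by
      rw [ha, norm_mul, Complex.norm_real, Real.norm_of_nonneg (by linarith [hv.2])]
      have := hf.2.1
      nlinarith [norm_nonneg (m - 1), hv.1]
    have hk0 : k = 0 := by
      refine (smul_eq_zero.1 eq3).resolve_left (mul_ne_zero ?_ (by exact_mod_cast hF.1.ne'))
      intro h1
      have : a = -1 := by linear_combination h1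
      rw [this] at ha1; norm_num at ha1
    have hyr : y = r := by rw [hy, hk0]; simp
    have ha0 : a = 0 := by rw [ha, hm, hyr, hq0, mm_one]; simp
    have hxr' : x = r := by
      have : l = 1 := by rw [ha0] at eq2; linear_combination eq2
      rw [hxr, this, one_smul]
    have hqx : q x = 1 := by rw [hxr', hq0]
    refine hkap x hqx (by linarith [hxo.2.2 hqx]) ?_
    rw [hxr', ← hk, hk0]

theorem log_cont (h : HomIso q e) {R : ℝ} : ContinuousOn (fun x => Complex.log (q x)) (frontier (Om q R)) := by
  intro x hx
  exact ((h.cont.continuousAt).clog (slit_of (Om_frontier h hx).2.1)).continuousWithinAt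

theorem deg_step2 (h : HomIso q e) (hE : 0 < Module.finrank ℝ E) {R : ℝ} (hR : 1 ≤ R) (hτ : 0 < τ)
    (hkap : ∀ x, q x = 1 → R ≤ ‖x‖ → kap q e x ≠ 0) :
    deg μ (Om q (R+1)) (fun x => x - rr q e x + τ • kap q e (rr q e x)) =
    deg μ (Om q (R+1)) (fun x => (lam e (q x) - 1) • x + τ • kap q e x) := by
  haveI : FiniteDimensional ℝ E := FiniteDimensional.complexToReal E
  have hne : ∀ x ∈ frontier (Om q (R+1)), x ≠ 0 := by
    rintro x hx rfl
    have := (Om_frontier h hx).2.1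
    rw [h.zero] at this; norm_num at this
  have hqne : ∀ x ∈ frontier (Om q (R+1)), q x ≠ 0 := by
    intro x hx h0
    have := (Om_frontier h hx).2.1
    rw [h0] at this; norm_num at this
  have he' : (e:ℂ) ≠ 0 := by have := h.he; exact_mod_cast (by omega : e ≠ 0)
  have hlc : ContinuousOn (fun p : ℝ × E => Complex.log (q p.2)) (Icc 0 1 ×ˢ frontier (Om q (R+1))) :=
    (log_cont h).comp continuousOn_snd fun p hp => hp.2
  have := deg_homotopy μ hE (Om_open h (R+1)) (Om_bdd (R+1))
      (fun v x => (lam e (q x) - 1) • (Complex.exp (-((1 - v : ℝ) * (Complex.log (q x) / e))) • x)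
        + τ • kap q e (Complex.exp (-((1 - v : ℝ) * (Complex.log (q x) / e))) • x)) ?_ ?_
  · simp only [sub_self, zero_smul, sub_zero, one_smul, Complex.ofReal_zero, zero_mul, neg_zero, Complex.exp_zero, Complex.ofReal_one, one_mul] at this
    rw [← this]
    congr 1; funext x
    have : Complex.exp (-(Complex.log (q x) / e)) • x = rr q e x := rfl
    rw [this]
    have hxr : x = lam e (q x) • rr q e x := by rw [rr, smul_smul, lam_mm, one_smul]
    rw [sub_smul, ← hxr, one_smul]
  · have c1 : ContinuousOn (fun p : ℝ × E => Complex.exp (-((1 - p.1 : ℝ) * (Complex.log (q p.2) / e))) • p.2)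
        (Icc 0 1 ×ˢ frontier (Om q (R+1))) := by fun_prop
    refine ContinuousOn.add (ContinuousOn.smul ?_ c1) ((h.kap_cont.comp c1 ?_).const_smul τ)
    · unfold lam; fun_prop
    · exact fun p hp => smul_ne_zero (Complex.exp_ne_zero _) (hne _ hp.2)
  · intro v hv x hx h0
    set a := Complex.exp (-((1 - v : ℝ) * (Complex.log (q x) / e))) with ha
    have ha0 : a ≠ 0 := Complex.exp_ne_zero _
    have hax : a • x ≠ 0 := smul_ne_zero ha0 (hne x hx)
    have hqw : q (a • x) ≠ 0 := by rw [h.hom]; exact mul_ne_zero (pow_ne_zero _ ha0) (hqne x hx)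
    have : (lam e (q x) - 1) * (e * q (a • x)) = 0 := by
      generalize a • x = w at *
      have := congrArg (fderiv ℂ q w) h0
      rw [← Complex.coe_smul] at this
      simpa only [map_add, map_zero, map_smul, h.dkap hax, smul_zero, add_zero, h.euler, smul_eq_mul, mul_zero] using this
    have hl : lam e (q x) = 1 := by
      refine sub_eq_zero.1 ((mul_eq_zero.1 this).resolve_right ?_)
      exact mul_ne_zero he' hqw
    have hq1 : q x = 1 := by rw [← lam_pow h.he (hqne x hx), hl, one_pow]
    have ha1 : a = 1 := by rw [ha, hq1]; simp
    rw [hl, sub_self, zero_smul, zero_add, ha1, one_smul] at h0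
    exact hkap x hq1 (by linarith [(Om_frontier h hx).2.2 hq1]) ((smul_eq_zero.1 h0).resolve_left hτ.ne')

theorem NN_cont (h : HomIso q e) : Continuous (NN q e) := by
  have h1 := h.gr_cont; have h2 := h.cont
  unfold NN; fun_prop

theorem deg_step3 (h : HomIso q e) (hE : 0 < Module.finrank ℝ E) {R : ℝ} (hR : 1 ≤ R) (hτ : 0 < τ)
    (hkap : ∀ x, q x = 1 → R ≤ ‖x‖ → kap q e x ≠ 0) :
    deg μ (Om q (R+1)) (fun x => (lam e (q x) - 1) • x + τ • kap q e x) = deg μ (Om q (R+1)) (NN q e) := by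
  haveI : FiniteDimensional ℝ E := FiniteDimensional.complexToReal E
  have hqne : ∀ x ∈ frontier (Om q (R+1)), q x ≠ 0 := by
    intro x hx h0
    have := (Om_frontier h hx).2.1
    rw [h0] at this; norm_num at this
  have hne : ∀ x ∈ frontier (Om q (R+1)), x ≠ 0 := by
    rintro x hx rfl
    exact hqne _ hx h.zero
  have he' : (e:ℂ) ≠ 0 := by have := h.he; exact_mod_cast (by omega : e ≠ 0)
  have hlc : ContinuousOn (fun p : ℝ × E => Complex.log (q p.2)) (Icc 0 1 ×ˢ frontier (Om q (R+1))) :=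
    (log_cont h).comp continuousOn_snd fun p hp => hp.2
  have hkc : ContinuousOn (fun p : ℝ × E => kap q e p.2) (Icc 0 1 ×ˢ frontier (Om q (R+1))) :=
    h.kap_cont.comp continuousOn_snd fun p hp => hne _ hp.2
  have := deg_homotopy μ hE (Om_open h (R+1)) (Om_bdd (R+1))
      (fun s x => (((1 - s : ℝ) : ℂ) * (lam e (q x) - 1)) • x + ((s : ℂ) * (q x - 1)) • gr q x
        + (((1 - s) * τ + s * ‖gr q x‖ ^ 2 : ℝ) : ℂ) • kap q e x) ?_ ?_
  · simp only [sub_self, zero_smul, sub_zero, one_smul, Complex.ofReal_zero, zero_mul, neg_zero, Complex.exp_zero, Complex.ofReal_one, one_mul, zero_add, add_zero, Complex.coe_smul] at this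
    rw [this]
    refine deg_congr μ fun x hx => ?_
    rw [NN_eq h (hne x hx)]; simp only [Complex.coe_smul]; rw [add_comm]
  · have h1 := h.gr_cont; have h2 := h.cont
    refine ContinuousOn.add (ContinuousOn.add (ContinuousOn.smul ?_ continuousOn_snd) (by fun_prop)) (ContinuousOn.smul (by fun_prop) hkc)
    unfold lam; fun_prop
  · intro s hs x hx h0
    have hxo := Om_frontier h hx
    have hre := re_of hxo.2.1
    have hd := congrArg (fderiv ℂ q x) h0
    simp only [map_add, map_zero, map_smul, h.dkap (hne x hx), h.euler, fderiv_gr, smul_zero, add_zero, smul_eq_mul, mul_zero] at hd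
    have hgp : 0 < ‖gr q x‖ ^ 2 := by have := norm_pos_iff.2 (h.gr_ne (hne x hx)); positivity
    have hl : lam e (q x) = 1 := by
      by_contra hl
      have hgeo : q x - 1 = (lam e (q x) - 1) * ∑ j ∈ Finset.range e, lam e (q x) ^ j := by
        rw [mul_comm, geom_sum_mul, lam_pow h.he (hqne x hx)]
      have hprod : (lam e (q x) - 1) * (((1 - s : ℝ) : ℂ) * (e * q x) + (s * ‖gr q x‖ ^ 2 : ℝ) * ∑ j ∈ Finset.range e, lam e (q x) ^ j) = 0 := by
        rw [hgeo] at hd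
        rw [← hd]; push_cast; ring
      have h2 := (mul_eq_zero.1 hprod).resolve_left (sub_ne_zero.2 hl)
      have h3 := congrArg Complex.re h2
      have h4 : ((e:ℂ) * q x).re = e * (q x).re := by
        have := Complex.re_ofReal_mul (e:ℝ) (q x); simpa using this
      rw [Complex.add_re, Complex.re_ofReal_mul, Complex.re_ofReal_mul, h4, Complex.re_sum, Complex.zero_re] at h3
      have hsum : 0 < ∑ j ∈ Finset.range e, (lam e (q x) ^ j).re :=
        Finset.sum_pos (fun j hj => lam_re h.he hre (Finset.mem_range.1 hj).le) ⟨0, Finset.mem_range.2 (by have := h.he; omega)⟩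
      have hep : (0:ℝ) < e * (q x).re := mul_pos (by exact_mod_cast h.he) hre
      have t1 : 0 ≤ (1 - s) * (e * (q x).re) := mul_nonneg (by linarith [hs.2]) hep.le
      have t2 : 0 ≤ s * ‖gr q x‖ ^ 2 * ∑ j ∈ Finset.range e, (lam e (q x) ^ j).re :=
        mul_nonneg (mul_nonneg hs.1 hgp.le) hsum.le
      have t3 : (1 - s) * (e * (q x).re) = 0 := by linarith
      have t4 : s * ‖gr q x‖ ^ 2 * ∑ j ∈ Finset.range e, (lam e (q x) ^ j).re = 0 := by linarith
      have s1 := (mul_eq_zero.1 t3).resolve_right hep.ne'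
      have s0 := (mul_eq_zero.1 ((mul_eq_zero.1 t4).resolve_right hsum.ne')).resolve_right hgp.ne'
      linarith
    have hq1 : q x = 1 := by rw [← lam_pow h.he (hqne x hx), hl, one_pow]
    have hpos : (0:ℝ) < (1 - s) * τ + s * ‖gr q x‖ ^ 2 := by
      rcases hs.1.eq_or_lt with rfl | h1
      · simpa using hτ
      · have : 0 ≤ (1 - s) * τ := mul_nonneg (by linarith [hs.2]) hτ.le
        have := mul_pos h1 hgp
        linarith
    rw [hl, hq1, sub_self, mul_zero, mul_zero, zero_smul, zero_smul, add_zero, zero_add] at h0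
    exact hkap x hq1 (by linarith [hxo.2.2 hq1]) ((smul_eq_zero.1 h0).resolve_left (by exact_mod_cast hpos.ne'))

end Idx5

noncomputable section Idx6
variable {E : Type*} [NormedAddCommGroup E] [InnerProductSpace ℂ E] [FiniteDimensional ℂ E]
variable {q : E → ℂ} {e : ℕ} {ρ τ : ℝ}

theorem HomIso.fderiv_zero (h : HomIso q e) (he : 2 ≤ e) : fderiv ℂ q 0 = 0 := by
  have e1 := h.fderiv_smul two_ne_zero 0
  rw [smul_zero] at e1
  ext v
  have e2 : fderiv ℂ q 0 v = 2 ^ (e-1) * fderiv ℂ q 0 v := by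
    conv_lhs => rw [e1]
    simp
  have e' : ((1:ℂ) - 2 ^ (e-1)) * fderiv ℂ q 0 v = 0 := by
    rw [sub_mul, ← e2, one_mul, sub_self]
  refine (mul_eq_zero.1 e').resolve_left fun e'' => ?_
  have : (2:ℂ)^(e-1) = ((2 ^ (e-1) : ℕ) : ℂ) := by push_cast; rfl
  rw [this, sub_eq_zero, eq_comm, Nat.cast_eq_one] at e''
  have := Nat.one_lt_two_pow (n := e-1) (by omega)
  omega

section
variable {ι : Type*} [Fintype ι] (b : OrthonormalBasis ι ℂ E)

def Jlin : E →ₗ[ℝ] E where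
  toFun x := ∑ i, (starRingEnd ℂ) (inner ℂ (b i) x) • b i
  map_add' x y := by simp [inner_add_right, add_smul, Finset.sum_add_distrib]
  map_smul' c x := by
    rw [← Complex.coe_smul]
    simp [inner_smul_right, mul_smul, Finset.smul_sum]

theorem Jlin_apply (x : E) : Jlin b x = ∑ i, (starRingEnd ℂ) (inner ℂ (b i) x) • b i := rfl

theorem Jlin_sum (a : ι → ℂ) : Jlin b (∑ i, a i • b i) = ∑ i, (starRingEnd ℂ) (a i) • b i := by
  rw [Jlin_apply]
  refine Finset.sum_congr rfl fun i _ => ?_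
  rw [b.orthonormal.inner_right_fintype]

theorem Jlin_Jlin (x : E) : Jlin b (Jlin b x) = x := by
  conv_lhs => rw [Jlin_apply b x, Jlin_sum]
  simp only [Complex.conj_conj]
  exact b.sum_repr' x
end

variable [MeasurableSpace E] [BorelSpace E] (μ : Measure E) [μ.IsAddHaarMeasure]

theorem deg_gr_ne_one (h : HomIso q e) (he : 3 ≤ e) (hE : 0 < Module.finrank ℝ E) {ε : ℝ} (hε : 0 < ε) :
    deg μ (ball 0 ε) (fun x => - gr q x) ≠ 1 := by
  haveI : FiniteDimensional ℝ E := FiniteDimensional.complexToReal E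
  let b := stdOrthonormalBasis ℂ E
  let J : E →L[ℝ] E := LinearMap.toContinuousLinearMap (Jlin b)
  have hc1 : ContDiff ℂ 1 (fderiv ℂ q) := h.cd.fderiv_right (by norm_num)
  set H : E → E := fun x => ∑ i, (-(fderiv ℂ q x (b i))) • b i with hH
  have key : (fun x => - gr q x) = fun x => J (H x) := by
    funext x
    have h1 : gr q x = Jlin b (∑ i, (fderiv ℂ q x (b i)) • b i) := by
      rw [Jlin_sum]
      conv_lhs => rw [← b.sum_repr' (gr q x)]
      refine Finset.sum_congr rfl fun i _ => ?_
      rw [← inner_gr, inner_conj_symm]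
    rw [h1, ← map_neg]
    show Jlin b _ = Jlin b _
    congr 1; rw [hH]; simp [Finset.sum_neg_distrib]
  rw [key]
  refine deg_conj_ne_one μ hE (m := e - 1) ?_ (by omega) ?_ ?_ J (fun x => Jlin_Jlin b x) hε
  · rw [hH]
    refine ContDiff.sum fun i _ => ContDiff.smul (ContDiff.neg (hc1.clm_apply contDiff_const)) contDiff_const
  · intro c x
    by_cases hc : c = 0
    · rw [hc, zero_smul, zero_pow (by omega), zero_smul, hH]
      simp [h.fderiv_zero (by omega)]
    · simp only [hH]
      rw [h.fderiv_smul hc, Finset.smul_sum]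
      refine Finset.sum_congr rfl fun i _ => ?_
      simp [mul_smul]
  · intro x hx h0
    have := congrFun key x
    simp only [h0, map_zero, neg_eq_zero] at this
    exact h.gr_ne hx this

theorem deg_NN (h : HomIso q e) (he : 3 ≤ e) (hE : 0 < Module.finrank ℝ E) {R : ℝ} (hR : 1 ≤ R)
    (hpar : ∀ (x : E) (c : ℂ), R ≤ ‖x‖ → x = c • gr q x → 1 < ‖q x‖)
    (hkap : ∀ x, q x = 1 → R ≤ ‖x‖ → kap q e x ≠ 0) :
    deg μ (Om q (R+1)) (NN q e) ≠ 0 := by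
  haveI : FiniteDimensional ℝ E := FiniteDimensional.complexToReal E
  have he' : (e:ℂ) ≠ 0 := by exact_mod_cast (by omega : e ≠ 0)
  obtain ⟨ε, hε, hεq⟩ : ∃ ε > 0, ∀ x : E, ‖x‖ ≤ ε → ‖q x‖ < 1/2 := by
    have hq : ContinuousAt (fun x => ‖q x‖) 0 := h.cont.norm.continuousAt
    have h1 : ∀ᶠ x in 𝓝 (0:E), ‖q x‖ < 1/2 := hq.eventually_lt_const (by simp [h.zero])
    obtain ⟨ε, hε, h2⟩ := Metric.eventually_nhds_iff.1 h1
    refine ⟨ε/2, by positivity, fun x hx => h2 ?_⟩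
    rw [dist_zero_right]; linarith
  set ε' := min ε 1
  have hε' : 0 < ε' := by positivity
  have hgpos : ∀ x : E, x ≠ 0 → 0 < ‖gr q x‖ ^ 2 := fun x hx => by
    have := norm_pos_iff.2 (h.gr_ne hx); positivity
  have hgc : ∀ x : E, x ≠ 0 → ((‖gr q x‖ ^ 2 : ℝ) : ℂ) ≠ 0 := fun x hx => by exact_mod_cast (hgpos x hx).ne'
  have hdN : ∀ x, fderiv ℂ q x (NN q e x) = (q x - 1) * ((‖gr q x‖ ^ 2 : ℝ) : ℂ) := by
    intro x
    rw [NN]; simp only [map_add, map_sub, map_smul, h.euler, fderiv_gr, smul_eq_mul]; ring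
  have hadd := deg_add μ hE (isOpen_ball (x := (0:E)) (ε := R+1)) (Om_open h (R+1)) (isOpen_ball (x := (0:E)) (ε := ε'))
    (fun x hx => by simpa using hx.1) (ball_subset_ball (by have := min_le_right ε 1; linarith))
    (disjoint_left.2 fun x h1 h2 => by
      have h3 := hεq x (by rw [mem_ball_zero_iff] at h2; exact h2.le.trans (min_le_left _ _))
      have h4 := h1.2
      have := norm_sub_norm_le 1 (q x)
      rw [norm_sub_rev] at h4; simp at this; linarith) isBounded_ball (f := NN q e) (NN_cont h).continuousOn
    (by
      intro x hx h1 h2 h0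
      have hx0 : x ≠ 0 := by rintro rfl; exact h2 (mem_ball_self hε')
      have hd := hdN x
      rw [h0, map_zero] at hd
      have hq1 : q x = 1 := sub_eq_zero.1 ((mul_eq_zero.1 hd.symm).resolve_right (hgc x hx0))
      rw [NN_eq h hx0, hq1, sub_self, zero_smul, add_zero] at h0
      have hk := (smul_eq_zero.1 h0).resolve_left (hgc x hx0)
      refine h1 ⟨?_, by rw [hq1]; norm_num⟩
      by_contra! h3
      exact hkap x hq1 (by linarith) hk)
  have d1 : deg μ (ball 0 (R+1)) (NN q e) = 1 := by
    have hh := deg_homotopy μ hE (isOpen_ball (x := (0:E)) (ε := R+1)) isBounded_ball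
      (fun u x => ((1 - u : ℝ) : ℂ) • NN q e x + (u:ℂ) • x) ?_ ?_
    · simp only [sub_zero, Complex.ofReal_one, one_smul, Complex.ofReal_zero, zero_smul, add_zero, sub_self, zero_add] at hh
      rw [hh]
      have := deg_sub_const μ hE (isOpen_ball (x := (0:E)) (ε := R+1)) isBounded_ball (mem_ball_self (by linarith))
      simpa using this
    · have := NN_cont h; fun_prop
    · intro u hu x hx h0
      rw [frontier_ball _ (by linarith), mem_sphere_zero_iff_norm] at hx
      have hx0 : x ≠ 0 := by rintro rfl; simp at hx; linarith
      have hd := congrArg (fderiv ℂ q x) h0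
      simp only [map_add, map_smul, hdN, h.euler, map_zero, smul_eq_mul] at hd
      set G := ‖gr q x‖ ^ 2 with hG
      have hGp := hgpos x hx0
      have hden : 0 < (1 - u) * G + u * e := by
        rcases hu.1.eq_or_lt with rfl | h1
        · simpa using hGp
        · have : 0 ≤ (1 - u) * G := mul_nonneg (by linarith [hu.2]) hGp.le
          have : 0 < u * e := mul_pos h1 (by exact_mod_cast (by omega : 0 < e))
          linarith
      have hqe : (((1 - u) * G + u * e : ℝ) : ℂ) * q x = (((1 - u) * G : ℝ) : ℂ) := by
        push_cast at hd ⊢; linear_combination hd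
      have hqn := congrArg norm hqe
      rw [norm_mul, Complex.norm_real, Complex.norm_real, Real.norm_of_nonneg hden.le,
        Real.norm_of_nonneg (mul_nonneg (by linarith [hu.2]) hGp.le)] at hqn
      have hle : ‖q x‖ ≤ 1 := by
        by_contra! h1
        have : 0 ≤ u * e := mul_nonneg hu.1 (by positivity)
        nlinarith [mul_lt_mul_of_pos_left h1 hden]
      have hA : 0 < (1 - u) * G + u := by
        rcases hu.1.eq_or_lt with rfl | h1
        · simpa using hGp
        · have : 0 ≤ (1 - u) * G := mul_nonneg (by linarith [hu.2]) hGp.le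
          linarith
      have hAc : (((1 - u) * G + u : ℝ) : ℂ) ≠ 0 := by exact_mod_cast hA.ne'
      have hx' : x = ((((1 - u) * G + u : ℝ) : ℂ)⁻¹ * ((1 - u : ℝ) * (e * q x - (q x - 1)))) • gr q x := by
        rw [mul_smul, eq_inv_smul_iff₀ hAc, ← sub_eq_zero, ← h0, NN, ← hG]
        push_cast; module
      have := hpar x _ (by linarith) hx'
      linarith
  have d2 : deg μ (ball 0 ε') (NN q e) = deg μ (ball 0 ε') (fun x => - gr q x) := by
    have hh := deg_homotopy μ hE (isOpen_ball (x := (0:E)) (ε := ε')) isBounded_ball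
      (fun u x => ((1 - u : ℝ) : ℂ) • NN q e x - (u:ℂ) • gr q x) ?_ ?_
    · simpa using hh
    · have := NN_cont h; have := h.gr_cont; fun_prop
    · intro u hu x hx h0
      rw [frontier_ball _ hε'.ne', mem_sphere_zero_iff_norm] at hx
      have hx0 : x ≠ 0 := by rintro rfl; simp at hx; exact hε'.ne hx
      have hd := congrArg (fderiv ℂ q x) h0
      simp only [map_sub, map_smul, hdN, h.euler, map_zero, smul_eq_mul, fderiv_gr] at hd
      have h1 : ((1 - u : ℝ) : ℂ) * q x = 1 := by
        have : (((1 - u : ℝ) : ℂ) * q x - 1) * ((‖gr q x‖ ^ 2 : ℝ) : ℂ) = 0 := by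
          rw [← hd]; push_cast; ring
        exact sub_eq_zero.1 ((mul_eq_zero.1 this).resolve_right (hgc x hx0))
      have h2 := congrArg norm h1
      rw [norm_mul, Complex.norm_real, Real.norm_of_nonneg (by linarith [hu.2]), norm_one] at h2
      have h3 := hεq x (by rw [hx]; exact min_le_left _ _)
      nlinarith [hu.1, hu.2, norm_nonneg (q x)]
  have d3 := deg_gr_ne_one μ h he hE hε'
  rw [d1, d2] at hadd
  intro h0
  rw [h0, zero_add] at hadd
  exact d3 hadd.symm

end Idx6

section Idx7
variable {E : Type*} [NormedAddCommGroup E] [InnerProductSpace ℂ E] [FiniteDimensional ℂ E]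
variable {q : E → ℂ} {e : ℕ}

theorem no_rotate (h : HomIso q e) (he : 3 ≤ e) {ζ : ℂ} (hζ : ζ ^ e = 1) (hζ1 : ζ ≠ 1) (hne : ∃ p, q p = 1) :
    ∃ R : ℝ, 0 < R ∧ ∀ (C : ℝ → E → E), ContinuousOn (fun p : ℝ × E => C p.1 p.2) (Icc 0 1 ×ˢ FK q R) →
    (∀ t ∈ Icc (0:ℝ) 1, ∀ x ∈ FK q R, q (C t x) = 1) → (∀ x ∈ FK q R, C 0 x = x) →
    (∀ x ∈ FK q R, C 1 x = ζ • x) → False := by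
  letI : MeasurableSpace E := borel E
  haveI : BorelSpace E := ⟨rfl⟩
  haveI : FiniteDimensional ℝ E := FiniteDimensional.complexToReal E
  let μ : Measure E := Measure.addHaar
  obtain ⟨p, hp⟩ := hne
  have hE := finrank_pos_of (h.ne0 hp)
  obtain ⟨R, hR1, hpar, hkap, ρ0, hRρ0, hρ0, hset⟩ := setup h
  refine ⟨R, by linarith, fun C hc hcm hc0 hc1 => ?_⟩
  obtain ⟨B, hB⟩ := (isCompact_Icc.prod (FK_compact h R)).exists_bound_of_continuousOn hc
  set ρ := max ρ0 B with hρ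
  have hρ0ρ : ρ0 ≤ ρ := le_max_left _ _
  obtain ⟨τ, hF, N, hN, hNm⟩ := hset ρ hρ0ρ
  have hζn : ‖ζ‖ = 1 := Complex.norm_eq_one_of_pow_eq_one hζ (by omega)
  have hρr : ∀ x, ‖x‖ ≤ R + 1 → ‖q x - 1‖ ≤ 1/2 → ‖rr q e x‖ ≤ ρ := fun x h1 h2 => (hρ0 x h1 h2).trans hρ0ρ
  have d0 := deg_zeta μ h hE (hRρ0.trans hρ0ρ) hF hρr hN hNm hζ hζ1 hζn
  have dH := deg_H μ h hE (by linarith : R < R + 1) (hRρ0.trans hρ0ρ) hρr (it_cont h hF N) hNm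
    C hc (fun t ht x hx => ⟨hcm t ht x hx, (hB (t, x) ⟨ht, hx⟩).trans (le_max_right _ _)⟩)
  have hr : ∀ x ∈ frontier (Om q (R+1)), rr q e x ∈ FK q ρ := fun x hx => by
    have := Om_frontier h hx
    exact ⟨h.rr_F this.2.1, hρr x this.1 this.2.1⟩
  rw [deg_congr μ (f' := fun x => x - (ss q e τ)^[(2 * N - 1) + 1] (rr q e x))
    (fun x hx => by
      have h2 : 2 * N - 1 + 1 = N + N := by omega
      beta_reduce; rw [hc0 _ (hNm (hr x hx)), h2, Function.iterate_add_apply]),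
    deg_iter μ h hE hF hkap hρr, deg_step1 μ h hE hF hkap hρr, deg_step2 μ h hE hR1 hF.1 hkap,
    deg_step3 μ h hE hR1 hF.1 hkap,
    deg_congr μ (f := fun x => x - (ss q e τ)^[N] (C 1 ((ss q e τ)^[N] (rr q e x)))) (f' := fun x => x - (ss q e τ)^[N] (ζ • (ss q e τ)^[N] (rr q e x)))
    (fun x hx => by beta_reduce; rw [hc1 _ (hNm (hr x hx))]), d0] at dH
  exact deg_NN μ h he hE hR1 hpar hkap dH

end Idx7

noncomputable section Lg1
variable {X : Type*} [TopologicalSpace X]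

theorem hlog {S : Set X} {u : ℝ → X → ℂ}
    (hu : ContinuousOn (fun p : ℝ × X => u p.1 p.2) (Icc 0 1 ×ˢ S))
    (h0 : ∀ t ∈ Icc (0:ℝ) 1, ∀ x ∈ S, u t x ≠ 0) :
    ∃ L : ℝ → X → ℂ, ContinuousOn (fun p : ℝ × X => L p.1 p.2) (Icc 0 1 ×ˢ S) ∧
      (∀ x ∈ S, L 0 x = 0) ∧
      ∀ t ∈ Icc (0:ℝ) 1, ∀ x ∈ S, u t x = u 0 x * Complex.exp (L t x) := by
  classical
  have z1 : (0:ℝ) ∈ Icc (0:ℝ) 1 := by simp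
  let H : C(unitInterval × S, {z : ℂ // z ≠ 0}) :=
    ⟨fun p => ⟨u p.1 p.2 / u 0 p.2, div_ne_zero (h0 _ p.1.2 _ p.2.2) (h0 _ z1 _ p.2.2)⟩, by
      refine Continuous.subtype_mk ?_ _
      refine Continuous.div ?_ ?_ (fun p => h0 _ z1 _ p.2.2)
      · exact hu.comp_continuous (f := fun p : unitInterval × S => ((p.1:ℝ),(p.2:X))) (by fun_prop)
          (fun p => ⟨p.1.2, p.2.2⟩)
      · exact hu.comp_continuous (f := fun p : unitInterval × S => ((0:ℝ),(p.2:X))) (by fun_prop)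
          (fun p => ⟨z1, p.2.2⟩)⟩
  let f : C(S, ℂ) := ContinuousMap.const _ 0
  have H0 : ∀ a : S, H (0, a) = (fun z:ℂ => (⟨_, z.exp_ne_zero⟩ : {z:ℂ // z≠0})) (f a) := by
    intro a
    apply Subtype.ext
    simp [H, f, div_self (h0 _ z1 _ a.2)]
  let G := Complex.isCoveringMap_exp.liftHomotopy H f H0
  have hG := Complex.isCoveringMap_exp.liftHomotopy_lifts H f H0
  have hG0 := Complex.isCoveringMap_exp.liftHomotopy_zero H f H0
  let L : ℝ → X → ℂ := fun t x => if h : t ∈ Icc (0:ℝ) 1 ∧ x ∈ S then G (⟨t,h.1⟩,⟨x,h.2⟩) else 0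
  refine ⟨L, ?_, ?_, ?_⟩
  · rw [continuousOn_iff_continuous_domRestrict]
    have : (Icc (0:ℝ) 1 ×ˢ S).domRestrict (fun p : ℝ × X => L p.1 p.2) =
        fun p => G (⟨p.1.1, p.2.1⟩, ⟨p.1.2, p.2.2⟩) := by
      ext p
      have : p.1.1 ∈ Icc (0:ℝ) 1 ∧ p.1.2 ∈ S := ⟨p.2.1, p.2.2⟩
      simp only [domRestrict_apply, L]
      rw [dif_pos this]
    rw [this]
    exact G.continuous.comp (by fun_prop)
  · intro x hx
    simp only [L]
    rw [dif_pos ⟨z1, hx⟩]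
    exact hG0 ⟨x, hx⟩
  · intro t ht x hx
    simp only [L]
    rw [dif_pos ⟨ht, hx⟩]
    have := congr_arg Subtype.val (congrFun hG (⟨t,ht⟩,⟨x,hx⟩))
    simp only [Function.comp, H, ContinuousMap.coe_mk] at this
    rw [show G (⟨t,ht⟩,⟨x,hx⟩) = Complex.isCoveringMap_exp.liftHomotopy H f H0 (⟨t,ht⟩,⟨x,hx⟩) from rfl, this]
    have := h0 _ z1 _ hx
    field_simp

theorem exp_eq_one_const {S : Set X} (hS : IsPreconnected S) {f : X → ℂ} (hf : ContinuousOn f S)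
    (h1 : ∀ x ∈ S, Complex.exp (f x) = 1) {x y : X} (hx : x ∈ S) (hy : y ∈ S) : f x = f y := by
  have hk : ∀ z ∈ S, ∃ k : ℤ, f z = k * (2 * Real.pi * Complex.I) := fun z hz =>
    Complex.exp_eq_one_iff.1 (h1 z hz)
  refine hS.constant_of_mapsTo (T := Set.range fun k : ℤ => (k:ℂ) * (2 * Real.pi * Complex.I))
    ?_ hf ?_ hx hy
  · have : IsDiscrete (Set.range fun k : ℤ => (k:ℂ) * (2 * Real.pi * Complex.I)) := by
      have h2 : Topology.IsClosedEmbedding (fun z : ℂ => z * (2 * Real.pi * Complex.I)) :=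
        (Homeomorph.mulRight₀ (2 * Real.pi * Complex.I) Complex.two_pi_I_ne_zero).isClosedEmbedding
      have h3 : Topology.IsClosedEmbedding (fun k : ℤ => (k:ℂ) * (2 * Real.pi * Complex.I)) :=
        h2.comp Complex.isClosedEmbedding_intCast
      exact ⟨h3.isEmbedding.toHomeomorph.symm.isEmbedding.discreteTopology⟩
    exact this
  · intro z hz
    obtain ⟨k, hk⟩ := hk z hz
    exact ⟨k, hk.symm⟩

variable {E : Type*} [NormedAddCommGroup E] [NormedSpace ℝ E]

theorem starlog {S : Set E} {x0 : E} (hS : StarConvex ℝ x0 S) {u : E → ℂ}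
    (hu : ContinuousOn u S) (h0 : ∀ x ∈ S, u x ≠ 0) :
    ∃ L : E → ℂ, ContinuousOn L S ∧ ∀ x ∈ S, u x = Complex.exp (L x) := by
  rcases S.eq_empty_or_nonempty with rfl | ⟨y, hy⟩
  · exact ⟨0, continuousOn_const, by simp⟩
  have hm : ∀ t ∈ Icc (0:ℝ) 1, ∀ x ∈ S, x0 + t • (x - x0) ∈ S := by
    intro t ht x hx
    exact hS.add_smul_sub_mem hx ht.1 ht.2
  obtain ⟨L, h1, h2, h3⟩ := hlog (S := S) (u := fun t x => u (x0 + t • (x - x0)))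
    (hu.comp (f := fun p : ℝ × E => x0 + p.1 • (p.2 - x0)) (by fun_prop) (fun p hp => hm _ hp.1 _ hp.2))
    (fun t ht x hx => h0 _ (hm t ht x hx))
  have hx0 : u x0 ≠ 0 := by
    have := h0 _ (hm 0 (by simp) y hy)
    simpa using this
  refine ⟨fun x => Complex.log (u x0) + L 1 x, ?_, ?_⟩
  · refine continuousOn_const.add ?_
    exact h1.comp (f := fun x : E => ((1:ℝ), x)) (by fun_prop) (fun x hx => ⟨by simp, hx⟩)
  · intro x hx
    have := h3 1 (by simp) x hx
    simp at this
    rw [this, Complex.exp_add, Complex.exp_log hx0]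

end Lg1

noncomputable section Lg2
variable {E : Type*} [NormedAddCommGroup E] [NormedSpace ℂ E]

def Cl {X : Type*} [TopologicalSpace X] (u v : X → ℂ) (k : ℤ) (S : Set X) : Prop :=
  ∃ s : X → ℂ, ContinuousOn s S ∧ ∀ z ∈ S, u z = v z ^ k * Complex.exp (s z)

theorem Cl.mono {X : Type*} [TopologicalSpace X] {u v : X → ℂ} {k : ℤ} {S T : Set X}
    (h : Cl u v k S) (hT : T ⊆ S) : Cl u v k T := by
  obtain ⟨s, h1, h2⟩ := h
  exact ⟨s, h1.mono hT, fun z hz => h2 z (hT hz)⟩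

theorem Cl.trans {X : Type*} [TopologicalSpace X] {u v w : X → ℂ} {k l : ℤ} {S : Set X}
    (h : Cl u v k S) (h' : Cl v w l S) : Cl u w (l * k) S := by
  obtain ⟨s, h1, h2⟩ := h
  obtain ⟨s', h1', h2'⟩ := h'
  refine ⟨fun z => k * s' z + s z, (continuousOn_const.mul h1').add h1, fun z hz => ?_⟩
  rw [h2 z hz, h2' z hz, mul_zpow, ← zpow_mul, ← Complex.exp_int_mul, Complex.exp_add, mul_assoc]

variable (ℓ : E →L[ℂ] ℂ) (a : E)

def Bx (A : Set ℂ) (B : Set E) : Set E := {z | ℓ z ≠ 0 ∧ ℓ z ∈ A ∧ z - ℓ z • a ∈ B}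

variable {ℓ a}

theorem box_cl (ha : ℓ a = 1) {A : Set ℂ} (hA : Convex ℝ (Complex.exp ⁻¹' A)) {B : Set E}
    (hAo : IsOpen A)
    (hB : Convex ℝ B) {u : E → ℂ} (hu : ContinuousOn u (Bx ℓ a A B))
    (h0 : ∀ z ∈ Bx ℓ a A B, u z ≠ 0) : ∃ k : ℤ, Cl u ℓ k (Bx ℓ a A B) := by
  let _ : NormedSpace ℝ E := NormedSpace.restrictScalars ℝ ℂ E
  let S : Set (ℂ × E) := {p | Complex.exp p.1 ∈ A ∧ p.2 - ℓ p.2 • a ∈ B}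
  let π : E →ₗ[ℝ] E := ((LinearMap.id : E →ₗ[ℂ] E) - (ℓ : E →ₗ[ℂ] ℂ).smulRight a).restrictScalars ℝ
  have hS : Convex ℝ S := by
    have e : S = (Complex.exp ⁻¹' A) ×ˢ (π ⁻¹' B) := by
      ext p; simp [S, π]
    rw [e]
    exact hA.prod (hB.linear_preimage π)
  let m : ℂ × E → E := fun p => Complex.exp p.1 • a + (p.2 - ℓ p.2 • a)
  have hℓm : ∀ p, ℓ (m p) = Complex.exp p.1 := by
    intro p; simp [m, ha]
  have hmS : MapsTo m S (Bx ℓ a A B) := by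
    intro p hp
    refine ⟨?_, ?_, ?_⟩
    · rw [hℓm]; exact Complex.exp_ne_zero _
    · rw [hℓm]; exact hp.1
    · rw [hℓm]; simpa [m] using hp.2
  have hmc : Continuous m := by fun_prop
  rcases S.eq_empty_or_nonempty with hSe | ⟨p0, hp0⟩
  · refine ⟨0, 0, continuousOn_const, fun z hz => ?_⟩
    exfalso
    have : (Complex.log (ℓ z), z) ∈ S := ⟨by rw [Complex.exp_log hz.1]; exact hz.2.1, hz.2.2⟩
    rw [hSe] at this; exact this
  obtain ⟨L, hL, hLe⟩ := starlog (hS.starConvex hp0) (hu.comp hmc.continuousOn hmS)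
    (fun p hp => h0 _ (hmS hp))
  let sh : ℂ × E → ℂ × E := fun p => (p.1 + 2 * Real.pi * Complex.I, p.2)
  have hsh : MapsTo sh S S := by
    intro p hp
    refine ⟨?_, hp.2⟩
    simp only [sh, Complex.exp_add, Complex.exp_two_pi_mul_I, mul_one]; exact hp.1
  have hmsh : ∀ p, m (sh p) = m p := by
    intro p
    simp only [m, sh, Complex.exp_add, Complex.exp_two_pi_mul_I, mul_one]
  let f : ℂ × E → ℂ := fun p => L (sh p) - L p
  have hf : ContinuousOn f S := (hL.comp (by fun_prop) hsh).sub hL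
  have hf1 : ∀ p ∈ S, Complex.exp (f p) = 1 := by
    intro p hp
    simp only [f, Complex.exp_sub]
    rw [← hLe _ hp, ← hLe _ (hsh hp)]
    simp only [Function.comp, hmsh]
    exact div_self (h0 _ (hmS hp))
  obtain ⟨k, hk⟩ := Complex.exp_eq_one_iff.1 (hf1 p0 hp0)
  have hfk : ∀ p ∈ S, L (sh p) - L p = k * (2 * Real.pi * Complex.I) := by
    intro p hp
    rw [← hk]
    exact exp_eq_one_const hS.isPreconnected hf hf1 hp hp0
  have hn : ∀ n : ℕ, ∀ σ z, (σ, z) ∈ S → (σ + n * (2 * Real.pi * Complex.I), z) ∈ S ∧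
      L (σ + n * (2 * Real.pi * Complex.I), z) - L (σ, z) = k * (n * (2 * Real.pi * Complex.I)) := by
    intro n σ z hp
    induction n with
    | zero => simpa using hp
    | succ n ih =>
      have h1 := hsh ih.1
      have h2 := hfk _ ih.1
      have e : sh (σ + n * (2 * Real.pi * Complex.I), z) =
        (σ + (n + 1 : ℕ) * (2 * Real.pi * Complex.I), z) := by
        simp only [sh]; congr 1; push_cast; ring
      rw [e] at h1 h2
      refine ⟨h1, ?_⟩
      have := ih.2
      push_cast at *
      linear_combination h2 + this
  have hs : ∀ σ τ z, (σ, z) ∈ S → (τ, z) ∈ S → Complex.exp σ = Complex.exp τ →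
      L (σ, z) - k * σ = L (τ, z) - k * τ := by
    intro σ τ z h1 h2 h3
    obtain ⟨n, hn'⟩ := Complex.exp_eq_exp_iff_exists_int.1 h3
    rcases n.eq_nat_or_neg with ⟨n, rfl | rfl⟩
    · have := (hn n τ z h2).2
      push_cast at hn'
      rw [← hn'] at this
      linear_combination this - k * hn'
    · have := (hn n σ z h1).2
      push_cast at hn'
      have e : τ = σ + n * (2 * Real.pi * Complex.I) := by rw [hn']; ring
      rw [← e] at this
      linear_combination - this - k * hn'
  refine ⟨k, fun z => L (Complex.log (ℓ z), z) - k * Complex.log (ℓ z), ?_, ?_⟩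
  · intro z0 hz0
    let τ : E → ℂ := fun z => Complex.log (ℓ z / ℓ z0) + Complex.log (ℓ z0)
    have hτ : ContinuousAt τ z0 := by
      refine ContinuousAt.add ?_ continuousAt_const
      refine ContinuousAt.clog (by fun_prop) ?_
      rw [div_self hz0.1]
      exact Complex.one_mem_slitPlane
    have hτe : ∀ z, ℓ z ≠ 0 → Complex.exp (τ z) = ℓ z := by
      intro z hz
      simp only [τ]
      rw [Complex.exp_add, Complex.exp_log (div_ne_zero hz hz0.1), Complex.exp_log hz0.1]
      have := hz0.1
      field_simp
    have hτS : ∀ z ∈ Bx ℓ a A B, (τ z, z) ∈ S := fun z hz =>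
      ⟨by rw [hτe z hz.1]; exact hz.2.1, hz.2.2⟩
    have hc : ContinuousWithinAt (fun z => L (τ z, z) - k * τ z) (Bx ℓ a A B) z0 := by
      refine ContinuousWithinAt.sub ?_ (continuousWithinAt_const.mul hτ.continuousWithinAt)
      exact ContinuousWithinAt.comp (f := fun z => (τ z, z)) (hL _ (hτS z0 hz0)) (hτ.continuousWithinAt.prodMk continuousWithinAt_id) hτS
    have hlS : ∀ z ∈ Bx ℓ a A B, (Complex.log (ℓ z), z) ∈ S := fun z hz =>
      ⟨by rw [Complex.exp_log hz.1]; exact hz.2.1, hz.2.2⟩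
    refine hc.congr (fun z hz => ?_) ?_
    · exact hs _ _ _ (hlS z hz) (hτS z hz) (by rw [hτe z hz.1, Complex.exp_log hz.1])
    · exact hs _ _ _ (hlS _ hz0) (hτS _ hz0) (by rw [hτe _ hz0.1, Complex.exp_log hz0.1])
  · intro z hz
    have hlS : (Complex.log (ℓ z), z) ∈ S :=
      ⟨by rw [Complex.exp_log hz.1]; exact hz.2.1, hz.2.2⟩
    have := hLe _ hlS
    simp only [Function.comp, m, Complex.exp_log hz.1] at this
    rw [add_sub_cancel] at this
    rw [Complex.exp_sub, ← this, Complex.exp_int_mul, Complex.exp_log hz.1]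
    have := zpow_ne_zero k hz.1
    field_simp

theorem exp_ball_convex (r : ℝ) : Convex ℝ (Complex.exp ⁻¹' ball 0 r) := by
  have e : Complex.exp ⁻¹' ball 0 r = {z : ℂ | Real.exp z.re < r} := by
    ext z; simp [Complex.norm_exp]
  rw [e]
  rcases le_or_gt r 0 with h | h
  · have : {z : ℂ | Real.exp z.re < r} = ∅ := by
      ext z
      simp only [mem_setOf_eq, mem_empty_iff_false, iff_false, not_lt]
      exact h.trans (Real.exp_pos _).le
    rw [this]; exact convex_empty
  · have : {z : ℂ | Real.exp z.re < r} = {z : ℂ | Complex.reLm z < Real.log r} := by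
      ext z; simp [Real.lt_log_iff_exp_lt h]
    rw [this]
    exact (convex_Iio _).linear_preimage Complex.reLm

theorem box_small (ha : ℓ a = 1) {N : Set E} (hN : N ∈ 𝓝 (0:E)) :
    ∃ r > 0, Bx ℓ a (ball 0 r) (ball 0 r) ⊆ N := by
  obtain ⟨ε, hε, h⟩ := Metric.mem_nhds_iff.1 hN
  refine ⟨ε / (‖a‖ + 1), by positivity, fun z hz => h ?_⟩
  obtain ⟨-, h1, h2⟩ := hz
  rw [mem_ball_zero_iff] at *
  have : 0 < ε / (‖a‖ + 1) := by positivity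
  calc ‖z‖ = ‖ℓ z • a + (z - ℓ z • a)‖ := by congr 1; abel
    _ ≤ ‖ℓ z‖ * ‖a‖ + ‖z - ℓ z • a‖ := (norm_add_le _ _).trans (by rw [norm_smul])
    _ < ε / (‖a‖ + 1) * ‖a‖ + ε / (‖a‖ + 1) := by
      have := mul_le_mul_of_nonneg_right h1.le (norm_nonneg a)
      linarith
    _ = ε := by field_simp

theorem box_nhds {r : ℝ} (hr : 0 < r) :
    ∀ᶠ z in 𝓝 (0:E), ℓ z ≠ 0 → z ∈ Bx ℓ a (ball 0 r) (ball 0 r) := by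
  have h1 : ∀ᶠ z in 𝓝 (0:E), ℓ z ∈ ball (0:ℂ) r := by
    have : ContinuousAt (fun z => ℓ z) 0 := by fun_prop
    exact this (by simpa using ball_mem_nhds (0:ℂ) hr)
  have h2 : ∀ᶠ z in 𝓝 (0:E), z - ℓ z • a ∈ ball (0:E) r := by
    have : ContinuousAt (fun z => z - ℓ z • a) 0 := by fun_prop
    exact this (by simpa using ball_mem_nhds (0:E) hr)
  filter_upwards [h1, h2] with z h1 h2 h3 using ⟨h3, h1, h2⟩

theorem circ_unique {ρ : ℂ} (hρ : ρ ≠ 0) {k : ℤ} {s : ℝ → ℂ} (hs : ContinuousOn s (Icc 0 1))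
    (h : ∀ θ ∈ Icc (0:ℝ) 1, (ρ * Complex.exp (2 * Real.pi * Complex.I * θ)) ^ k = Complex.exp (s θ))
    (hp : s 0 = s 1) : k = 0 := by
  have h1 : ∀ θ ∈ Icc (0:ℝ) 1,
      Complex.exp (s θ - s 0 - k * (2 * Real.pi * Complex.I * θ)) = 1 := by
    intro θ hθ
    have e0 := h 0 (by simp)
    have e1 := h θ hθ
    simp at e0
    rw [Complex.exp_sub, Complex.exp_sub, ← e1, ← e0, mul_zpow, ← Complex.exp_int_mul]
    have := zpow_ne_zero k hρ
    field_simp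
  have := exp_eq_one_const (isPreconnected_Icc) (f := fun θ : ℝ => s θ - s 0 - k * (2 * Real.pi * Complex.I * θ))
    (by fun_prop) h1 (x := 0) (y := 1) (by simp) (by simp)
  simp only [← hp, sub_self, Complex.ofReal_zero, mul_zero, Complex.ofReal_one, mul_one] at this
  have h2 := Complex.two_pi_I_ne_zero
  have : (k:ℂ) * (2 * Real.pi * Complex.I) = 0 := by linear_combination this
  exact_mod_cast (mul_eq_zero.1 this).resolve_right h2

theorem Cl.unique_circ {u v : E → ℂ} {k l : ℤ} {S : Set E} (h : Cl u v k S) (h' : Cl u v l S)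
    {z0 b : E} {ρ : ℂ} (hρ : ρ ≠ 0)
    (hz : ∀ θ ∈ Icc (0:ℝ) 1, z0 + Complex.exp (2 * Real.pi * Complex.I * θ) • b ∈ S)
    (hv : ∀ θ ∈ Icc (0:ℝ) 1, v (z0 + Complex.exp (2 * Real.pi * Complex.I * θ) • b) =
      ρ * Complex.exp (2 * Real.pi * Complex.I * θ)) : k = l := by
  obtain ⟨s, h1, h2⟩ := h
  obtain ⟨s', h1', h2'⟩ := h'
  let γ : ℝ → E := fun θ => z0 + Complex.exp (2 * Real.pi * Complex.I * θ) • b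
  have hγ : Continuous γ := by fun_prop
  have hγ1 : γ 0 = γ 1 := by simp [γ, Complex.exp_two_pi_mul_I]
  have := circ_unique hρ (k := k - l) (s := fun θ => s' (γ θ) - s (γ θ))
    ((h1'.comp hγ.continuousOn hz).sub (h1.comp hγ.continuousOn hz)) (fun θ hθ => by
      have e := (h2 _ (hz θ hθ)).symm.trans (h2' _ (hz θ hθ))
      rw [hv θ hθ] at e
      have hne : ρ * Complex.exp (2 * Real.pi * Complex.I * θ) ≠ 0 :=
        mul_ne_zero hρ (Complex.exp_ne_zero _)
      rw [zpow_sub₀ hne, Complex.exp_sub]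
      have := Complex.exp_ne_zero (s (γ θ))
      have := zpow_ne_zero l hne
      field_simp
      simp only [γ]
      linear_combination e) (by simp only [hγ1])
  omega

end Lg2

noncomputable section Lg3
variable {E : Type*} [NormedAddCommGroup E] [NormedSpace ℂ E]

def BLip (φ : OpenPartialHomeomorph E E) : Prop :=
  ∃ K, LipschitzOnWith K φ φ.source ∧ LipschitzOnWith K φ.symm φ.target

theorem BLip.symm {φ : OpenPartialHomeomorph E E} (h : BLip φ) : BLip φ.symm := by
  obtain ⟨K, h1, h2⟩ := h
  exact ⟨K, h2, by simpa using h1⟩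

theorem BLip.trans {φ ψ : OpenPartialHomeomorph E E} (h : BLip φ) (h' : BLip ψ) :
    BLip (φ.trans ψ) := by
  obtain ⟨K, h1, h2⟩ := h
  obtain ⟨K', h1', h2'⟩ := h'
  refine ⟨max (K' * K) (K * K'), ?_, ?_⟩
  · refine LipschitzOnWith.weaken (K := K' * K) ?_ (le_max_left _ _)
    rw [OpenPartialHomeomorph.coe_trans]
    refine h1'.comp (h1.mono ?_) ?_
    · rw [OpenPartialHomeomorph.trans_source]; exact inter_subset_left
    · intro z hz
      rw [OpenPartialHomeomorph.trans_source] at hz; exact hz.2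
  · refine LipschitzOnWith.weaken (K := K * K') ?_ (le_max_right _ _)
    rw [OpenPartialHomeomorph.coe_trans_symm]
    refine h2.comp (h2'.mono ?_) ?_
    · rw [OpenPartialHomeomorph.trans_target]; exact inter_subset_left
    · intro z hz
      rw [OpenPartialHomeomorph.trans_target] at hz; exact hz.2

theorem BLip.restr {φ : OpenPartialHomeomorph E E} (h : BLip φ) (s : Set E) : BLip (φ.restr s) := by
  obtain ⟨K, h1, h2⟩ := h
  refine ⟨K, h1.mono ?_, h2.mono ?_⟩
  · simp only [OpenPartialHomeomorph.restr_source]; exact inter_subset_left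
  · intro z hz
    have := (φ.restr s).map_target hz
    have e := (φ.restr s).right_inv hz
    rw [OpenPartialHomeomorph.restr_source] at this
    have := φ.map_source this.1
    rw [← e]; exact this

def transl (x : E) : OpenPartialHomeomorph E E := (Homeomorph.addLeft x).toOpenPartialHomeomorph

theorem transl_source (x : E) : (transl x).source = univ := rfl
theorem transl_apply (x z : E) : transl x z = x + z := rfl

theorem transl_blip (x : E) : BLip (transl x) := by
  refine ⟨1, LipschitzOnWith.of_dist_le_mul fun a _ b _ => ?_,
    LipschitzOnWith.of_dist_le_mul fun a _ b _ => ?_⟩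
  · simp [transl_apply]
  · have : ∀ c : E, (transl x).symm c = -x + c := fun c => rfl
    rw [this, this]; simp

theorem straighten [CompleteSpace E] {h : E → ℂ} {ℓ : E →L[ℂ] ℂ} {y : E} (hd : HasStrictFDerivAt h ℓ y)
    (hy : h y = 0) (hℓ : ℓ ≠ 0) : ∃ Ψ : OpenPartialHomeomorph E E, y ∈ Ψ.source ∧ Ψ y = 0 ∧
      BLip Ψ ∧ ∀ z ∈ Ψ.source, ℓ (Ψ z) = h z := by
  obtain ⟨w, hw⟩ : ∃ w, ℓ w = 1 := by
    obtain ⟨v, hv⟩ : ∃ v, ℓ v ≠ 0 := by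
      by_contra hc; push Not at hc; exact hℓ (by ext; simp [hc])
    exact ⟨(ℓ v)⁻¹ • v, by simp [hv]⟩
  let f : E → E := fun z => (z - y) + (h z - ℓ (z - y)) • w
  have hf : HasStrictFDerivAt f ((ContinuousLinearEquiv.refl ℂ E : E ≃L[ℂ] E) : E →L[ℂ] E) y := by
    have h1 : HasStrictFDerivAt (fun z => z - y) (ContinuousLinearMap.id ℂ E) y :=
      (hasStrictFDerivAt_id y).sub_const y
    have h2 : HasStrictFDerivAt (fun z => ℓ (z - y)) ℓ y := by
      have := ℓ.hasStrictFDerivAt.comp y h1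
      simpa using this
    have h3 := h1.add ((hd.sub h2).smul_const w)
    have e : ((ContinuousLinearEquiv.refl ℂ E : E ≃L[ℂ] E) : E →L[ℂ] E) =
      ContinuousLinearMap.id ℂ E + (ℓ - ℓ).smulRight w := by ext; simp
    rw [e]; exact h3
  have hfℓ : ∀ z, ℓ (f z) = h z := by
    intro z
    simp [f, hw]
  let Ψ := hf.toOpenPartialHomeomorph f
  have hΨy : y ∈ Ψ.source := hf.mem_toOpenPartialHomeomorph_source
  have hΨ : ∀ z, Ψ z = f z := fun z => rfl
  have hfy : f y = 0 := by simp [f, hy]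
  obtain ⟨K1, s, hs, hK1⟩ := hf.exists_lipschitzOnWith
  obtain ⟨K2, t, ht, hK2⟩ := (hf.to_localInverse).exists_lipschitzOnWith
  have ht' : Ψ ⁻¹' t ∈ 𝓝 y := Ψ.continuousAt hΨy ht
  refine ⟨Ψ.restr (s ∩ Ψ ⁻¹' t), ?_, hfy, ⟨max K1 K2, ?_, ?_⟩, fun z _ => hfℓ z⟩
  · rw [OpenPartialHomeomorph.restr_source]
    exact ⟨hΨy, mem_interior_iff_mem_nhds.2 (inter_mem hs ht')⟩
  · refine LipschitzOnWith.weaken (K := K1) (hK1.mono ?_) (le_max_left _ _)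
    rw [OpenPartialHomeomorph.restr_source]
    exact fun z hz => (interior_subset hz.2).1
  · refine LipschitzOnWith.weaken (K := K2) (hK2.mono ?_) (le_max_right _ _)
    intro z hz
    have h1 := (Ψ.restr (s ∩ Ψ ⁻¹' t)).map_target hz
    have h2 := (Ψ.restr (s ∩ Ψ ⁻¹' t)).right_inv hz
    rw [OpenPartialHomeomorph.restr_source] at h1
    have h3 := (interior_subset h1.2).2
    rw [mem_preimage] at h3
    rw [← h2]; exact h3

def Cln (u h : E → ℂ) (k : ℤ) (z0 : E) : Prop := ∃ N ∈ 𝓝 z0, Cl u h k (N ∩ {z | h z ≠ 0})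

theorem exists_one {ℓ : E →L[ℂ] ℂ} (hℓ : ℓ ≠ 0) : ∃ a, ℓ a = 1 := by
  obtain ⟨v, hv⟩ : ∃ v, ℓ v ≠ 0 := by
    by_contra hc; push Not at hc; exact hℓ (by ext; simp [hc])
  exact ⟨(ℓ v)⁻¹ • v, by simp [hv]⟩

theorem cln_unique_lin {ℓ : E →L[ℂ] ℂ} (hℓ : ℓ ≠ 0) {u : E → ℂ} {k l : ℤ}
    (h : Cln u ℓ k 0) (h' : Cln u ℓ l 0) : k = l := by
  obtain ⟨a, ha⟩ := exists_one hℓ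
  obtain ⟨N, hN, h⟩ := h
  obtain ⟨N', hN', h'⟩ := h'
  obtain ⟨r, hr, hb⟩ := Metric.mem_nhds_iff.1 (inter_mem hN hN')
  let ρ : ℝ := r / (2 * (‖a‖ + 1))
  have hρ : 0 < ρ := by positivity
  have hρa : ρ * ‖a‖ < r := by
    have : ρ * (2 * (‖a‖ + 1)) = r := by simp only [ρ]; field_simp
    nlinarith [norm_nonneg a]
  refine Cl.unique_circ (h.mono (T := (N ∩ N') ∩ {z | ℓ z ≠ 0}) ?_) (h'.mono ?_) (z0 := 0)
    (b := (ρ:ℂ) • a) (ρ := ρ) (by exact_mod_cast hρ.ne') ?_ ?_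
  · exact fun z hz => ⟨hz.1.1, hz.2⟩
  · exact fun z hz => ⟨hz.1.2, hz.2⟩
  · intro θ _
    refine ⟨hb ?_, ?_⟩
    · rw [mem_ball_zero_iff, zero_add, norm_smul, norm_smul]
      have : ‖Complex.exp (2 * Real.pi * Complex.I * θ)‖ = 1 := by
        rw [Complex.norm_exp]; simp
      rw [this, one_mul]; simpa [abs_of_pos hρ] using hρa
    · simp [ha, hρ.ne', Complex.exp_ne_zero]
  · intro θ _
    simp [ha]; ring

theorem cln_lin0 {ℓ ℓ' : E →L[ℂ] ℂ} (hℓ : ℓ ≠ 0) {u : E → ℂ} {N : Set E} (hN : N ∈ 𝓝 (0:E))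
    (hu : ContinuousOn u N) (h0 : ∀ z ∈ N, ℓ z ≠ 0 → u z ≠ 0) : ∃ k, Cln u ℓ k 0 := by
  obtain ⟨a, ha⟩ := exists_one hℓ
  obtain ⟨r, hr, hb⟩ := box_small ha hN
  obtain ⟨k, hk⟩ := box_cl ha (exp_ball_convex r) isOpen_ball (convex_ball (0:E) r |> fun h => h)
    (hu.mono hb) (fun z hz => h0 z (hb hz) hz.1)
  exact ⟨k, _, box_nhds hr, hk.mono fun z hz => hz.1 hz.2⟩

theorem cln_lin {ℓ ℓ' : E →L[ℂ] ℂ} (hℓ : ℓ ≠ 0) (hℓ' : ℓ' ≠ 0) {Θ : OpenPartialHomeomorph E E}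
    (h0 : (0:E) ∈ Θ.source) (hΘ : Θ 0 = 0) (hz : ∀ z ∈ Θ.source, ℓ z = 0 ↔ ℓ' (Θ z) = 0) :
    ∃ k : ℤ, (k = 1 ∨ k = -1) ∧ Cln (ℓ' ∘ Θ) ℓ k 0 := by
  have h0' : (0:E) ∈ Θ.target := by rw [← hΘ]; exact Θ.map_source h0
  have hΘ' : Θ.symm 0 = 0 := by have := Θ.left_inv h0; rwa [hΘ] at this
  obtain ⟨k, hk⟩ := cln_lin0 (ℓ' := ℓ) hℓ (u := ℓ' ∘ Θ) (Θ.open_source.mem_nhds h0)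
    (ℓ'.continuous.comp_continuousOn Θ.continuousOn) (fun z h1 h2 h3 => h2 ((hz z h1).2 h3))
  obtain ⟨l, hl⟩ := cln_lin0 (ℓ' := ℓ) hℓ' (u := ℓ ∘ Θ.symm) (Θ.open_target.mem_nhds h0')
    (ℓ.continuous.comp_continuousOn Θ.continuousOn_symm) (fun z h1 h2 h3 => h2 (by
      have := (hz _ (Θ.map_target h1)).1 h3
      rwa [Θ.right_inv h1] at this))
  refine ⟨k, ?_, hk⟩
  have : k * l = 1 := by
    refine cln_unique_lin hℓ (u := ℓ) ?_ ⟨univ, univ_mem, 0, continuousOn_const, by simp⟩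
    obtain ⟨N, hN, hk⟩ := hk
    obtain ⟨N', hN', s, hs1, hs2⟩ := hl
    have hN'' : Θ ⁻¹' N' ∈ 𝓝 (0:E) := by
      have := Θ.continuousAt h0
      rw [ContinuousAt, hΘ] at this
      exact this hN'
    refine ⟨(N ∩ Θ ⁻¹' N') ∩ Θ.source, inter_mem (inter_mem hN hN'') (Θ.open_source.mem_nhds h0), ?_⟩
    refine Cl.trans (v := ℓ' ∘ Θ) ⟨s ∘ Θ, ?_, ?_⟩ (hk.mono fun z hz => ⟨hz.1.1.1, hz.2⟩)
    · refine hs1.comp (Θ.continuousOn.mono fun z hz => hz.1.2) ?_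
      intro z h
      exact ⟨h.1.1.2, fun h3 => h.2 ((hz z h.1.2).2 h3)⟩
    · intro z h
      have := hs2 (Θ z) ⟨h.1.1.2, fun h3 => h.2 ((hz z h.1.2).2 h3)⟩
      rw [Function.comp, Θ.left_inv h.1.2] at this
      exact this
  exact Int.isUnit_iff.1 (IsUnit.of_mul_eq_one _ this)

theorem Cln.pull {u h u' h' : E → ℂ} {k : ℤ} {z0 z1 : E} (hc : Cln u h k z0)
    {Ψ : OpenPartialHomeomorph E E} (h1 : z1 ∈ Ψ.source) (h2 : Ψ z1 = z0)
    (hu : ∀ᶠ z in 𝓝 z1, u' z = u (Ψ z)) (hh : ∀ᶠ z in 𝓝 z1, h' z = h (Ψ z)) :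
    Cln u' h' k z1 := by
  obtain ⟨N, hN, s, hs1, hs2⟩ := hc
  have hΨ := Ψ.continuousAt h1
  rw [ContinuousAt, h2] at hΨ
  refine ⟨_, inter_mem (inter_mem (hΨ hN) (Ψ.open_source.mem_nhds h1)) (inter_mem hu hh),
    s ∘ Ψ, ?_, ?_⟩
  · refine hs1.comp (Ψ.continuousOn.mono fun z hz => hz.1.1.2) ?_
    intro z hz
    refine ⟨hz.1.1.1, ?_⟩
    have := hz.2
    rw [mem_setOf_eq, hz.1.2.2] at this; exact this
  · intro z hz
    have h3 := hz.2
    rw [mem_setOf_eq, hz.1.2.2] at h3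
    have := hs2 (Ψ z) ⟨hz.1.1.1, h3⟩
    rw [hz.1.2.1, hz.1.2.2, this]; rfl

theorem cln_unique [CompleteSpace E] {h : E → ℂ} {ℓ : E →L[ℂ] ℂ} {y : E}
    (hd : HasStrictFDerivAt h ℓ y) (hy : h y = 0) (hℓ : ℓ ≠ 0) {u : E → ℂ} {k l : ℤ}
    (hk : Cln u h k y) (hl : Cln u h l y) : k = l := by
  obtain ⟨Ψ, h1, h2, -, h3⟩ := straighten hd hy hℓ
  have h0 : (0:E) ∈ Ψ.symm.source := by rw [← h2]; exact Ψ.map_source h1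
  have h0' : Ψ.symm 0 = y := by rw [← h2]; exact Ψ.left_inv h1
  have key : ∀ j, Cln u h j y → Cln (u ∘ Ψ.symm) ℓ j 0 := fun j hj =>
    hj.pull h0 h0' (Eventually.of_forall fun z => rfl) (by
      filter_upwards [Ψ.open_target.mem_nhds h0] with z hz
      rw [← h3 _ (Ψ.map_target hz), Ψ.right_inv hz])
  exact cln_unique_lin hℓ (key k hk) (key l hl)

theorem cln_loc [CompleteSpace E] {h h' : E → ℂ} {ℓ ℓ' : E →L[ℂ] ℂ} {x y : E}
    (hd : HasStrictFDerivAt h ℓ x) (hx : h x = 0) (hℓ : ℓ ≠ 0)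
    (hd' : HasStrictFDerivAt h' ℓ' y) (hy : h' y = 0) (hℓ' : ℓ' ≠ 0)
    {φ : OpenPartialHomeomorph E E} (hxs : x ∈ φ.source) (hφ : φ x = y)
    (hz : ∀ z ∈ φ.source, h z = 0 ↔ h' (φ z) = 0) :
    ∃ k : ℤ, (k = 1 ∨ k = -1) ∧ Cln (h' ∘ φ) h k x := by
  obtain ⟨Ψ, h1, h2, -, h3⟩ := straighten hd hx hℓ
  obtain ⟨Ψ', h1', h2', -, h3'⟩ := straighten hd' hy hℓ'
  let Θ := (Ψ.symm.trans φ).trans Ψ'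
  have h0 : (0:E) ∈ Ψ.symm.source := by rw [← h2]; exact Ψ.map_source h1
  have h0' : Ψ.symm 0 = x := by rw [← h2]; exact Ψ.left_inv h1
  have hΘ0 : (0:E) ∈ Θ.source := by
    simp only [Θ, OpenPartialHomeomorph.trans_source, mem_inter_iff, mem_preimage,
      OpenPartialHomeomorph.coe_trans, Function.comp, h0', hφ]
    exact ⟨⟨h0, hxs⟩, h1'⟩
  have hΘ : ∀ z, Θ z = Ψ' (φ (Ψ.symm z)) := fun z => rfl
  obtain ⟨k, hk, hc⟩ := cln_lin hℓ hℓ' (Θ := Θ) hΘ0 (by rw [hΘ, h0', hφ, h2']) (by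
    intro z hz'
    simp only [Θ, OpenPartialHomeomorph.trans_source, mem_inter_iff, mem_preimage,
      OpenPartialHomeomorph.coe_trans, Function.comp] at hz'
    rw [hΘ, h3' _ hz'.2, ← hz _ hz'.1.2, ← h3 _ (Ψ.map_target hz'.1.1), Ψ.right_inv hz'.1.1])
  refine ⟨k, hk, hc.pull h1 h2 ?_ ?_⟩
  · have : ∀ᶠ z in 𝓝 x, φ z ∈ Ψ'.source :=
      φ.continuousAt hxs (by rw [hφ]; exact Ψ'.open_source.mem_nhds h1')
    filter_upwards [Ψ.open_source.mem_nhds h1, this] with z hz hz2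
    simp only [Function.comp, hΘ]
    rw [Ψ.left_inv hz, h3' _ hz2]
  · filter_upwards [Ψ.open_source.mem_nhds h1] with z hz
    rw [h3 z hz]

end Lg3

noncomputable section Blw1

theorem min_mod {g : ℂ → ℂ} (hg : Differentiable ℂ g) {ρ c : ℝ} (hρ : 0 < ρ)
    (hc : ∀ z ∈ sphere (0:ℂ) ρ, c ≤ ‖g z‖) (h0 : ‖g 0‖ < c) : ∃ z ∈ ball (0:ℂ) ρ, g z = 0 := by
  have hcpos : 0 < c := (norm_nonneg _).trans_lt h0
  by_contra hn
  push Not at hn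
  have hne : ∀ z ∈ closedBall (0:ℂ) ρ, g z ≠ 0 := by
    intro z hz
    rw [← ball_union_sphere] at hz
    rcases hz with hz | hz
    · exact hn z hz
    · intro h; have := hc z hz; rw [h, norm_zero] at this; linarith
  have hd : DiffContOnCl ℂ (fun z => (g z)⁻¹) (ball 0 ρ) := by
    refine ⟨fun z hz => ?_, ?_⟩
    · exact ((hg z).inv (hn z hz)).differentiableWithinAt
    · rw [closure_ball _ hρ.ne']
      exact hg.continuous.continuousOn.inv₀ hne
  have := Complex.norm_le_of_forall_mem_frontier_norm_le isBounded_ball hd (C := c⁻¹) (z := 0) (by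
    rw [frontier_ball _ hρ.ne']
    intro z hz
    rw [norm_inv]
    exact inv_anti₀ hcpos (hc z hz)) (subset_closure (mem_ball_self hρ))
  rw [norm_inv] at this
  have h1 : 0 < ‖g 0‖ := norm_pos_iff.2 (hne 0 (by simp [hρ.le]))
  have := (inv_le_inv₀ h1 hcpos).1 this
  linarith

theorem good_circle {g : ℂ → ℂ} (hg : Differentiable ℂ g) (h1 : ∃ z, g z ≠ 0) {δ : ℝ} (hδ : 0 < δ) :
    ∃ ρ, 0 < ρ ∧ ρ < δ ∧ ∃ c > 0, ∀ z ∈ sphere (0:ℂ) ρ, c ≤ ‖g z‖ := by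
  have han : AnalyticOnNhd ℂ g univ := fun z _ => hg.analyticAt z
  have hev : ∀ᶠ z in 𝓝[≠] (0:ℂ), g z ≠ 0 := by
    rcases (han 0 (mem_univ _)).eventually_eq_zero_or_eventually_ne_zero with h | h
    · exfalso
      obtain ⟨z, hz⟩ := h1
      exact hz (han.eqOn_zero_of_preconnected_of_eventuallyEq_zero isPreconnected_univ (mem_univ 0) h (mem_univ z))
    · exact h
  rw [eventually_nhdsWithin_iff, Metric.eventually_nhds_iff] at hev
  obtain ⟨ε, hε, hev⟩ := hev
  let ρ := min (δ/2) (ε/2)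
  have hρ : 0 < ρ := by positivity
  have hρ1 : ρ < δ := (min_le_left _ _).trans_lt (by linarith)
  have hρ2 : ρ < ε := (min_le_right _ _).trans_lt (by linarith)
  obtain ⟨c, hc, h⟩ := norm_lb (isCompact_sphere (0:ℂ) ρ) (f := g) hg.continuous.continuousOn (by
    intro z hz
    rw [mem_sphere] at hz
    refine hev (by rw [hz]; exact hρ2) ?_
    rintro rfl
    simp at hz; linarith)
  exact ⟨ρ, hρ, hρ1, c, hc, h⟩

theorem unif_of_lip {T E F : Type*} [PseudoMetricSpace E] [PseudoMetricSpace F]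
    {l : Filter T} {φ : T → E → F} {Φ : E → F} {K : NNReal} {C : Set E} (hC : IsCompact C)
    (hφ : ∀ᶠ t in l, LipschitzOnWith K (φ t) C) (hΦ : LipschitzOnWith K Φ C)
    (hp : ∀ z ∈ C, Tendsto (fun t => φ t z) l (𝓝 (Φ z))) {ε : ℝ} (hε : 0 < ε) :
    ∀ᶠ t in l, ∀ z ∈ C, dist (φ t z) (Φ z) < ε := by
  let η : ℝ := ε / (4 * (K + 1))
  have hη : 0 < η := by positivity
  obtain ⟨s, hsC, hs, hcov⟩ := hC.finite_cover_balls hη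
  have h2 : ∀ᶠ t in l, ∀ y ∈ s, dist (φ t y) (Φ y) < ε / 2 := by
    rw [eventually_all_finite hs]
    intro y hy
    exact (Metric.tendsto_nhds.1 (hp y (hsC hy))) _ (by positivity)
  filter_upwards [hφ, h2] with t h1 h2 z hz
  obtain ⟨y, hy, hzy⟩ := mem_iUnion₂.1 (hcov hz)
  have e1 := h1.dist_le_mul z hz y (hsC hy)
  have e2 := hΦ.dist_le_mul y (hsC hy) z hz
  rw [mem_ball] at hzy
  have e3 : (K:ℝ) * dist z y ≤ ε / 4 := by
    have : (K:ℝ) * η ≤ ε/4 := by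
      simp only [η]
      rw [mul_div_assoc', div_le_iff₀ (by positivity)]
      nlinarith [K.2]
    exact (mul_le_mul_of_nonneg_left hzy.le K.2).trans this
  rw [dist_comm y z] at e2
  have := dist_triangle4 (φ t z) (φ t y) (Φ y) (Φ z)
  have := h2 y hy
  linarith

end Blw1

noncomputable section Blw2
variable {E : Type*} [NormedAddCommGroup E] [NormedSpace ℂ E] [FiniteDimensional ℂ E]

theorem ultra_lim (U : Ultrafilter ℝ) {f : ℝ → E → E} {K : NNReal}
    (hf : ∀ R : ℝ, ∀ᶠ t : ℝ in (U : Filter ℝ), LipschitzOnWith K (f t) (closedBall 0 R))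
    (h0 : ∀ t, f t 0 = 0) : ∃ Φ : E → E, LipschitzWith K Φ ∧
      ∀ z, Tendsto (fun t => f t z) U (𝓝 (Φ z)) := by
  haveI := FiniteDimensional.proper ℂ E
  have h1 : ∀ z, ∃ y, Tendsto (fun t => f t z) U (𝓝 y) := by
    intro z
    have hb : ∀ᶠ t : ℝ in (U : Filter ℝ), f t z ∈ closedBall (0:E) (K * ‖z‖) := by
      filter_upwards [hf ‖z‖] with t ht
      have := ht.dist_le_mul z (by simp) 0 (by simp)
      rw [h0, dist_zero_right, dist_zero_right] at this
      simpa using this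
    obtain ⟨y, -, hy⟩ := (isCompact_closedBall (0:E) (K * ‖z‖)).ultrafilter_le_nhds
      (U.map fun t => f t z) (by rw [le_principal_iff]; exact hb)
    exact ⟨y, hy⟩
  choose Φ hΦ using h1
  refine ⟨Φ, LipschitzWith.of_dist_le_mul fun z w => ?_, hΦ⟩
  refine le_of_tendsto ((hΦ z).dist (hΦ w)) ?_
  filter_upwards [hf (max ‖z‖ ‖w‖)] with t ht
  exact ht.dist_le_mul z (by simp) w (by simp)

theorem lip_scale {f : E → E} {K : NNReal} {x y : E} {r R t : ℝ} (hf : LipschitzOnWith K f (ball x r))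
    (ht : 0 < t) (htR : t * R < r) :
    LipschitzOnWith K (fun z => ((t:ℂ)⁻¹) • (f (x + (t:ℂ) • z) - y)) (closedBall 0 R) := by
  have hm : ∀ z ∈ closedBall (0:E) R, x + (t:ℂ) • z ∈ ball x r := by
    intro z hz
    rw [mem_ball, dist_eq_norm, add_sub_cancel_left, norm_smul, Complex.norm_real, Real.norm_of_nonneg ht.le]
    rw [mem_closedBall_zero_iff] at hz
    exact (mul_le_mul_of_nonneg_left hz ht.le).trans_lt htR
  refine LipschitzOnWith.of_dist_le_mul fun z hz w hw => ?_
  have := hf.dist_le_mul _ (hm z hz) _ (hm w hw)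
  rw [dist_smul₀, dist_sub_right, norm_inv, Complex.norm_real, Real.norm_of_nonneg ht.le]
  rw [dist_add_left, dist_smul₀, Complex.norm_real, Real.norm_of_nonneg ht.le] at this
  rw [inv_mul_le_iff₀ ht]
  linarith

theorem deform {h : E → ℂ} {x : E} {G : ℕ → E → ℂ} {N m : ℕ}
    (hd : ∀ j, Differentiable ℂ (G j)) (hh : ∀ j (c : ℂ) z, G j (c • z) = c ^ j * G j z)
    (hs : ∀ z, h (x + z) = ∑ j ∈ Finset.range N, G j z) (hm : ∀ j < m, ∀ z, G j z = 0)
    (hmN : m < N) : ∃ P : ℂ → E → ℂ, (Continuous fun p : ℂ × E => P p.1 p.2) ∧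
      (∀ t, Differentiable ℂ (P t)) ∧ (∀ z, P 0 z = G m z) ∧
      ∀ (t : ℂ) z, h (x + t • z) = t ^ m * P t z := by
  let P : ℂ → E → ℂ := fun t z => ∑ j ∈ Finset.range N, t ^ (j - m) * G j z
  have hPc : Continuous fun p : ℂ × E => P p.1 p.2 := by
    refine continuous_finsetSum _ fun j _ => ?_
    exact (continuous_fst.pow _).mul ((hd j).continuous.comp continuous_snd)
  have hPd : ∀ t, Differentiable ℂ (P t) := by
    intro t
    refine Differentiable.fun_sum fun j _ => ?_
    exact (hd j).const_mul _
  have hP0 : ∀ z, P 0 z = G m z := by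
    intro z
    simp only [P]
    rw [Finset.sum_eq_single m]
    · simp
    · intro j hj hjm
      rcases lt_or_gt_of_ne hjm with hlt | hlt
      · rw [hm j hlt, mul_zero]
      · rw [zero_pow (by omega), zero_mul]
    · intro hn; exact absurd (Finset.mem_range.2 hmN) hn
  have hPh : ∀ (t : ℂ) z, h (x + t • z) = t ^ m * P t z := by
    intro t z
    rw [hs, Finset.mul_sum]
    refine Finset.sum_congr rfl fun j _ => ?_
    rw [hh]
    rcases lt_or_ge j m with hlt | hge
    · rw [hm j hlt]; simp
    · rw [← mul_assoc, ← pow_add]; congr 2; omega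
  exact ⟨P, hPc, hPd, hP0, hPh⟩

set_option maxHeartbeats 1000000 in
theorem blowup {h : E → ℂ} {x : E} {G : ℕ → E → ℂ} {N m : ℕ}
    (hd : ∀ j, Differentiable ℂ (G j)) (hh : ∀ j (c : ℂ) z, G j (c • z) = c ^ j * G j z)
    (hs : ∀ z, h (x + z) = ∑ j ∈ Finset.range N, G j z) (hm : ∀ j < m, ∀ z, G j z = 0)
    (hmN : m < N) (hG : ∃ v, G m v ≠ 0) {ℓ : E →L[ℂ] ℂ} (hℓ : ℓ ≠ 0)
    {φ : OpenPartialHomeomorph E E} (hφ : BLip φ) (h0 : (0:E) ∈ φ.source) (hφ0 : φ 0 = x)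
    (hz : ∀ z ∈ φ.source, ℓ z = 0 ↔ h (φ z) = 0) {k : ℤ} (hk : Cln (h ∘ φ) ℓ k 0) :
    ∃ Φ : E ≃ₜ E, BLip Φ.toOpenPartialHomeomorph ∧ (∀ z, ℓ z = 0 ↔ G m (Φ z) = 0) ∧
      Cl (G m ∘ Φ) ℓ k {z | ℓ z ≠ 0} := by
  haveI := FiniteDimensional.proper ℂ E
  obtain ⟨K, hK1, hK2⟩ := hφ
  have hx : x ∈ φ.target := by rw [← hφ0]; exact φ.map_source h0
  have hψx : φ.symm x = 0 := by rw [← hφ0]; exact φ.left_inv h0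
  obtain ⟨r1, hr1, hb1⟩ := Metric.mem_nhds_iff.1 (φ.open_source.mem_nhds h0)
  obtain ⟨r2, hr2, hb2⟩ := Metric.mem_nhds_iff.1 (φ.open_target.mem_nhds hx)
  let U : Ultrafilter ℝ := Ultrafilter.of (𝓝[>] (0:ℝ))
  have hU : (U : Filter ℝ) ≤ 𝓝[>] (0:ℝ) := Ultrafilter.of_le _
  have hUpos : ∀ᶠ t : ℝ in (U : Filter ℝ), 0 < t := hU self_mem_nhdsWithin
  have hU0 : Tendsto (fun t : ℝ => t) U (𝓝 0) := (tendsto_id.mono_left hU).mono_right nhdsWithin_le_nhds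
  have hUC : Tendsto (fun t : ℝ => (t:ℂ)) U (𝓝 0) := by
    have := (Complex.continuous_ofReal.tendsto 0).comp hU0
    rw [Complex.ofReal_zero] at this
    exact this
  have hUs : ∀ R r : ℝ, 0 < r → ∀ᶠ t : ℝ in (U : Filter ℝ), t * R < r := by
    intro R r hr
    have : Tendsto (fun t : ℝ => t * R) U (𝓝 0) := by simpa using hU0.mul_const R
    exact this.eventually_lt_const hr
  let f : ℝ → E → E := fun t z => ((t:ℂ)⁻¹) • (φ (0 + (t:ℂ) • z) - x)
  let f' : ℝ → E → E := fun t z => ((t:ℂ)⁻¹) • (φ.symm (x + (t:ℂ) • z) - 0)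
  have hf : ∀ R : ℝ, ∀ᶠ t : ℝ in (U : Filter ℝ), LipschitzOnWith K (f t) (closedBall 0 R) := by
    intro R
    filter_upwards [hUpos, hUs R r1 hr1] with t h1 h2
    exact lip_scale (hK1.mono hb1) h1 h2
  have hf' : ∀ R : ℝ, ∀ᶠ t : ℝ in (U : Filter ℝ), LipschitzOnWith K (f' t) (closedBall 0 R) := by
    intro R
    filter_upwards [hUpos, hUs R r2 hr2] with t h1 h2
    exact lip_scale (hK2.mono hb2) h1 h2
  obtain ⟨Φ, hΦL, hΦ⟩ := ultra_lim U hf (by intro t; simp [f, hφ0])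
  obtain ⟨Ψ, hΨL, hΨ⟩ := ultra_lim U hf' (by intro t; simp [f', hψx])
  have mem1 : ∀ z, ∀ᶠ t : ℝ in (U : Filter ℝ), 0 + (t:ℂ) • z ∈ φ.source := by
    intro z
    have : Tendsto (fun t : ℝ => 0 + (t:ℂ) • z) U (𝓝 0) := by simpa using hUC.smul_const z
    exact this (φ.open_source.mem_nhds h0)
  have mem2 : ∀ z, ∀ᶠ t : ℝ in (U : Filter ℝ), x + (t:ℂ) • z ∈ φ.target := by
    intro z
    have : Tendsto (fun t : ℝ => x + (t:ℂ) • z) U (𝓝 x) := by simpa using (hUC.smul_const z).const_add x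
    exact this (φ.open_target.mem_nhds hx)
  have ff' : ∀ z, ∀ᶠ t : ℝ in (U : Filter ℝ), f' t (f t z) = z := by
    intro z
    filter_upwards [mem1 z, hUpos] with t h1 h2
    have h2' : (t:ℂ) ≠ 0 := by exact_mod_cast h2.ne'
    simp only [f, f', smul_inv_smul₀ h2', add_sub_cancel, φ.left_inv h1]
    rw [zero_add, sub_zero, inv_smul_smul₀ h2']
  have f'f : ∀ z, ∀ᶠ t : ℝ in (U : Filter ℝ), f t (f' t z) = z := by
    intro z
    filter_upwards [mem2 z, hUpos] with t h1 h2
    have h2' : (t:ℂ) ≠ 0 := by exact_mod_cast h2.ne'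
    simp only [f, f', smul_inv_smul₀ h2', sub_zero, zero_add, φ.right_inv h1]
    rw [add_sub_cancel_left, inv_smul_smul₀ h2']
  have inv_gen : ∀ {g g' : ℝ → E → E} {A B : E → E} (_ : ∀ z, Tendsto (fun t => g t z) U (𝓝 (A z)))
      (_ : ∀ R : ℝ, ∀ᶠ t : ℝ in (U : Filter ℝ), LipschitzOnWith K (g' t) (closedBall 0 R))
      (_ : ∀ z, Tendsto (fun t => g' t z) U (𝓝 (B z))) (_ : ∀ z, ∀ᶠ t : ℝ in (U : Filter ℝ), g' t (g t z) = z),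
      ∀ z, B (A z) = z := by
    intro g g' A B hA hg' hB hgg z
    refine tendsto_nhds_unique (hB (A z)) ?_
    have hb : ∀ᶠ t : ℝ in (U : Filter ℝ), ‖g t z‖ ≤ ‖A z‖ + 1 := by
      have := (hA z).norm
      exact (this.eventually_lt_const (lt_add_one _)).mono fun t h => h.le
    rw [tendsto_iff_dist_tendsto_zero]
    have hz0 : Tendsto (fun t => (K:ℝ) * dist (A z) (g t z)) U (𝓝 0) := by
      have := ((tendsto_const_nhds (x := A z)).dist (hA z)).const_mul (K:ℝ)
      simpa using this
    refine squeeze_zero' (Eventually.of_forall fun t => dist_nonneg) ?_ hz0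
    filter_upwards [hb, hg' (‖A z‖ + 1), hgg z] with t h1 h2 h3
    have := h2.dist_le_mul (A z) (by simp) (g t z) (by simpa using h1)
    rwa [h3] at this
  have hΨΦ := inv_gen hΦ hf' hΨ ff'
  have hΦΨ := inv_gen hΨ hf hΦ f'f
  let Φh : E ≃ₜ E :=
    { toFun := Φ, invFun := Ψ, left_inv := hΨΦ, right_inv := hΦΨ
      continuous_toFun := hΦL.continuous, continuous_invFun := hΨL.continuous }
  obtain ⟨P, hPc, hPd, hP0, hPh⟩ := deform hd hh hs hm hmN
  have hfx : ∀ t : ℝ, 0 < t → ∀ z, φ (0 + (t:ℂ) • z) = x + (t:ℂ) • f t z := by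
    intro t ht z
    have h2' : (t:ℂ) ≠ 0 := by exact_mod_cast ht.ne'
    simp only [f, smul_inv_smul₀ h2']; abel
  have hPt : ∀ {w : ℝ → E} {w0 : E}, Tendsto w U (𝓝 w0) → Tendsto (fun t : ℝ => P t (w t)) U (𝓝 (G m w0)) := by
    intro w w0 hw
    rw [← hP0]
    exact Tendsto.comp (g := fun p : ℂ × E => P p.1 p.2) (hPc.tendsto (0, w0)) (hUC.prodMk_nhds hw)
  have fwd : ∀ z, ℓ z = 0 → G m (Φ z) = 0 := by
    intro z hzz
    refine tendsto_nhds_unique (hPt (hΦ z)) (tendsto_const_nhds.congr' ?_)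
    filter_upwards [mem1 z, hUpos] with t h1 h2
    have := (hz _ h1).1 (by simp [hzz])
    rw [hfx t h2, hPh] at this
    exact ((mul_eq_zero.1 this).resolve_left (pow_ne_zero _ (by exact_mod_cast h2.ne'))).symm
  have bwd : ∀ w, G m w = 0 → ℓ (Ψ w) = 0 := by
    intro w hw
    by_contra hne
    have hnp : 0 < ‖ℓ (Ψ w)‖ := norm_pos_iff.2 hne
    obtain ⟨v, hv⟩ := hG
    let v' := v - w
    let g : ℂ → ℂ := fun s => G m (w + s • v')
    have hg : Differentiable ℂ g := (hd m).comp (by fun_prop)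
    let δ : ℝ := ‖ℓ (Ψ w)‖ / (2 * (‖ℓ‖ * K + 1) * (‖v'‖ + 1))
    have hδ : 0 < δ := by positivity
    obtain ⟨ρ, hρ, hρδ, c, hc, hcs⟩ := good_circle hg ⟨1, by simpa [g, v'] using hv⟩ hδ
    have hw' : ∀ s ∈ closedBall (0:ℂ) ρ, ‖ℓ‖ * (K * ‖s • v'‖) ≤ ‖ℓ (Ψ w)‖ / 2 := by
      intro s hs
      rw [mem_closedBall_zero_iff] at hs
      rw [norm_smul]
      have e1 : ‖s‖ * ‖v'‖ ≤ δ * (‖v'‖ + 1) :=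
        mul_le_mul (hs.trans hρδ.le) (by linarith) (norm_nonneg _) hδ.le
      have e2 : δ * (‖v'‖ + 1) * (‖ℓ‖ * K + 1) = ‖ℓ (Ψ w)‖ / 2 := by
        simp only [δ]; field_simp
      have e3 : 0 ≤ ‖ℓ‖ * (K:ℝ) := by positivity
      calc ‖ℓ‖ * (K * (‖s‖ * ‖v'‖)) = (‖ℓ‖ * K) * (‖s‖ * ‖v'‖) := by ring
        _ ≤ (‖ℓ‖ * K) * (δ * (‖v'‖ + 1)) := mul_le_mul_of_nonneg_left e1 e3
        _ ≤ δ * (‖v'‖ + 1) * (‖ℓ‖ * K + 1) := by nlinarith [mul_pos hδ (by positivity : 0 < ‖v'‖ + 1)]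
        _ = _ := e2
    have A1 : ∀ᶠ t : ℝ in (U : Filter ℝ), ‖ℓ‖ * dist (f' t w) (Ψ w) < ‖ℓ (Ψ w)‖ / 2 := by
      have := ((hΨ w).dist (tendsto_const_nhds (x := Ψ w))).const_mul ‖ℓ‖
      rw [dist_self, mul_zero] at this
      exact this.eventually_lt_const (by positivity)
    have A2 : ∀ᶠ t : ℝ in (U : Filter ℝ), ∀ s ∈ closedBall (0:ℂ) ρ, ℓ (f' t (w + s • v')) ≠ 0 := by
      filter_upwards [A1, hf' (‖w‖ + ρ * ‖v'‖)] with t h1 h2 s hs h3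
      have hs' := mem_closedBall_zero_iff.1 hs
      have e := h2.dist_le_mul (w + s • v') (by
        rw [mem_closedBall_zero_iff]
        refine (norm_add_le _ _).trans ?_
        rw [norm_smul]
        gcongr) w (by
        rw [mem_closedBall_zero_iff]
        have : 0 ≤ ρ * ‖v'‖ := by positivity
        linarith)
      rw [dist_eq_norm (w + s • v') w, add_sub_cancel_left] at e
      have e1 := hw' s hs
      have e2 : ‖ℓ (Ψ w)‖ ≤ ‖ℓ‖ * dist (f' t (w + s • v')) (Ψ w) := by
        have : ℓ (Ψ w) = - ℓ (f' t (w + s • v') - Ψ w) := by rw [map_sub, h3]; ring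
        rw [this, norm_neg, dist_eq_norm]
        exact ℓ.le_opNorm _
      have e3 := dist_triangle (f' t (w + s • v')) (f' t w) (Ψ w)
      have e4 := mul_le_mul_of_nonneg_left (e3.trans (add_le_add_left e _)) (norm_nonneg ℓ)
      rw [mul_add] at e4
      linarith
    have A3 : ∀ᶠ t : ℝ in (U : Filter ℝ), ∀ s ∈ closedBall (0:ℂ) ρ, P t (w + s • v') ≠ 0 := by
      filter_upwards [A2, hUpos, hUs (‖w‖ + ρ * ‖v'‖) r2 hr2] with t h1 h2 h3 s hs h4
      have hs' := mem_closedBall_zero_iff.1 hs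
      apply h1 s hs
      have hmem : x + (t:ℂ) • (w + s • v') ∈ φ.target := by
        apply hb2
        rw [mem_ball, dist_eq_norm, add_sub_cancel_left, norm_smul, Complex.norm_real, Real.norm_of_nonneg h2.le]
        refine lt_of_le_of_lt (mul_le_mul_of_nonneg_left ?_ h2.le) h3
        refine (norm_add_le _ _).trans ?_
        rw [norm_smul]
        gcongr
      have := (hz _ (φ.map_target hmem)).2 (by rw [φ.right_inv hmem, hPh, h4, mul_zero])
      simp only [f', sub_zero, map_smul, this, smul_zero]
    have A4 : ∀ᶠ t : ℝ in (U : Filter ℝ), ∀ s ∈ sphere (0:ℂ) ρ, c / 2 ≤ ‖P t (w + s • v')‖ := by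
      have hcont : Continuous fun p : ℂ × ℂ => P p.1 (w + p.2 • v') :=
        hPc.comp (by fun_prop : Continuous fun p : ℂ × ℂ => (p.1, w + p.2 • v'))
      have : ∀ᶠ t in 𝓝 (0:ℂ), ∀ s ∈ sphere (0:ℂ) ρ, c / 2 < ‖P t (w + s • v')‖ := by
        refine (isCompact_sphere (0:ℂ) ρ).eventually_forall_of_forall_eventually fun s hs => ?_
        have hlt : c / 2 < ‖P (0:ℂ) (w + s • v')‖ := by
          rw [hP0]; have := hcs s hs; simp only [g] at this; linarith
        exact (hcont.norm.tendsto (0, s)).eventually_const_lt hlt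
      exact (hUC.eventually this).mono fun t ht s hs => (ht s hs).le
    have A5 : ∀ᶠ t : ℝ in (U : Filter ℝ), ‖P t w‖ < c / 2 := by
      have := (hPt (tendsto_const_nhds (x := w))).norm
      rw [hw, norm_zero] at this
      exact this.eventually_lt_const (by positivity)
    obtain ⟨t, h3, h4, h5⟩ := (A3.and (A4.and A5)).exists
    obtain ⟨s, hs1, hs2⟩ := min_mod (g := fun s : ℂ => P t (w + s • v')) ((hPd t).comp (by fun_prop)) hρ h4 (by simpa using h5)
    exact h3 s (ball_subset_closedBall hs1) hs2
  have hiff : ∀ z, ℓ z = 0 ↔ G m (Φ z) = 0 := by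
    intro z
    refine ⟨fwd z, fun hzz => ?_⟩
    have := bwd _ hzz
    rwa [hΨΦ] at this
  refine ⟨Φh, ⟨K, hΦL.lipschitzOnWith, hΨL.lipschitzOnWith⟩, hiff, ?_⟩
  obtain ⟨a, ha⟩ := exists_one hℓ
  have hBx : Bx ℓ a univ univ = {z | ℓ z ≠ 0} := by ext z; simp [Bx]
  obtain ⟨k', hk'⟩ := box_cl ha (A := univ) (by rw [preimage_univ]; exact convex_univ) (B := univ)
    isOpen_univ convex_univ (u := G m ∘ Φ) ((hd m).continuous.comp hΦL.continuous).continuousOn (by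
      intro z hz1 hz2
      exact hz1.1 ((hiff z).2 hz2))
  rw [hBx] at hk'
  suffices hkk : k' = k by rw [← hkk]; exact hk'
  let γ : ℝ → E := fun θ => 0 + Complex.exp (2 * Real.pi * Complex.I * θ) • a
  have hγ : Continuous γ := by fun_prop
  let C : Set E := γ '' Icc 0 1
  have hC : IsCompact C := isCompact_Icc.image hγ
  have hℓγ : ∀ θ, ℓ (γ θ) = Complex.exp (2 * Real.pi * Complex.I * θ) := by
    intro θ; simp [γ, ha]
  have hCne : ∀ z ∈ C, ℓ z ≠ 0 := by
    rintro _ ⟨θ, -, rfl⟩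
    rw [hℓγ]; exact Complex.exp_ne_zero _
  suffices hCl : Cl (G m ∘ Φ) ℓ k C from
    Cl.unique_circ (hk'.mono hCne) hCl (z0 := 0) (b := a) (ρ := 1) one_ne_zero
      (fun θ hθ => ⟨θ, hθ, rfl⟩) (fun θ _ => by rw [one_mul]; exact hℓγ θ)
  obtain ⟨M, hM, s, hs1, hs2⟩ := hk
  obtain ⟨c, hc, hcl⟩ := norm_lb hC (f := G m ∘ Φ) ((hd m).continuous.comp hΦL.continuous).continuousOn
    (fun z hz1 hz2 => hCne z hz1 ((hiff z).2 hz2))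
  have hRC : ∃ R, C ⊆ closedBall (0:E) R := hC.isBounded.subset_closedBall 0
  obtain ⟨R, hR⟩ := hRC
  have B1 : ∀ᶠ t : ℝ in (U : Filter ℝ), ∀ z ∈ C, ‖P t (f t z) - G m (Φ z)‖ < c := by
    have hcont : Continuous fun p : (ℂ × E) × E => P p.1.1 (Φ p.2 + p.1.2) - G m (Φ p.2) := by
      refine Continuous.sub ?_ ((hd m).continuous.comp (hΦL.continuous.comp continuous_snd))
      refine hPc.comp (g := fun p : ℂ × E => P p.1 p.2) (f := fun p : (ℂ × E) × E => (p.1.1, Φ p.2 + p.1.2)) ?_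
      exact (by fun_prop : Continuous fun p : (ℂ × E) × E => p.1.1).prodMk
        ((hΦL.continuous.comp continuous_snd).add (by fun_prop))
    have : ∀ᶠ q in 𝓝 ((0:ℂ), (0:E)), ∀ z ∈ C, ‖P q.1 (Φ z + q.2) - G m (Φ z)‖ < c := by
      refine hC.eventually_forall_of_forall_eventually fun z hz => ?_
      refine (hcont.norm.tendsto (((0:ℂ), (0:E)), z)).eventually_lt_const ?_
      simp only [add_zero, hP0, sub_self, norm_zero]; exact hc
    obtain ⟨ε, hε, hball⟩ := Metric.mem_nhds_iff.1 this
    have hun := unif_of_lip hC ((hf R).mono fun t ht => ht.mono hR) hΦL.lipschitzOnWith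
      (fun z _ => hΦ z) hε
    have hsm : ∀ᶠ t : ℝ in (U : Filter ℝ), ‖(t:ℂ)‖ < ε := by
      have := hUC.norm
      rw [norm_zero] at this
      exact this.eventually_lt_const hε
    filter_upwards [hun, hsm] with t h1 h2 z hz
    have := @hball ((t:ℂ), f t z - Φ z) (by
      rw [mem_ball, Prod.dist_eq, max_lt_iff]; dsimp only
      refine ⟨by simpa using h2, ?_⟩
      have := h1 z hz
      rw [dist_eq_norm] at this
      simpa using this) z hz
    simpa using this
  have B2 : ∀ᶠ t : ℝ in (U : Filter ℝ), ∀ z ∈ C, 0 + (t:ℂ) • z ∈ M ∩ φ.source := by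
    obtain ⟨ε, hε, hball⟩ := Metric.mem_nhds_iff.1 (inter_mem hM (φ.open_source.mem_nhds h0))
    filter_upwards [hUpos, hUs R ε hε] with t h1 h2 z hz
    apply hball
    rw [mem_ball_zero_iff, zero_add, norm_smul, Complex.norm_real, Real.norm_of_nonneg h1.le]
    have := mem_closedBall_zero_iff.1 (hR hz)
    exact (mul_le_mul_of_nonneg_left this h1.le).trans_lt h2
  obtain ⟨t, hB1, hB2, ht, hft⟩ := (B1.and (B2.and (hUpos.and (hf R)))).exists
  have ht' : (t:ℂ) ≠ 0 := by exact_mod_cast ht.ne'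
  have hmemt : ∀ z ∈ C, 0 + (t:ℂ) • z ∈ M ∩ {z | ℓ z ≠ 0} := by
    intro z hz
    refine ⟨(hB2 z hz).1, ?_⟩
    simp only [mem_setOf_eq, zero_add, map_smul, smul_eq_mul]
    exact mul_ne_zero ht' (hCne z hz)
  have hGne : ∀ z ∈ C, G m (Φ z) ≠ 0 := fun z hz1 hz2 => hCne z hz1 ((hiff z).2 hz2)
  have hq : ∀ z ∈ C, P t (f t z) / G m (Φ z) ∈ Complex.slitPlane := by
    intro z hz
    apply Complex.mem_slitPlane_of_norm_lt_one (z := P t (f t z) / G m (Φ z) - 1) _ |> fun h => by simpa using h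
    rw [div_sub_one (hGne z hz), norm_div, div_lt_one (norm_pos_iff.2 (hGne z hz))]
    exact (hB1 z hz).trans_le (hcl z hz)
  let κ : ℂ := Complex.log ((t:ℂ) ^ k / (t:ℂ) ^ m)
  have hκ : Complex.exp κ = (t:ℂ) ^ k / (t:ℂ) ^ m :=
    Complex.exp_log (div_ne_zero (zpow_ne_zero _ ht') (pow_ne_zero _ ht'))
  refine ⟨fun z => κ + s (0 + (t:ℂ) • z) - Complex.log (P t (f t z) / G m (Φ z)), ?_, ?_⟩
  · refine (continuousOn_const.add (hs1.comp (f := fun z => 0 + (t:ℂ) • z) (by fun_prop) hmemt)).sub ?_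
    refine ContinuousOn.clog ?_ hq
    refine ContinuousOn.div ?_ ((hd m).continuous.comp hΦL.continuous).continuousOn hGne
    exact (hPd t).continuous.comp_continuousOn (hft.continuousOn.mono hR)
  · intro z hz
    have e1 := hs2 _ (hmemt z hz)
    simp only [Function.comp] at e1 ⊢
    rw [hfx t ht, hPh, map_add, map_smul, map_zero, zero_add, smul_eq_mul, mul_zpow] at e1
    have hPne : P t (f t z) ≠ 0 := by
      intro h'
      have := Complex.slitPlane_ne_zero (hq z hz)
      rw [h', zero_div] at this; exact this rfl
    rw [Complex.exp_sub, Complex.exp_add, hκ, Complex.exp_log (div_ne_zero hPne (hGne z hz))]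
    have := pow_ne_zero m ht'
    have := hGne z hz
    field_simp
    linear_combination e1

end Blw2

noncomputable section Ply
variable {n : ℕ}

def ev (p : MvPolynomial (Fin n) ℂ) (x : EuclideanSpace ℂ (Fin n)) : ℂ :=
  MvPolynomial.eval (x : Fin n → ℂ) p

local notation "𝔼" => EuclideanSpace ℂ (Fin n)

@[simp] theorem ev_add (p q : MvPolynomial (Fin n) ℂ) (x : 𝔼) : ev (p + q) x = ev p x + ev q x := by
  simp [ev]
@[simp] theorem ev_mul (p q : MvPolynomial (Fin n) ℂ) (x : 𝔼) : ev (p * q) x = ev p x * ev q x := by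
  simp [ev]
@[simp] theorem ev_C (c : ℂ) (x : 𝔼) : ev (MvPolynomial.C c) x = c := by simp [ev]
@[simp] theorem ev_X (i : Fin n) (x : 𝔼) : ev (MvPolynomial.X i) x = x i := by simp [ev]
@[simp] theorem ev_zero (x : 𝔼) : ev 0 x = 0 := by simp [ev]

theorem ev_ext {p q : MvPolynomial (Fin n) ℂ} (h : ∀ x : 𝔼, ev p x = ev q x) : p = q := by
  refine MvPolynomial.funext fun x => ?_
  have := h (WithLp.toLp 2 x)
  simpa [ev] using this

theorem ev_ne {p : MvPolynomial (Fin n) ℂ} (h : p ≠ 0) : ∃ x : 𝔼, ev p x ≠ 0 := by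
  by_contra hc
  push Not at hc
  exact h (ev_ext fun x => by rw [hc x, ev_zero])

def evD (p : MvPolynomial (Fin n) ℂ) (x : 𝔼) : 𝔼 →L[ℂ] ℂ :=
  ∑ i, ev (MvPolynomial.pderiv i p) x • (EuclideanSpace.proj i : 𝔼 →L[ℂ] ℂ)

theorem evD_apply (p : MvPolynomial (Fin n) ℂ) (x v : 𝔼) :
    evD p x v = ∑ i, ev (MvPolynomial.pderiv i p) x * v i := by
  simp [evD]

theorem ev_hasFDerivAt (p : MvPolynomial (Fin n) ℂ) (x : 𝔼) : HasFDerivAt (ev p) (evD p x) x := by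
  induction p using MvPolynomial.induction_on with
  | C c =>
    have e : ev (MvPolynomial.C c) = fun x : 𝔼 => c := by ext; simp
    have e' : evD (MvPolynomial.C c) x = 0 := by ext; simp [evD_apply]
    rw [e, e']; exact hasFDerivAt_const _ _
  | add p q hp hq =>
    have e : ev (p + q) = ev p + ev q := by ext; simp
    have e' : evD (p + q) x = evD p x + evD q x := by
      ext; simp [evD_apply, add_mul, Finset.sum_add_distrib]
    rw [e, e']; exact hp.add hq
  | mul_X p i hp =>
    have e : ev (p * MvPolynomial.X i) = fun x : 𝔼 => ev p x * x i := by ext; simp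
    have e' : evD (p * MvPolynomial.X i) x = ev p x • (EuclideanSpace.proj i : 𝔼 →L[ℂ] ℂ) + x i • evD p x := by
      ext v
      simp only [evD_apply, MvPolynomial.pderiv_mul, MvPolynomial.pderiv_X, ev_add, ev_mul, ev_X,
        ContinuousLinearMap.add_apply, ContinuousLinearMap.smul_apply, smul_eq_mul,
        show ∀ (j : Fin n) (y : EuclideanSpace ℂ (Fin n)), (EuclideanSpace.proj j : EuclideanSpace ℂ (Fin n) →L[ℂ] ℂ) y = y j from fun _ _ => rfl, add_mul, Finset.sum_add_distrib, Finset.mul_sum]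
      rw [add_comm]
      congr 1
      · rw [Finset.sum_eq_single i]
        · simp [ev]
        · intro j _ hj; simp [Pi.single_apply, hj.symm]
        · simp
      · exact Finset.sum_congr rfl fun j _ => by ring
    rw [e, e']
    exact hp.mul (EuclideanSpace.proj i : 𝔼 →L[ℂ] ℂ).hasFDerivAt

theorem ev_contDiff (p : MvPolynomial (Fin n) ℂ) : ContDiff ℂ ⊤ (ev p) := by
  induction p using MvPolynomial.induction_on with
  | C c =>
    have e : ev (MvPolynomial.C c) = fun x : 𝔼 => c := by ext; simp
    rw [e]; exact contDiff_const
  | add p q hp hq =>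
    have e : ev (p + q) = ev p + ev q := by ext; simp
    rw [e]; exact hp.add hq
  | mul_X p i hp =>
    have e : ev (p * MvPolynomial.X i) = fun x : 𝔼 => ev p x * (EuclideanSpace.proj i : 𝔼 →L[ℂ] ℂ) x := by ext; simp
    rw [e]
    exact hp.mul (ContinuousLinearMap.contDiff _)

theorem ev_fderiv (p : MvPolynomial (Fin n) ℂ) (x : 𝔼) : fderiv ℂ (ev p) x = evD p x :=
  (ev_hasFDerivAt p x).fderiv

theorem ev_diff (p : MvPolynomial (Fin n) ℂ) : Differentiable ℂ (ev p) :=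
  fun x => (ev_hasFDerivAt p x).differentiableAt

theorem ev_cont (p : MvPolynomial (Fin n) ℂ) : Continuous (ev p) := (ev_diff p).continuous

theorem ev_strict (p : MvPolynomial (Fin n) ℂ) (x : 𝔼) : HasStrictFDerivAt (ev p) (evD p x) x := by
  rw [← ev_fderiv]
  exact (ev_contDiff p).contDiffAt.hasStrictFDerivAt (by simp)

theorem evD_eq_zero {p : MvPolynomial (Fin n) ℂ} {x : 𝔼} :
    evD p x = 0 ↔ ∀ i, ev (MvPolynomial.pderiv i p) x = 0 := by
  constructor
  · intro h i
    have := congrArg (fun L => L (EuclideanSpace.single i (1:ℂ))) h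
    simpa [evD_apply] using this
  · intro h
    ext v
    simp [evD_apply, h]

theorem ev_hom {p : MvPolynomial (Fin n) ℂ} {m : ℕ} (hp : p.IsHomogeneous m) (c : ℂ) (x : 𝔼) :
    ev p (c • x) = c ^ m * ev p x := by
  simp only [ev, MvPolynomial.eval_eq, Finset.mul_sum]
  refine Finset.sum_congr rfl fun d hd => ?_
  have := hp.degree_eq_sum_deg_support hd
  simp only [PiLp.smul_apply, smul_eq_mul, mul_pow, Finset.prod_mul_distrib, Finset.prod_pow_eq_pow_sum]
  have e : ∑ i ∈ d.support, d i = m := this.symm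
  have e2 : ∏ i ∈ d.support, c ^ d i = c ^ m := by rw [Finset.prod_pow_eq_pow_sum, e]
  rw [← e]; ring

theorem ev_euler {p : MvPolynomial (Fin n) ℂ} {m : ℕ} (hp : p.IsHomogeneous m) (x : 𝔼) :
    evD p x x = m * ev p x := by
  have := congrArg (fun r => ev r x) hp.sum_X_mul_pderiv
  simp only [ev, map_sum, map_mul, MvPolynomial.eval_X, nsmul_eq_mul, map_natCast] at this
  rw [evD_apply]
  simp only [ev]
  rw [← this]
  exact Finset.sum_congr rfl fun i _ => mul_comm _ _

def shiftP (x : 𝔼) (p : MvPolynomial (Fin n) ℂ) : MvPolynomial (Fin n) ℂ :=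
  MvPolynomial.bind₁ (fun i => MvPolynomial.C (x i) + MvPolynomial.X i) p

theorem ev_shift (x z : 𝔼) (p : MvPolynomial (Fin n) ℂ) : ev (shiftP x p) z = ev p (x + z) := by
  simp only [ev, shiftP, MvPolynomial.eval, MvPolynomial.eval₂Hom_bind₁]
  congr 1
  congr 1
  ext i
  simp

def Lam (g : 𝔼 → ℂ) : Submodule ℂ 𝔼 where
  carrier := {v | ∀ (c : ℂ) z, g (z + c • v) = g z}
  add_mem' := by
    intro v w hv hw c z
    rw [smul_add, ← add_assoc, hw, hv]
  zero_mem' := by intro c z; simp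
  smul_mem' := by
    intro d v hv c z
    rw [smul_smul, hv]

theorem mem_Lam_hom {p : MvPolynomial (Fin n) ℂ} {m : ℕ} (hp : p.IsHomogeneous m) {v : 𝔼}
    (h : ∀ z, ev p (z + v) = ev p z) : v ∈ Lam (ev p) := by
  intro c z
  rcases eq_or_ne c 0 with rfl | hc
  · simp
  have e : z + c • v = c • (c⁻¹ • z + v) := by rw [smul_add, smul_inv_smul₀ hc]
  rw [e, ev_hom hp, h, ← ev_hom hp, smul_inv_smul₀ hc]

theorem blowup_poly {h : MvPolynomial (Fin n) ℂ} (hh : h ≠ 0) {x : 𝔼} (hx : ev h x = 0)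
    (hdx : evD h x = 0) {ℓ : 𝔼 →L[ℂ] ℂ} (hℓ : ℓ ≠ 0)
    {φ : OpenPartialHomeomorph 𝔼 𝔼} (hφ : BLip φ) (h0 : (0:𝔼) ∈ φ.source) (hφ0 : φ 0 = x)
    (hz : ∀ z ∈ φ.source, ℓ z = 0 ↔ ev h (φ z) = 0) {k : ℤ} (hk : Cln (ev h ∘ φ) ℓ k 0) :
    ∃ (G : MvPolynomial (Fin n) ℂ) (m : ℕ), G.IsHomogeneous m ∧ 2 ≤ m ∧ G ≠ 0 ∧
      (∀ v ∈ Lam (ev h), v ∈ Lam (ev G)) ∧ (∀ d, h.IsHomogeneous d → x ∈ Lam (ev G)) ∧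
    ∃ Φ : 𝔼 ≃ₜ 𝔼, BLip Φ.toOpenPartialHomeomorph ∧ (∀ z, ℓ z = 0 ↔ ev G (Φ z) = 0) ∧
      Cl (ev G ∘ Φ) ℓ k {z | ℓ z ≠ 0} := by
  let Q := shiftP x h
  let N := Q.totalDegree + 1
  let Gp : ℕ → MvPolynomial (Fin n) ℂ := fun j => MvPolynomial.homogeneousComponent j Q
  have hGh : ∀ j, (Gp j).IsHomogeneous j := fun j => MvPolynomial.homogeneousComponent_isHomogeneous j Q
  have hsum : ∀ z, ev h (x + z) = ∑ j ∈ Finset.range N, ev (Gp j) z := by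
    intro z
    rw [← ev_shift]
    conv_lhs => rw [show shiftP x h = Q from rfl, ← MvPolynomial.sum_homogeneousComponent Q]
    simp only [ev, map_sum]
    rfl
  have hQ : ∃ j, Gp j ≠ 0 := by
    by_contra hc
    push Not at hc
    obtain ⟨w, hw⟩ := ev_ne hh
    apply hw
    have := hsum (w - x)
    rw [add_sub_cancel] at this
    rw [this]
    exact Finset.sum_eq_zero fun j _ => by rw [hc, ev_zero]
  classical
  let m := Nat.find hQ
  have hm1 : Gp m ≠ 0 := Nat.find_spec hQ
  have hm2 : ∀ j < m, ∀ z, ev (Gp j) z = 0 := by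
    intro j hj z
    have := Nat.find_min hQ hj
    push Not at this
    rw [this, ev_zero]
  have hmN : m < N := by
    by_contra hc
    push Not at hc
    exact hm1 (MvPolynomial.homogeneousComponent_eq_zero _ _ (by omega))
  have hhom : ∀ j (c : ℂ) (z : 𝔼), ev (Gp j) (c • z) = c ^ j * ev (Gp j) z := fun j c z => ev_hom (hGh j) c z
  obtain ⟨P, hPc, hPd, hP0, hPh⟩ := deform (fun j => ev_diff (Gp j)) hhom hsum hm2 hmN
  have hPl : ∀ z, Tendsto (fun t : ℂ => P t z) (𝓝[≠] 0) (𝓝 (ev (Gp m) z)) := by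
    intro z
    rw [← hP0]
    have : Continuous fun t : ℂ => P t z := hPc.comp (by fun_prop : Continuous fun t : ℂ => (t, z))
    exact (this.tendsto 0).mono_left nhdsWithin_le_nhds
  have hm : 2 ≤ m := by
    by_contra hlt
    push Not at hlt
    obtain ⟨v, hv⟩ := ev_ne hm1
    apply hv
    interval_cases hmm : m
    · have := hPh 0 v
      rw [zero_smul, add_zero, hx, hP0] at this
      simpa using this.symm
    ·
      have hd : HasDerivAt (fun t : ℂ => ev h (x + t • v)) 0 0 := by
        have h1 : HasDerivAt (fun t : ℂ => x + t • v) v 0 := by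
          simpa using ((hasDerivAt_id (0:ℂ)).smul_const v).const_add x
        have h2 := (ev_hasFDerivAt h (x + (0:ℂ) • v)).comp_hasDerivAt 0 h1
        rw [zero_smul, add_zero, hdx] at h2
        exact h2
      have hsl := hasDerivAt_iff_tendsto_slope_zero.1 hd
      refine tendsto_nhds_unique (hPl v) (hsl.congr' ?_)
      filter_upwards [self_mem_nhdsWithin] with t ht
      simp only [zero_add, zero_smul, add_zero, hx, sub_zero, smul_eq_mul]
      rw [hPh, pow_one]
      field_simp [show t ≠ 0 from ht]
  refine ⟨Gp m, m, hGh m, hm, hm1, ?_, ?_, ?_⟩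
  · intro v hv
    refine mem_Lam_hom (hGh m) fun z => ?_
    refine tendsto_nhds_unique (hPl (z + v)) ((hPl z).congr' ?_)
    filter_upwards [self_mem_nhdsWithin] with t ht
    have e : ev h (x + t • (z + v)) = ev h (x + t • z) := by
      rw [smul_add, ← add_assoc]; exact hv t _
    rw [hPh, hPh] at e
    exact (mul_left_cancel₀ (pow_ne_zero _ ht) e).symm
  · intro d hd
    refine mem_Lam_hom (hGh m) fun z => ?_
    have e0 : Tendsto (fun t : ℂ => t / (1 + t)) (𝓝[≠] 0) (𝓝 0) := by
      have : ContinuousAt (fun t : ℂ => t / (1 + t)) 0 :=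
        continuousAt_id.div (by fun_prop) (by simp)
      have h2 := this.tendsto
      simp only [zero_div] at h2
      exact h2.mono_left nhdsWithin_le_nhds
    have e1 : Tendsto (fun t : ℂ => (1 + t) ^ d / (1 + t) ^ m * P (t / (1 + t)) z) (𝓝[≠] 0) (𝓝 (1 * ev (Gp m) z)) := by
      refine Tendsto.mul ?_ ?_
      · have : ContinuousAt (fun t : ℂ => (1 + t) ^ d / (1 + t) ^ m) 0 :=
          ContinuousAt.div (by fun_prop) (by fun_prop) (by simp)
        have h2 := this.tendsto
        simp only [add_zero, one_pow, div_one] at h2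
        exact h2.mono_left nhdsWithin_le_nhds
      · rw [← hP0]
        have : Continuous fun t : ℂ => P t z := hPc.comp (by fun_prop : Continuous fun t : ℂ => (t, z))
        exact (this.tendsto 0).comp e0
    rw [one_mul] at e1
    refine tendsto_nhds_unique (hPl (z + x)) (e1.congr' ?_)
    have hne : ∀ᶠ t in 𝓝[≠] (0:ℂ), 1 + t ≠ 0 := by
      have : ContinuousAt (fun t : ℂ => 1 + t) 0 := by fun_prop
      exact (this.eventually_ne (by simp)).filter_mono nhdsWithin_le_nhds
    filter_upwards [self_mem_nhdsWithin, hne] with t ht ht1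
    have ht' : t ≠ 0 := ht
    have e : x + t • (z + x) = (1 + t) • (x + (t / (1 + t)) • z) := by
      rw [smul_add, smul_add, smul_smul, mul_div_cancel₀ _ ht1, add_smul, one_smul]; abel
    have e2 := hPh t (z + x)
    rw [e, ev_hom hd, hPh, div_pow] at e2
    have := pow_ne_zero m ht'
    have := pow_ne_zero m ht1
    field_simp at e2 ⊢
    linear_combination e2
  · exact blowup (fun j => ev_diff (Gp j)) hhom hsum hm2 hmN (ev_ne hm1) hℓ hφ h0 hφ0 hz hk

end Ply

noncomputable section ThA
variable {n : ℕ}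
local notation "𝔼" => EuclideanSpace ℂ (Fin n)

theorem lam_deriv {G : MvPolynomial (Fin n) ℂ} {v : 𝔼} (hv : v ∈ Lam (ev G)) (x : 𝔼) : evD G x v = 0 := by
  have h1 : HasDerivAt (fun t : ℂ => x + t • v) v 0 := by
    simpa using ((hasDerivAt_id (0:ℂ)).smul_const v).const_add x
  have h2 := (ev_hasFDerivAt G (x + (0:ℂ) • v)).comp_hasDerivAt 0 h1
  rw [zero_smul, add_zero] at h2
  have e : (ev G ∘ fun t : ℂ => x + t • v) = fun _ => ev G x := by
    funext t; exact hv t x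
  rw [e] at h2
  exact h2.unique (hasDerivAt_const _ _)

theorem SS_base {G : MvPolynomial (Fin n) ℂ} {m : ℕ} (hG : G.IsHomogeneous m) (hm : 2 ≤ m)
    {ℓ : 𝔼 →L[ℂ] ℂ} (hℓ : ℓ ≠ 0) {Φ : 𝔼 ≃ₜ 𝔼} (hz : ∀ z, ℓ z = 0 ↔ ev G (Φ z) = 0)
    {k : ℤ} (hk : k = 1 ∨ k = -1) (hcl : Cl (ev G ∘ Φ) ℓ k {z | ℓ z ≠ 0})
    (hreg : ∀ x, x ∉ Lam (ev G) → evD G x ≠ 0) : False := by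
  let L := Lam (ev G)
  let W := Lᗮ
  let q : W → ℂ := fun w => ev G w
  have hm0 : (m : ℂ) ≠ 0 := by exact_mod_cast (by omega : m ≠ 0)
  have hq : HomIso q m := by
    refine ⟨?_, by omega, ?_, ?_⟩
    · exact ((ev_contDiff G).of_le le_top).comp W.subtypeL.contDiff
    · intro c x
      exact ev_hom hG c (x : 𝔼)
    · intro x hx hd
      have hx' : (x : 𝔼) ∉ L := by
        intro hxL
        apply hx
        have : inner ℂ (x : 𝔼) (x : 𝔼) = 0 := (Submodule.mem_orthogonal _ _).1 x.2 _ hxL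
        exact Subtype.ext (inner_self_eq_zero.1 this)
      apply hreg _ hx'
      have hf : HasFDerivAt q ((evD G x).comp W.subtypeL) x :=
        (ev_hasFDerivAt G (x : 𝔼)).comp x W.subtypeL.hasFDerivAt
      rw [hf.fderiv] at hd
      ext v
      obtain ⟨a, ha, b, hb, rfl⟩ := Submodule.exists_add_mem_mem_orthogonal (K := L) v
      have h2 : evD G x b = 0 := by
        have := congrArg (fun T => T (⟨b, hb⟩ : W)) hd
        simpa using this
      rw [map_add, lam_deriv ha, h2]; simp
  let π : 𝔼 →L[ℂ] W := W.orthogonalProjection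
  have hπ : ∀ z, ev G (π z : 𝔼) = ev G z := by
    intro z
    have h1 : z - π z ∈ L := by
      have : z - π z ∈ Wᗮ := Submodule.sub_starProjection_mem_orthogonal (K := W) z
      rwa [Submodule.orthogonal_orthogonal] at this
    have := h1 1 (π z : 𝔼)
    rw [one_smul, add_sub_cancel] at this
    exact this.symm
  have hπw : ∀ w : W, π (w : 𝔼) = w := fun w => Submodule.orthogonalProjection_mem_subspace_eq_self w
  obtain ⟨a, ha⟩ := exists_one hℓ
  obtain ⟨S, hS, hSe⟩ := hcl
  have key : ∀ (τ : ℂ) (y : 𝔼), ℓ y = Complex.exp τ →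
      ev G (Complex.exp (-(k * τ + S y) / m) • Φ y) = 1 := by
    intro τ y hy
    have hy0 : ℓ y ≠ 0 := by rw [hy]; exact Complex.exp_ne_zero _
    have h1 : ev G (Φ y) = ℓ y ^ k * Complex.exp (S y) := hSe y hy0
    rw [ev_hom hG, h1, hy, ← Complex.exp_int_mul, ← Complex.exp_nat_mul, ← Complex.exp_add, ← Complex.exp_add,
      mul_div_cancel₀ _ hm0]
    ring_nf
    simp
  have hkk : (k : ℂ) * k = 1 := by rcases hk with rfl | rfl <;> norm_num
  have hy : ∀ w : W, q w = 1 → ℓ (Φ.symm w) ≠ 0 := by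
    intro w hw h0
    have := (hz _).1 h0
    rw [Φ.apply_symm_apply] at this
    have hw' : ev G (w : 𝔼) = 1 := hw
    rw [hw'] at this
    exact one_ne_zero this
  have hσ : ∀ w : W, q w = 1 → ℓ (Φ.symm w) = Complex.exp (-(k * S (Φ.symm w))) := by
    intro w hw
    have h1 : ev G (Φ (Φ.symm w)) = ℓ (Φ.symm w) ^ k * Complex.exp (S (Φ.symm w)) := hSe _ (hy w hw)
    rw [Φ.apply_symm_apply, show ev G (w : 𝔼) = 1 from hw] at h1
    have hne := hy w hw
    have he := Complex.exp_ne_zero (S (Φ.symm w))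
    rcases hk with rfl | rfl
    · simp only [zpow_one, Int.cast_one, one_mul] at h1 ⊢
      rw [Complex.exp_neg]; exact eq_inv_of_mul_eq_one_left h1.symm
    · simp only [zpow_neg, zpow_one, Int.cast_neg, Int.cast_one, neg_mul, one_mul, neg_neg] at h1 ⊢
      field_simp at h1
      exact h1
  let σ : W → ℂ := fun w => -(k * S (Φ.symm w))
  let Y : ℝ → W → 𝔼 := fun t w => Complex.exp (((1 - t : ℝ) : ℂ) * σ w) • a +
    ((1 - t : ℝ) : ℂ) • (Φ.symm w - ℓ (Φ.symm w) • a)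
  have hY : ∀ t w, ℓ (Y t w) = Complex.exp (((1 - t : ℝ) : ℂ) * σ w) := by
    intro t w
    simp [Y, ha]
  let c : ℝ → W → W := fun t w =>
    π (Complex.exp (-(k * (((1 - t : ℝ) : ℂ) * σ w) + S (Y t w)) / m) • Φ (Y t w))
  refine no_contract hq hm c ?_ ?_ ?_ (p := π (Complex.exp (-(k * 0 + S a) / m) • Φ a)) ?_ ?_
  · have hσc : ContinuousOn (fun p : ℝ × W => σ p.2) (Icc 0 1 ×ˢ {x | q x = 1}) := by
      have h1 : ContinuousOn (fun p : ℝ × W => S (Φ.symm (p.2 : 𝔼))) (Icc 0 1 ×ˢ {x | q x = 1}) := by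
        refine hS.comp (f := fun p : ℝ × W => Φ.symm (p.2 : 𝔼)) ?_ ?_
        · exact (Φ.symm.continuous.comp (continuous_subtype_val.comp continuous_snd)).continuousOn
        · intro p hp; exact hy _ hp.2
      exact (continuousOn_const.mul h1).neg
    have hΦ : ContinuousOn (fun p : ℝ × W => Φ.symm (p.2 : 𝔼)) (Icc 0 1 ×ˢ {x | q x = 1}) :=
      (Φ.symm.continuous.comp (continuous_subtype_val.comp continuous_snd)).continuousOn
    have ht : ContinuousOn (fun p : ℝ × W => ((1 - p.1 : ℝ) : ℂ)) (Icc 0 1 ×ˢ {x | q x = 1}) := by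
      fun_prop
    have hYc : ContinuousOn (fun p : ℝ × W => Y p.1 p.2) (Icc 0 1 ×ˢ {x | q x = 1}) := by
      refine ContinuousOn.add ?_ ?_
      · exact ((ht.mul hσc).cexp).smul continuousOn_const
      · exact ht.smul (hΦ.sub ((ℓ.continuous.comp_continuousOn hΦ).smul continuousOn_const))
    have hSY : ContinuousOn (fun p : ℝ × W => S (Y p.1 p.2)) (Icc 0 1 ×ˢ {x | q x = 1}) := by
      refine hS.comp hYc ?_
      intro p hp
      show ℓ (Y p.1 p.2) ≠ 0
      rw [hY]; exact Complex.exp_ne_zero _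
    have hΦY : ContinuousOn (fun p : ℝ × W => Φ (Y p.1 p.2)) (Icc 0 1 ×ˢ {x | q x = 1}) :=
      Φ.continuous.comp_continuousOn hYc
    refine π.continuous.comp_continuousOn (ContinuousOn.smul (f := fun p : ℝ × W =>
      Complex.exp (-(k * (((1 - p.1 : ℝ) : ℂ) * σ p.2) + S (Y p.1 p.2)) / m)) ?_ hΦY)
    exact (((continuousOn_const.mul (ht.mul hσc)).add hSY).neg.div_const _).cexp
  · intro t ht x hx
    show ev G (c t x : 𝔼) = 1
    rw [hπ]
    exact key _ _ (hY t x)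
  · intro x hx
    have e1 : Y 0 x = Φ.symm x := by
      have := hσ x hx
      simp only [Y]
      rw [show ((1 - (0:ℝ) : ℝ) : ℂ) = 1 by simp, one_mul, one_smul]
      show Complex.exp (-(k * S (Φ.symm x))) • a + _ = _
      rw [← this]; abel
    show π _ = x
    rw [e1, show ((1 - (0:ℝ) : ℝ) : ℂ) = 1 by simp, Φ.apply_symm_apply]
    have : (k : ℂ) * (1 * σ x) + S (Φ.symm x) = 0 := by
      simp only [σ]; linear_combination -(S (Φ.symm x)) * hkk
    rw [this]
    simp [hπw]
  · show ev G (π _ : 𝔼) = 1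
    rw [hπ]
    exact key 0 a (by simp [ha])
  · intro x hx
    have e1 : Y 1 x = a := by simp [Y]
    show π _ = _
    rw [e1]; simp

theorem SS (N : ℕ) : ∀ {G : MvPolynomial (Fin n) ℂ} {m : ℕ} (hG : G.IsHomogeneous m) (hm : 2 ≤ m) (hG0 : G ≠ 0)
    {ℓ : 𝔼 →L[ℂ] ℂ} (hℓ : ℓ ≠ 0) {Φ : 𝔼 ≃ₜ 𝔼} (hB : BLip Φ.toOpenPartialHomeomorph)
    (hz : ∀ z, ℓ z = 0 ↔ ev G (Φ z) = 0)
    {k : ℤ} (hk : k = 1 ∨ k = -1) (hcl : Cl (ev G ∘ Φ) ℓ k {z | ℓ z ≠ 0})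
    (hN : n - Module.finrank ℂ (Lam (ev G)) ≤ N), False := by
  induction N with
  | zero =>
    intro G m hG hm hG0 ℓ hℓ Φ hB hz k hk hcl hN
    have hle := (Lam (ev G)).finrank_le
    rw [finrank_euclideanSpace_fin] at hle
    refine SS_base hG hm hℓ hz hk hcl fun x hx => (hx ?_).elim
    have : Lam (ev G) = ⊤ := Submodule.eq_top_of_finrank_eq (by rw [finrank_euclideanSpace_fin]; omega)
    rw [this]; trivial
  | succ N ih =>
    intro G m hG hm hG0 ℓ hℓ Φ hB hz k hk hcl hN
    by_cases hreg : ∀ x, x ∉ Lam (ev G) → evD G x ≠ 0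
    · exact SS_base hG hm hℓ hz hk hcl hreg
    push Not at hreg
    obtain ⟨x, hx, hdx⟩ := hreg
    have hm0 : (m : ℂ) ≠ 0 := by exact_mod_cast (by omega : m ≠ 0)
    have hx0 : ev G x = 0 := by
      have := ev_euler hG x
      rw [hdx] at this
      simpa [hm0] using this.symm
    have hy : ℓ (Φ.symm x) = 0 := by rw [hz, Φ.apply_symm_apply, hx0]
    let φ := (transl (Φ.symm x)).trans Φ.toOpenPartialHomeomorph
    have hφ : ∀ z, φ z = Φ (Φ.symm x + z) := fun z => rfl
    have hℓy : ∀ z, ℓ (Φ.symm x + z) = ℓ z := fun z => by rw [map_add, hy, zero_add]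
    obtain ⟨G', m', hG', hm', hG0', hL, hxL, Φ', hB', hz', hcl'⟩ := blowup_poly hG0 hx0 hdx hℓ (φ := φ)
      ((transl_blip _).trans hB) (by simp [φ, transl_source]) (by rw [hφ]; simp)
      (fun z _ => by rw [hφ, ← hz, hℓy]) (k := k) (by
        refine ⟨univ, univ_mem, ?_⟩
        obtain ⟨s, hs, hse⟩ := hcl
        refine ⟨fun z => s (Φ.symm x + z), ?_, ?_⟩
        · refine hs.comp (by fun_prop) ?_
          intro z hz
          show ℓ _ ≠ 0
          rw [hℓy]; exact hz.2
        · intro z hz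
          have := hse (Φ.symm x + z) (by show ℓ _ ≠ 0; rw [hℓy]; exact hz.2)
          rw [hℓy] at this
          exact this)
    refine ih hG' hm' hG0' hℓ hB' hz' hk hcl' ?_
    have hlt : Lam (ev G) < Lam (ev G') := by
      refine lt_of_le_of_ne (fun v hv => hL v hv) fun e => hx ?_
      rw [e]; exact hxL m hG
    have := Submodule.finrank_lt_finrank_of_lt hlt
    omega

theorem thmA {h : MvPolynomial (Fin n) ℂ} (hh : h ≠ 0) {x : 𝔼} (hx : ev h x = 0)
    (hreg : ∀ N ∈ 𝓝 x, ∃ y ∈ N, ev h y = 0 ∧ evD h y ≠ 0)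
    {ℓ : 𝔼 →L[ℂ] ℂ} (hℓ : ℓ ≠ 0)
    {φ : OpenPartialHomeomorph 𝔼 𝔼} (hφ : BLip φ) (h0 : (0:𝔼) ∈ φ.source) (hφ0 : φ 0 = x)
    (hz : ∀ z ∈ φ.source, ℓ z = 0 ↔ ev h (φ z) = 0) : evD h x ≠ 0 := by
  intro hdx
  obtain ⟨k, hk⟩ := cln_lin0 (ℓ' := ℓ) hℓ (φ.open_source.mem_nhds h0) (u := ev h ∘ φ)
    ((ev_cont h).comp_continuousOn φ.continuousOn) (fun z hzs hz0 hc => hz0 ((hz z hzs).2 hc))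
  have hk1 : k = 1 ∨ k = -1 := by
    obtain ⟨N, hN, hcl⟩ := id hk
    have hN' : φ.target ∩ φ.symm ⁻¹' (interior N) ∈ 𝓝 x := by
      have hxt : x ∈ φ.target := hφ0 ▸ φ.map_source h0
      have h1 : φ.symm x = 0 := by rw [← hφ0, φ.left_inv h0]
      refine inter_mem (φ.open_target.mem_nhds hxt) ?_
      refine (φ.symm.continuousAt hxt).preimage_mem_nhds ?_
      rw [h1]
      exact interior_mem_nhds.2 hN
    obtain ⟨y, ⟨hyt, hyN⟩, hy0, hyd⟩ := hreg _ hN'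
    have hys := φ.map_target hyt
    have hℓy : ℓ (φ.symm y) = 0 := by rw [hz _ hys, φ.right_inv hyt, hy0]
    obtain ⟨k', hk', hc⟩ := cln_loc (ℓ.hasStrictFDerivAt (x := φ.symm y)) hℓy hℓ (ev_strict h y) hy0 hyd (φ := φ)
      hys (φ.right_inv hyt) hz
    have : k = k' := cln_unique (ℓ.hasStrictFDerivAt (x := φ.symm y)) hℓy hℓ
      (⟨interior N, isOpen_interior.mem_nhds hyN, hcl.mono (inter_subset_inter_left _ interior_subset)⟩) hc
    rwa [this]
  obtain ⟨G, m, hG, hm, hG0, -, -, Φ, hB, hz', hcl⟩ := blowup_poly hh hx hdx hℓ hφ h0 hφ0 hz hk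
  exact SS _ hG hm hG0 hℓ hB hz' hk1 hcl le_rfl

end ThA

noncomputable section Alg1
variable {n : ℕ}
local notation "𝔼" => EuclideanSpace ℂ (Fin n)
local notation "ℛ" => MvPolynomial (Fin n) ℂ

def shHom (v : 𝔼) : Polynomial ℛ →+* Polynomial ℛ :=
  Polynomial.eval₂RingHom
    (MvPolynomial.eval₂Hom (Polynomial.C.comp MvPolynomial.C)
      (fun i => Polynomial.C (MvPolynomial.X i) + Polynomial.X * Polynomial.C (MvPolynomial.C (v i)))) Polynomial.X

theorem shHom_comp (v : 𝔼) : (shHom (-v)).comp (shHom v) = RingHom.id (Polynomial ℛ) := by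
  refine Polynomial.ringHom_ext' ?_ ?_
  · refine MvPolynomial.ringHom_ext ?_ ?_
    · intro r; simp [shHom]
    · intro i; simp [shHom]; ring
  · simp [shHom]

def shEquiv (v : 𝔼) : Polynomial ℛ ≃+* Polynomial ℛ :=
  RingEquiv.ofRingHom (shHom v) (shHom (-v)) (by have := shHom_comp (-v); rwa [neg_neg] at this) (shHom_comp v)

def evT (x : 𝔼) (t : ℂ) : Polynomial ℛ →+* ℂ :=
  Polynomial.eval₂RingHom (MvPolynomial.eval (x : Fin n → ℂ)) t

theorem evT_C (x : 𝔼) (t : ℂ) (p : ℛ) : evT x t (Polynomial.C p) = ev p x := by simp [evT, ev]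

theorem evT_sh (v x : 𝔼) (t : ℂ) (p : ℛ) : evT x t (shHom v (Polynomial.C p)) = ev p (x + t • v) := by
  have : ((evT x t).comp ((shHom v).comp Polynomial.C)) = (MvPolynomial.eval ((x + t • v : 𝔼) : Fin n → ℂ)) := by
    refine MvPolynomial.ringHom_ext ?_ ?_
    · intro r; simp [shHom, evT]
    · intro i; simp [shHom, evT]; ring
  exact congrArg (fun F => F p) this

theorem exists_D' (K : Type) [Field K] [Algebra ℛ K] [IsFractionRing ℛ K] {q b : ℛ} (hq : Irreducible q) (hb : ¬ q ∣ b) {v : 𝔼} (hv : ev q v ≠ 0) (h0 : ev q 0 = 0) :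
    ∃ D : ℛ, D ≠ 0 ∧ ∀ (x : 𝔼) (t : ℂ), ev D x ≠ 0 → ev q (x + t • v) = 0 → ev b (x + t • v) ≠ 0 := by
  classical
  letI : StrongNormalizationMonoid ℛ := UniqueFactorizationMonoid.normalizationMonoid
  letI : NormalizedGCDMonoid ℛ := UniqueFactorizationMonoid.toNormalizedGCDMonoid ℛ
  let Q := shHom v (Polynomial.C q)
  let B := shHom v (Polynomial.C b)
  have hQi : Irreducible Q := by
    have h1 : Irreducible (Polynomial.C q) := by
      have := (Polynomial.prime_C_iff (r := q)).2 hq.prime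
      exact this.irreducible
    exact (MulEquiv.irreducible_iff (shEquiv v : Polynomial ℛ ≃* Polynomial ℛ)).2 h1
  have hQB : ¬ Q ∣ B := by
    intro h
    have h1 : Polynomial.C q ∣ Polynomial.C b := (map_dvd_iff (shEquiv v)).1 h
    rw [Polynomial.C_dvd_iff_dvd_coeff] at h1
    exact hb (by simpa using h1 0)
  have hdeg : Q.natDegree ≠ 0 := by
    intro hd
    rw [Polynomial.natDegree_eq_zero] at hd
    obtain ⟨r, hr⟩ := hd
    have e1 := evT_sh v 0 1 q
    have e0 := evT_sh v 0 0 q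
    rw [show shHom v (Polynomial.C q) = Polynomial.C r from hr.symm, evT_C] at e1 e0
    rw [zero_add, one_smul] at e1
    rw [zero_add, zero_smul, h0] at e0
    rw [e0] at e1
    exact hv e1.symm
  have hprim : Q.IsPrimitive := hQi.isPrimitive hdeg
  have hK1 : Irreducible (Q.map (algebraMap ℛ K)) :=
    (Polynomial.IsPrimitive.irreducible_iff_irreducible_map_fraction_map hprim).1 hQi
  have hK2 : ¬ Q.map (algebraMap ℛ K) ∣ B.map (algebraMap ℛ K) := fun h =>
    hQB ((hprim.dvd_iff_fraction_map_dvd_fraction_map K).2 h)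
  obtain ⟨α, β, hαβ⟩ := (hK1.coprime_iff_not_dvd).2 hK2
  obtain ⟨c, hc0, hc⟩ := IsLocalization.integerNormalization_spec (nonZeroDivisors ℛ) α
  obtain ⟨d, hd0, hd⟩ := IsLocalization.integerNormalization_spec (nonZeroDivisors ℛ) β
  set α' := IsLocalization.integerNormalization (nonZeroDivisors ℛ) α
  set β' := IsLocalization.integerNormalization (nonZeroDivisors ℛ) β
  have hD : Polynomial.C d * α' * Q + Polynomial.C c * β' * B = Polynomial.C (c * d) := by
    apply Polynomial.map_injective (algebraMap ℛ K) (IsFractionRing.injective ℛ K)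
    simp only [Polynomial.map_add, Polynomial.map_mul, Polynomial.map_C, hc, hd, map_mul]
    have : ∀ (r : ℛ) (p : Polynomial K), r • p = Polynomial.C (algebraMap ℛ K r) * p := by
      intro r p
      rw [← Polynomial.smul_eq_C_mul, algebraMap_smul]
    rw [this, this]
    linear_combination (Polynomial.C (algebraMap ℛ K c) * Polynomial.C (algebraMap ℛ K d)) * hαβ
  refine ⟨c * d, mul_ne_zero (nonZeroDivisors.ne_zero hc0) (nonZeroDivisors.ne_zero hd0), ?_⟩
  intro x t hx hqx hbx
  have := congrArg (evT x t) hD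
  rw [map_add, map_mul, map_mul _ (_ * _) B, evT_sh, evT_sh, hqx, hbx, evT_C] at this
  apply hx; rw [← this]; ring

theorem exists_D {q b : ℛ} (hq : Irreducible q) (hb : ¬ q ∣ b) {v : 𝔼} (hv : ev q v ≠ 0) (h0 : ev q 0 = 0) :
    ∃ D : ℛ, D ≠ 0 ∧ ∀ (x : 𝔼) (t : ℂ), ev D x ≠ 0 → ev q (x + t • v) = 0 → ev b (x + t • v) ≠ 0 :=
  exists_D' (FractionRing ℛ) hq hb hv h0

end Alg1

noncomputable section Alg2
variable {n : ℕ}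
local notation "𝔼" => EuclideanSpace ℂ (Fin n)
local notation "ℛ" => MvPolynomial (Fin n) ℂ

def hgH : ℛ →+* Polynomial ℛ :=
  MvPolynomial.eval₂Hom (Polynomial.C.comp MvPolynomial.C)
      (fun i => Polynomial.X * Polynomial.C (MvPolynomial.X i))

theorem hgH_monomial (d : Fin n →₀ ℕ) (c : ℂ) :
    hgH (MvPolynomial.monomial d c) = Polynomial.monomial d.degree (MvPolynomial.monomial d c) := by
  rw [hgH, MvPolynomial.coe_eval₂Hom, MvPolynomial.eval₂_monomial, Finsupp.prod]
  simp only [mul_pow, Finset.prod_mul_distrib, Finset.prod_pow_eq_pow_sum]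
  rw [← Polynomial.C_mul_X_pow_eq_monomial, MvPolynomial.monomial_eq (a := c), Polynomial.C_mul, Finsupp.prod, map_prod]
  simp only [map_pow, RingHom.comp_apply]
  rw [show d.degree = ∑ i ∈ d.support, d i from rfl]
  ring

theorem hgH_coeff (p : ℛ) (j : ℕ) : (hgH p).coeff j = MvPolynomial.homogeneousComponent j p := by
  induction p using MvPolynomial.induction_on' with
  | monomial d c =>
    rw [hgH_monomial, Polynomial.coeff_monomial]
    split_ifs with h
    · rw [MvPolynomial.homogeneousComponent_eq_self]; exact MvPolynomial.isHomogeneous_monomial c h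
    · symm
      rw [MvPolynomial.homogeneousComponent_of_mem (m := j) (n := d.degree)]
      · simp [Ne.symm h, h]
      · exact MvPolynomial.isHomogeneous_monomial c rfl
  | add p q hp hq => rw [map_add, Polynomial.coeff_add, hp, hq, map_add]

theorem hom_of_mul' {hgH : ℛ →+* Polynomial ℛ} (hgH_coeff : ∀ p j, (hgH p).coeff j = MvPolynomial.homogeneousComponent j p) {a b : ℛ} {N : ℕ} (h : (a * b).IsHomogeneous N) (h0 : a * b ≠ 0) :
    ∃ m, a.IsHomogeneous m := by
  have ha0 : a ≠ 0 := left_ne_zero_of_mul h0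
  have hb0 : b ≠ 0 := right_ne_zero_of_mul h0
  have hinj : ∀ p : ℛ, p ≠ 0 → hgH p ≠ 0 := by
    intro p hp hc
    apply hp
    rw [← MvPolynomial.sum_homogeneousComponent p]
    exact Finset.sum_eq_zero fun j _ => by rw [← hgH_coeff, hc, Polynomial.coeff_zero]
  have e : hgH (a * b) = Polynomial.monomial N (a * b) := by
    ext1 j
    rw [hgH_coeff, Polynomial.coeff_monomial]
    split_ifs with hj
    · subst hj; exact MvPolynomial.homogeneousComponent_eq_self h
    · rw [MvPolynomial.homogeneousComponent_of_mem (m := j) (n := N) h]; simp [hj, Ne.symm hj]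
  have d1 : (hgH a).natDegree + (hgH b).natDegree = N := by
    rw [← Polynomial.natDegree_mul (hinj a ha0) (hinj b hb0), ← map_mul, e, Polynomial.natDegree_monomial, if_neg h0]
  have d2 : (hgH a).natTrailingDegree + (hgH b).natTrailingDegree = N := by
    rw [← Polynomial.natTrailingDegree_mul (hinj a ha0) (hinj b hb0), ← map_mul, e, Polynomial.natTrailingDegree_monomial h0]
  have l1 := Polynomial.natTrailingDegree_le_natDegree (hgH a)
  have l2 := Polynomial.natTrailingDegree_le_natDegree (hgH b)
  have he : (hgH a).natTrailingDegree = (hgH a).natDegree := by omega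
  refine ⟨(hgH a).natDegree, ?_⟩
  have : a = MvPolynomial.homogeneousComponent (hgH a).natDegree a := by
    conv_lhs => rw [← MvPolynomial.sum_homogeneousComponent a]
    rw [Finset.sum_eq_single (hgH a).natDegree]
    · intro j _ hj
      rw [← hgH_coeff]
      rcases lt_or_gt_of_ne hj with h | h
      · exact Polynomial.coeff_eq_zero_of_lt_natTrailingDegree (by omega)
      · exact Polynomial.coeff_eq_zero_of_natDegree_lt h
    · intro hj
      rw [Finset.mem_range, not_lt] at hj
      exact MvPolynomial.homogeneousComponent_eq_zero _ _ (by omega)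
  have hh := MvPolynomial.homogeneousComponent_isHomogeneous (hgH a).natDegree a
  rw [← this] at hh
  exact hh

theorem hom_of_mul {a b : ℛ} {N : ℕ} (h : (a * b).IsHomogeneous N) (h0 : a * b ≠ 0) :
    ∃ m, a.IsHomogeneous m := hom_of_mul' hgH_coeff h h0

theorem hom_of_dvd {p f : ℛ} {N : ℕ} (h : f.IsHomogeneous N) (h0 : f ≠ 0) (hp : p ∣ f) :
    p.IsHomogeneous p.totalDegree := by
  obtain ⟨b, rfl⟩ := hp
  obtain ⟨m, hm⟩ := hom_of_mul h h0
  rwa [hm.totalDegree (left_ne_zero_of_mul h0)]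

theorem irr_deg {p : ℛ} (hp : Irreducible p) : 1 ≤ p.totalDegree := by
  by_contra h
  have h0 : p.totalDegree = 0 := by omega
  rw [MvPolynomial.totalDegree_eq_zero_iff_eq_C] at h0
  have hc : p.coeff 0 ≠ 0 := by
    intro hc; rw [hc, map_zero] at h0; exact hp.ne_zero h0
  apply hp.not_isUnit
  rw [h0]
  exact (isUnit_iff_ne_zero.2 hc).map MvPolynomial.C

theorem ev_hom0 {p : ℛ} {m : ℕ} (hp : p.IsHomogeneous m) (hm : 1 ≤ m) : ev p 0 = 0 := by
  have := ev_hom hp 0 0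
  rwa [zero_smul, zero_pow (by omega), zero_mul] at this

def dirP (f : ℛ) (v : 𝔼) : ℛ := ∑ i, MvPolynomial.C (v i) * MvPolynomial.pderiv i f

theorem ev_dirP (f : ℛ) (v x : 𝔼) : ev (dirP f v) x = evD f x v := by
  rw [evD_apply, dirP]
  simp only [ev, map_sum, map_mul, MvPolynomial.eval_C]
  exact Finset.sum_congr rfl fun i _ => mul_comm _ _

theorem dirP_mul (a b : ℛ) (v : 𝔼) : dirP (a * b) v = a * dirP b v + b * dirP a v := by
  simp only [dirP, MvPolynomial.pderiv_mul, Finset.mul_sum, ← Finset.sum_add_distrib]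
  exact Finset.sum_congr rfl fun i _ => by ring

theorem dirP_self {p : ℛ} {m : ℕ} (hp : p.IsHomogeneous m) (hp0 : p ≠ 0) (hm : 1 ≤ m) {v : 𝔼} (hv : ev p v ≠ 0) : ¬ p ∣ dirP p v := by
  intro h
  have h0 : dirP p v ≠ 0 := by
    intro hc
    have := ev_dirP p v v
    rw [hc, ev_zero, ev_euler hp] at this
    have hm0 : (m : ℂ) ≠ 0 := by exact_mod_cast (by omega : m ≠ 0)
    exact mul_ne_zero hm0 hv this.symm
  have hd : (dirP p v).IsHomogeneous (m - 1) := by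
    refine MvPolynomial.IsHomogeneous.sum _ _ _ fun i _ => ?_
    exact hp.pderiv.C_mul _
  obtain ⟨r, hr⟩ := h
  have hr0 : r ≠ 0 := by rintro rfl; exact h0 (by rw [hr, mul_zero])
  have e := MvPolynomial.totalDegree_mul_of_isDomain hp0 hr0
  rw [← hr, hd.totalDegree h0, hp.totalDegree hp0] at e
  omega

theorem dirP_fac {p f : ℛ} {m : ℕ} (hpi : Irreducible p) (hp : p.IsHomogeneous m) (hm : 1 ≤ m) (hf : Squarefree f)
    (hpf : p ∣ f) {v : 𝔼} (hv : ev p v ≠ 0) : ¬ p ∣ dirP f v := by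
  obtain ⟨r, rfl⟩ := hpf
  intro h
  rw [dirP_mul, dvd_add_right (dvd_mul_right _ _)] at h
  rcases hpi.prime.dvd_or_dvd h with h | h
  · obtain ⟨s, rfl⟩ := h
    exact hpi.not_isUnit (hf p ⟨s, by ring⟩)
  · exact dirP_self hp hpi.ne_zero hm hv h

theorem line_diff (q : ℛ) (x v : 𝔼) : Differentiable ℂ fun t : ℂ => ev q (x + t • v) :=
  (ev_diff q).comp ((differentiable_const x).add (differentiable_id.smul_const v))

theorem ne_dense {D : ℛ} (hD : D ≠ 0) (x : 𝔼) {N : Set 𝔼} (hN : N ∈ 𝓝 x) : ∃ y ∈ N, ev D y ≠ 0 := by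
  obtain ⟨w, hw⟩ := ev_ne hD
  have hc : Continuous fun t : ℂ => x + t • (w - x) := by fun_prop
  have : (fun t : ℂ => x + t • (w - x)) ⁻¹' N ∈ 𝓝 (0:ℂ) := hc.continuousAt.preimage_mem_nhds (by simpa using hN)
  obtain ⟨δ, hδ, hs⟩ := Metric.mem_nhds_iff.1 this
  obtain ⟨ρ, h1, h2, c, hc0, hc⟩ := good_circle (line_diff D x (w - x)) ⟨1, by simpa using hw⟩ hδ
  refine ⟨x + (ρ : ℂ) • (w - x), hs (by simp [abs_of_pos h1, h2]), ?_⟩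
  have := hc (ρ : ℂ) (by simp [abs_of_pos h1])
  exact norm_pos_iff.1 (hc0.trans_le this)

theorem persist {q D : ℛ} {m : ℕ} (hq : q.IsHomogeneous m) {v x : 𝔼} (hv : ev q v ≠ 0) (hD : D ≠ 0) (hx : ev q x = 0)
    {ε : ℝ} (hε : 0 < ε) : ∃ (y : 𝔼) (t : ℂ), dist y x < ε ∧ ‖t‖ < ε ∧ ev D y ≠ 0 ∧ ev q (y + t • v) = 0 := by
  have hne : ∃ t : ℂ, ev q (x + t • v) ≠ 0 := by
    have hc : ContinuousAt (fun s : ℂ => ev q (s • x + v)) 0 :=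
      ((ev_cont q).comp (by fun_prop : Continuous fun s : ℂ => s • x + v)).continuousAt
    have h1 : ∀ᶠ s in 𝓝[≠] (0:ℂ), ev q (s • x + v) ≠ 0 :=
      (hc.eventually_ne (by simpa using hv)).filter_mono nhdsWithin_le_nhds
    obtain ⟨s, hs, hs0⟩ := (h1.and self_mem_nhdsWithin).exists
    refine ⟨s⁻¹, fun hc => hs ?_⟩
    rw [show s • x + v = s • (x + s⁻¹ • v) by rw [smul_add, smul_inv_smul₀ hs0], ev_hom hq, hc, mul_zero]
  obtain ⟨ρ, h1, h2, c, hc0, hc⟩ := good_circle (line_diff q x v) hne hε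
  have e1 : ∀ᶠ y in 𝓝 x, ∀ t ∈ sphere (0:ℂ) ρ, c / 2 < ‖ev q (y + t • v)‖ := by
    refine (isCompact_sphere (0:ℂ) ρ).eventually_forall_of_forall_eventually fun t ht => ?_
    have hcc : Continuous fun z : 𝔼 × ℂ => ‖ev q (z.1 + z.2 • v)‖ :=
      ((ev_cont q).comp (by fun_prop : Continuous fun z : 𝔼 × ℂ => z.1 + z.2 • v)).norm
    exact hcc.continuousAt.eventually_const_lt (by have := hc t ht; show c / 2 < ‖ev q (x + t • v)‖; linarith)
  have e2 : ∀ᶠ y in 𝓝 x, ‖ev q y‖ < c / 2 :=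
    (ev_cont q).norm.continuousAt.eventually_lt_const (by beta_reduce; rw [hx, norm_zero]; linarith)
  obtain ⟨y, ⟨⟨hy1, hy2⟩, hy3⟩, hyD⟩ := ne_dense hD x ((e1.and e2).and (Metric.ball_mem_nhds x hε))
  obtain ⟨t, ht, ht0⟩ := min_mod (line_diff q y v) h1 (fun t ht => (hy1 t ht).le) (by simpa using hy2)
  exact ⟨y, t, hy3, by simpa using (mem_ball_zero_iff.1 ht).trans h2, hyD, ht0⟩

theorem pt_of_nhds {v x : 𝔼} {N : Set 𝔼} (hN : N ∈ 𝓝 x) : ∃ ε > 0, ∀ (y : 𝔼) (t : ℂ), dist y x < ε → ‖t‖ < ε → y + t • v ∈ N := by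
  have hc : Continuous fun z : 𝔼 × ℂ => z.1 + z.2 • v := by fun_prop
  have : (fun z : 𝔼 × ℂ => z.1 + z.2 • v) ⁻¹' N ∈ 𝓝 (x, (0:ℂ)) := hc.continuousAt.preimage_mem_nhds (by simpa using hN)
  obtain ⟨ε, hε, hs⟩ := Metric.mem_nhds_iff.1 this
  refine ⟨ε, hε, fun y t hy ht => ?_⟩
  refine hs (show (y, t) ∈ ball (x, (0:ℂ)) ε from ?_)
  rw [mem_ball, Prod.dist_eq]
  exact max_lt hy (by simpa using ht)

theorem dens {q b : ℛ} {m : ℕ} (hqi : Irreducible q) (hq : q.IsHomogeneous m) (hm : 1 ≤ m) (hb : ¬ q ∣ b)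
    {x : 𝔼} (hx : ev q x = 0) {N : Set 𝔼} (hN : N ∈ 𝓝 x) : ∃ y ∈ N, ev q y = 0 ∧ ev b y ≠ 0 := by
  obtain ⟨v, hv⟩ := ev_ne hqi.ne_zero
  obtain ⟨D, hD, hD'⟩ := exists_D hqi hb hv (ev_hom0 hq hm)
  obtain ⟨ε, hε, hs⟩ := pt_of_nhds (v := v) hN
  obtain ⟨y, t, h1, h2, h3, h4⟩ := persist hq hv hD hx hε
  exact ⟨y + t • v, hs y t h1 h2, h4, hD' y t h3 h4⟩

theorem dens_reg {p f : ℛ} {m : ℕ} (hpi : Irreducible p) (hp : p.IsHomogeneous m) (hm : 1 ≤ m) (hf : Squarefree f)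
    (hpf : p ∣ f) {x : 𝔼} (hx : ev p x = 0) {N : Set 𝔼} (hN : N ∈ 𝓝 x) : ∃ y ∈ N, ev p y = 0 ∧ evD f y ≠ 0 := by
  obtain ⟨v, hv⟩ := ev_ne hpi.ne_zero
  obtain ⟨y, h1, h2, h3⟩ := dens hpi hp hm (dirP_fac hpi hp hm hf hpf hv) hx hN
  refine ⟨y, h1, h2, fun hc => h3 ?_⟩
  rw [ev_dirP, hc]; rfl

theorem fac_zero {f : ℛ} (hf : f ≠ 0) {x : 𝔼} (hx : ev f x = 0) : ∃ p, Irreducible p ∧ p ∣ f ∧ ev p x = 0 := by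
  induction f using WfDvdMonoid.induction_on_irreducible with
  | zero => exact absurd rfl hf
  | unit u hu =>
    exfalso
    obtain ⟨w, hw⟩ := hu.exists_right_inv
    have := congrArg (fun r => ev r x) hw
    simp only [ev_mul, hx, zero_mul] at this
    rw [show (1 : ℛ) = MvPolynomial.C 1 by simp, ev_C] at this
    exact zero_ne_one this
  | mul a i ha hi ih =>
    rw [ev_mul] at hx
    rcases mul_eq_zero.1 hx with h | h
    · exact ⟨i, hi, dvd_mul_right _ _, h⟩
    · obtain ⟨p, h1, h2, h3⟩ := ih ha h
      exact ⟨p, h1, h2.mul_left _, h3⟩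

theorem reg_dense {f : ℛ} {N0 : ℕ} (hf : Squarefree f) (hh : f.IsHomogeneous N0) {x : 𝔼} (hx : ev f x = 0) :
    ∀ N ∈ 𝓝 x, ∃ y ∈ N, ev f y = 0 ∧ evD f y ≠ 0 := by
  intro N hN
  obtain ⟨p, h1, h2, h3⟩ := fac_zero hf.ne_zero hx
  obtain ⟨y, hy, hy1, hy2⟩ := dens_reg h1 (hom_of_dvd hh hf.ne_zero h2) (irr_deg h1) hf h2 h3 hN
  refine ⟨y, hy, ?_, hy2⟩
  obtain ⟨r, rfl⟩ := h2
  rw [ev_mul, hy1, zero_mul]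

end Alg2

noncomputable section Alg3

theorem rem_fin (F : Finset ℂ) : ∀ f : ℂ → ℂ, (∀ s, s ∉ F → DifferentiableAt ℂ f s) →
    (∀ c ∈ F, ∃ C : ℝ, ∀ᶠ z in 𝓝[≠] c, ‖f z‖ ≤ C) → ∃ g : ℂ → ℂ, Differentiable ℂ g ∧ ∀ s, s ∉ F → g s = f s := by
  induction F using Finset.induction_on with
  | empty => intro f hd _; exact ⟨f, fun s => hd s (by simp), fun _ _ => rfl⟩
  | insert c F hc ih =>
    intro f hd hb
    obtain ⟨C, hC⟩ := hb c (by simp)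
    have hF : ∀ z0 : ℂ, ∀ᶠ z in 𝓝[≠] z0, z ∉ (insert c F) := by
      intro z0
      have : ((insert c F : Finset ℂ) : Set ℂ) \ {z0} ⊆ ((insert c F : Finset ℂ) : Set ℂ) := sdiff_subset
      have hfin := ((insert c F).finite_toSet.subset this).isClosed.compl_mem_nhds (x := z0) (by simp)
      filter_upwards [mem_nhdsWithin_of_mem_nhds hfin, self_mem_nhdsWithin] with z h1 h2 h3
      exact h1 ⟨h3, h2⟩
    have hs : {z | z ≠ c → (‖f z‖ ≤ C ∧ z ∉ insert c F)} ∈ 𝓝 c := by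
      have := hC.and (hF c)
      rw [eventually_nhdsWithin_iff] at this
      exact this
    have h1 := Complex.differentiableOn_update_limUnder_of_bddAbove (f := f) hs
      (fun z hz => (hd z (hz.1 hz.2).2).differentiableWithinAt)
      ⟨C, by rintro _ ⟨z, hz, rfl⟩; exact (hz.1 hz.2).1⟩
    set f1 := Function.update f c (limUnder (𝓝[≠] c) f) with hf1
    have hev : ∀ z, z ≠ c → f1 =ᶠ[𝓝 z] f := by
      intro z hz
      filter_upwards [isOpen_ne.mem_nhds hz] with w hw
      exact Function.update_of_ne hw _ _
    obtain ⟨g, hg, hgf⟩ := ih f1 (fun s hs' => by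
        by_cases h : s = c
        · subst h; exact h1.differentiableAt hs
        · exact (hev s h).differentiableAt_iff.2 (hd s (by simp [h, hs']))) (fun c' hc' => by
        obtain ⟨C', hC'⟩ := hb c' (by simp [hc'])
        have hne : c' ≠ c := by rintro rfl; exact hc hc'
        refine ⟨C', ?_⟩
        filter_upwards [hC', mem_nhdsWithin_of_mem_nhds (hev c' hne)] with z h2 h3
        rw [h3]; exact h2)
    refine ⟨g, hg, fun s hs' => ?_⟩
    rw [Finset.mem_insert, not_or] at hs'
    rw [hgf s hs'.2, hf1, Function.update_of_ne hs'.1]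

theorem rem_poly (F : Finset ℂ) (f : ℂ → ℂ) (hd : ∀ s, s ∉ F → DifferentiableAt ℂ f s) {A B : ℝ} (hA : 0 ≤ A) (hB : 0 ≤ B)
    (k : ℕ) (hb : ∀ s, s ∉ F → ‖f s‖ ≤ (A + B * ‖s‖) ^ k) :
    ∃ P : Polynomial ℂ, P.natDegree ≤ k ∧ ∀ s, s ∉ F → f s = P.eval s := by
  obtain ⟨g, hg, hgf⟩ := rem_fin F f hd (by
    intro c hc
    refine ⟨(A + B * (‖c‖ + 1)) ^ k, ?_⟩
    have hfin := ((F.finite_toSet.subset (sdiff_subset : (F : Set ℂ) \ {c} ⊆ _))).isClosed.compl_mem_nhds (x := c) (by simp)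
    filter_upwards [mem_nhdsWithin_of_mem_nhds hfin, self_mem_nhdsWithin, mem_nhdsWithin_of_mem_nhds (ball_mem_nhds c one_pos)] with z h1 h2 h3
    have hz : z ∉ F := fun h => h1 ⟨h, h2⟩
    refine (hb z hz).trans ?_
    have : ‖z‖ ≤ ‖c‖ + 1 := by
      have := norm_le_norm_add_norm_sub' z c
      rw [mem_ball_iff_norm] at h3; linarith
    gcongr)
  obtain ⟨R0, hR0⟩ : ∃ R0 : ℝ, ∀ s ∈ F, ‖s‖ ≤ R0 := by
    obtain ⟨R0, h⟩ := F.finite_toSet.isBounded.exists_norm_le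
    exact ⟨R0, fun s hs => h s hs⟩
  have hz : ∀ j : ℕ, k < j → iteratedDeriv j g 0 = 0 := by
    intro j hj
    have hle : ∀ᶠ R : ℝ in atTop, ‖iteratedDeriv j g 0‖ ≤ j.factorial * (A + B) ^ k * R⁻¹ := by
      filter_upwards [eventually_gt_atTop R0, eventually_ge_atTop 1] with R h1 h2
      have hR : 0 < R := by linarith
      have h3 := Complex.norm_iteratedDeriv_le_of_forall_mem_sphere_norm_le (f := g) (c := 0) (C := (A + B * R) ^ k) j hR
        hg.diffContOnCl (fun z hz => by
          have hz' : ‖z‖ = R := by simpa using hz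
          have : z ∉ F := fun h => by have := hR0 z h; linarith
          rw [hgf z this, ← hz']; exact hb z this)
      refine h3.trans ?_
      rw [div_le_iff₀ (by positivity)]
      have h4 : (A + B * R) ^ k ≤ (A + B) ^ k * R ^ k := by
        rw [← mul_pow]; gcongr; nlinarith
      have h5 : R ^ k ≤ R⁻¹ * R ^ j := by
        rw [inv_mul_eq_div, le_div_iff₀ hR, ← pow_succ]
        exact pow_le_pow_right₀ h2 hj
      calc (j.factorial : ℝ) * (A + B * R) ^ k ≤ j.factorial * ((A + B) ^ k * R ^ k) := by gcongr
        _ ≤ j.factorial * ((A + B) ^ k * (R⁻¹ * R ^ j)) := by gcongr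
        _ = _ := by ring
    have hlim : Tendsto (fun R : ℝ => (j.factorial : ℝ) * (A + B) ^ k * R⁻¹) atTop (𝓝 0) := by
      simpa using tendsto_inv_atTop_zero.const_mul ((j.factorial : ℝ) * (A + B) ^ k)
    have := ge_of_tendsto hlim hle
    exact norm_le_zero_iff.1 this
  refine ⟨∑ j ∈ Finset.range (k + 1), Polynomial.C ((j.factorial : ℂ)⁻¹ * iteratedDeriv j g 0) * Polynomial.X ^ j, ?_, ?_⟩
  · refine Polynomial.natDegree_sum_le_of_forall_le _ _ fun j hj => (Polynomial.natDegree_C_mul_X_pow_le _ _).trans ?_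
    have := Finset.mem_range.1 hj; omega
  · intro s hs
    rw [← hgf s hs, ← Complex.taylorSeries_eq_of_entire' 0 s hg, tsum_eq_sum (s := Finset.range (k + 1)), Polynomial.eval_finsetSum]
    · simp
    · intro j hj
      rw [hz j (by simpa using hj)]; simp

theorem interp {n : ℕ} {c : Fin n → ℂ} {δ : ℝ} (hδ : 0 < δ) (k : ℕ) (T : Finset (Fin n)) : ∀ F : (Fin n → ℂ) → ℂ,
    (∀ x, (∀ i, x i ∈ ball (c i) δ) → ∀ i, ∃ P : Polynomial ℂ, P.natDegree ≤ k ∧ ∀ s ∈ ball (c i) δ, F (Function.update x i s) = P.eval s) →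
    (∀ x y, (∀ i, x i ∈ ball (c i) δ) → (∀ i, y i ∈ ball (c i) δ) → (∀ i ∈ T, x i = y i) → F x = F y) →
    ∃ A : MvPolynomial (Fin n) ℂ, ∀ x, (∀ i, x i ∈ ball (c i) δ) → F x = MvPolynomial.eval x A := by
  induction T using Finset.induction_on with
  | empty =>
    intro F _ h2
    exact ⟨MvPolynomial.C (F c), fun x hx => by rw [MvPolynomial.eval_C]; exact h2 x c hx (fun i => mem_ball_self hδ) (by simp)⟩
  | insert i T hi ih =>
    intro F h1 h2
    have hupd : ∀ (x : Fin n → ℂ) (i : Fin n) (s : ℂ), (∀ i, x i ∈ ball (c i) δ) → s ∈ ball (c i) δ → ∀ j, Function.update x i s j ∈ ball (c j) δ := by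
      intro x i s hx hs j
      by_cases h : j = i
      · subst h; simpa using hs
      · simpa [Function.update_of_ne h] using hx j
    obtain ⟨S, hS, hcard⟩ : ∃ S : Finset ℂ, (∀ s ∈ S, s ∈ ball (c i) δ) ∧ S.card = k + 1 := by
      have hinf : (ball (c i) δ).Infinite := by
        have := infinite_of_mem_nhds (c i) (ball_mem_nhds (c i) hδ)
        exact this
      obtain ⟨S, hS, hc⟩ := hinf.exists_subset_card_eq (k + 1)
      exact ⟨S, fun s hs => hS hs, hc⟩
    have key : ∀ a ∈ S, ∃ A : MvPolynomial (Fin n) ℂ, ∀ x, (∀ i, x i ∈ ball (c i) δ) → F (Function.update x i a) = MvPolynomial.eval x A := by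
      intro a ha
      refine ih (fun x => F (Function.update x i a)) ?_ ?_
      · intro x hx i'
        by_cases h : i' = i
        · subst h
          exact ⟨Polynomial.C (F (Function.update x i' a)), by simp, fun s hs => by simp⟩
        · obtain ⟨P, hP, hP'⟩ := h1 _ (hupd x i a hx (hS a ha)) i'
          refine ⟨P, hP, fun s hs => ?_⟩
          beta_reduce
          rw [Function.update_comm h, hP' s hs]
      · intro x y hx hy hxy
        refine h2 _ _ (hupd x i a hx (hS a ha)) (hupd y i a hy (hS a ha)) fun j hj => ?_
        by_cases h : j = i
        · subst h; simp
        · rw [Function.update_of_ne h, Function.update_of_ne h]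
          exact hxy j (by simpa [h] using hj)
    choose! A hA using key
    refine ⟨∑ a ∈ S, A a * Polynomial.aeval (MvPolynomial.X i) (Lagrange.basis S id a), fun x hx => ?_⟩
    obtain ⟨P, hP, hP'⟩ := h1 x hx i
    have hPi : P = Lagrange.interpolate S id fun a => F (Function.update x i a) := by
      refine Lagrange.eq_interpolate_of_eval_eq _ Function.injective_id.injOn ?_ ?_
      · rw [hcard]; exact lt_of_le_of_lt Polynomial.degree_le_natDegree (by exact_mod_cast Nat.lt_succ_of_le hP)
      · intro a ha; exact (hP' a (hS a ha)).symm
    have h3 := hP' (x i) (hx i)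
    rw [Function.update_eq_self] at h3
    rw [h3, hPi, Lagrange.interpolate_apply, Polynomial.eval_finsetSum, map_sum]
    refine Finset.sum_congr rfl fun a ha => ?_
    rw [Polynomial.eval_mul, Polynomial.eval_C, map_mul, hA a ha x hx]
    congr 1
    rw [Polynomial.aeval_def, Polynomial.hom_eval₂, MvPolynomial.eval_X]
    have : (MvPolynomial.eval x).comp (algebraMap ℂ (MvPolynomial (Fin n) ℂ)) = RingHom.id ℂ := by
      ext z; simp
    rw [this, Polynomial.eval₂_id]

end Alg3

noncomputable section Alg4
variable {n : ℕ}
local notation "𝔼" => EuclideanSpace ℂ (Fin n)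
local notation "ℛ" => MvPolynomial (Fin n) ℂ

def LP (q : ℛ) (x v : 𝔼) : Polynomial ℂ :=
  MvPolynomial.aeval (fun i => Polynomial.C (x i) + Polynomial.C (v i) * Polynomial.X) q

theorem LP_eval (q : ℛ) (x v : 𝔼) (t : ℂ) : (LP q x v).eval t = ev q (x + t • v) := by
  rw [LP, ev, MvPolynomial.aeval_def, ← Polynomial.coe_evalRingHom, MvPolynomial.hom_eval₂]
  have : (Polynomial.evalRingHom t).comp (algebraMap ℂ (Polynomial ℂ)) = RingHom.id ℂ := by ext z; simp
  rw [this]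
  change MvPolynomial.eval₂ _ _ _ = MvPolynomial.eval₂ _ _ _
  have e : (fun i => (Polynomial.evalRingHom t) (Polynomial.C (x i) + Polynomial.C (v i) * Polynomial.X)) = (x + t • v : 𝔼).ofLp := by
    funext i
    simp only [Polynomial.coe_evalRingHom, Polynomial.eval_add, Polynomial.eval_mul, Polynomial.eval_C, Polynomial.eval_X, PiLp.add_apply, PiLp.smul_apply, smul_eq_mul]
    rw [mul_comm]
  rw [e]

theorem LP_deg {q : ℛ} {m : ℕ} (hq : q.IsHomogeneous m) (x v : 𝔼) : (LP q x v).natDegree ≤ m := by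
  have := MvPolynomial.aeval_natDegree_le (m := m) (n := 1) q hq.totalDegree_le
    (fun i => Polynomial.C (x i) + Polynomial.C (v i) * Polynomial.X) (fun i => by compute_degree)
  rw [mul_one] at this
  exact this

theorem LP_lc {q : ℛ} {m : ℕ} (hq : q.IsHomogeneous m) (x v : 𝔼) : (LP q x v).coeff m = ev q v := by
  have h1 : (fun s : ℂ => (Polynomial.reflect m (LP q x v)).eval s) = fun s => ev q (v + s • x) := by
    refine Continuous.ext_on (dense_compl_singleton (0 : ℂ)) (Polynomial.continuous _) (line_diff q v x).continuous ?_
    intro s hs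
    have hs : s ≠ 0 := hs
    have : Invertible (s⁻¹) := invertibleOfNonzero (inv_ne_zero hs)
    have h2 := Polynomial.eval₂_reflect_mul_pow (RingHom.id ℂ) s⁻¹ m (LP q x v) (LP_deg hq x v)
    rw [Polynomial.eval₂_id, Polynomial.eval₂_id, LP_eval, invOf_eq_inv, inv_inv] at h2
    have h3 : x + s⁻¹ • v = s⁻¹ • (v + s • x) := by
      rw [smul_add, smul_smul, inv_mul_cancel₀ hs, one_smul, add_comm]
    rw [h3, ev_hom hq, mul_comm] at h2
    exact mul_left_cancel₀ (pow_ne_zero _ (inv_ne_zero hs)) h2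
  have h4 := congrFun h1 0
  beta_reduce at h4
  rw [← Polynomial.coeff_zero_eq_eval_zero, Polynomial.coeff_reflect] at h4
  simpa using h4

theorem LP_nd {q : ℛ} {m : ℕ} {v : 𝔼} (hq : q.IsHomogeneous m) (hv : ev q v ≠ 0) (x : 𝔼) : (LP q x v).natDegree = m :=
  le_antisymm (LP_deg hq x v) (Polynomial.le_natDegree_of_ne_zero (by rwa [LP_lc hq]))

theorem LP_ne {q : ℛ} {m : ℕ} {v : 𝔼} (hq : q.IsHomogeneous m) (hv : ev q v ≠ 0) (x : 𝔼) : LP q x v ≠ 0 := by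
  intro h; have := LP_lc hq x v; rw [h] at this; simp at this; exact hv this.symm

def RT (q : ℛ) (v x : 𝔼) : Finset ℂ := (LP q x v).roots.toFinset

theorem mem_RT {q : ℛ} {m : ℕ} {v : 𝔼} (hq : q.IsHomogeneous m) (hv : ev q v ≠ 0) {x : 𝔼} {t : ℂ} : t ∈ RT q v x ↔ ev q (x + t • v) = 0 := by
  rw [RT, Multiset.mem_toFinset, Polynomial.mem_roots (LP_ne hq hv x), Polynomial.IsRoot, LP_eval]

theorem RT_card_le {q : ℛ} {m : ℕ} {v : 𝔼} (hq : q.IsHomogeneous m) (x : 𝔼) : (RT q v x).card ≤ m :=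
  (Multiset.toFinset_card_le _).trans ((Polynomial.card_roots' _).trans (LP_deg hq x v))

theorem LP_der (q : ℛ) (x v : 𝔼) (t : ℂ) : (LP q x v).derivative.eval t = evD q (x + t • v) v := by
  have h1 := (LP q x v).hasDerivAt t
  have h2 : HasDerivAt (fun t : ℂ => ev q (x + t • v)) (evD q (x + t • v) v) t := by
    have := (ev_hasFDerivAt q (x + t • v)).comp_hasDerivAt t (((hasDerivAt_id t).smul_const v).const_add x)
    rw [one_smul] at this
    exact this
  have h3 : (fun t => (LP q x v).eval t) = fun t : ℂ => ev q (x + t • v) := funext fun t => LP_eval q x v t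
  rw [h3] at h1
  exact h1.unique h2

theorem RT_roots {q : ℛ} {v : 𝔼} {x : 𝔼} (h0 : LP q x v ≠ 0) (hs : ∀ t : ℂ, ev q (x + t • v) = 0 → evD q (x + t • v) v ≠ 0) :
    (RT q v x).val = (LP q x v).roots := by
  rw [RT, Multiset.toFinset_val, Multiset.dedup_eq_self, Multiset.nodup_iff_count_le_one]
  intro t
  rw [Polynomial.count_roots]
  by_contra hc
  have := (Polynomial.one_lt_rootMultiplicity_iff_isRoot h0).1 (not_le.1 hc)
  rw [Polynomial.IsRoot, Polynomial.IsRoot, LP_eval, LP_der] at this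
  exact hs t this.1 this.2

theorem RT_card {q : ℛ} {m : ℕ} {v : 𝔼} (hq : q.IsHomogeneous m) (hv : ev q v ≠ 0) {x : 𝔼}
    (hs : ∀ t : ℂ, ev q (x + t • v) = 0 → evD q (x + t • v) v ≠ 0) : (RT q v x).card = m := by
  rw [Finset.card_def, RT_roots (LP_ne hq hv x) hs, ← (IsAlgClosed.splits _).natDegree_eq_card_roots, LP_nd hq hv]

theorem RT_prod {q : ℛ} {m : ℕ} {v : 𝔼} (hq : q.IsHomogeneous m) (hv : ev q v ≠ 0) {x : 𝔼}
    (hs : ∀ t : ℂ, ev q (x + t • v) = 0 → evD q (x + t • v) v ≠ 0) : ev q x = ev q v * ∏ t ∈ RT q v x, (-t) := by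
  have h1 := (IsAlgClosed.splits (LP q x v)).eval_eq_prod_roots 0
  rw [LP_eval, ← RT_roots (LP_ne hq hv x) hs, Polynomial.leadingCoeff, LP_nd hq hv, LP_lc hq] at h1
  simp only [zero_smul, add_zero, zero_sub] at h1
  exact h1

open Classical in
def br (q : ℛ) (v : 𝔼) (O : Set 𝔼) (x : 𝔼) : ℂ := ∏ t ∈ (RT q v x).filter (fun t => x + t • v ∈ O), (-t)

theorem br_mul {q : ℛ} {m : ℕ} {v : 𝔼} (hq : q.IsHomogeneous m) (hv : ev q v ≠ 0) {x : 𝔼}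
    (hs : ∀ t : ℂ, ev q (x + t • v) = 0 → evD q (x + t • v) v ≠ 0) {O1 O2 : Set 𝔼}
    (h1 : ∀ t : ℂ, ev q (x + t • v) = 0 → (x + t • v ∈ O2 ↔ x + t • v ∉ O1)) :
    ev q x = ev q v * (br q v O1 x * br q v O2 x) := by
  classical
  rw [RT_prod hq hv hs, br, br, ← Finset.prod_filter_mul_prod_filter_not (RT q v x) (fun t => x + t • v ∈ O1)]
  congr 3
  refine Finset.filter_congr fun t ht => ?_
  exact (h1 t ((mem_RT hq hv).1 ht)).symm

theorem root_bd {q : ℛ} {m : ℕ} {v : 𝔼} (hq : q.IsHomogeneous m) (hv : ev q v ≠ 0) :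
    ∃ β : ℝ, 0 ≤ β ∧ ∀ x t, t ∈ RT q v x → ‖t‖ ≤ 1 + β * ‖x‖ := by
  have : ∀ᶠ y in 𝓝 v, ev q y ≠ 0 := (ev_cont q).continuousAt.eventually_ne hv
  obtain ⟨δ, hδ, hb⟩ := Metric.eventually_nhds_iff.1 this
  refine ⟨δ⁻¹, by positivity, fun x t ht => ?_⟩
  by_contra hc
  push Not at hc
  have h0 : 0 < ‖t‖ := lt_of_le_of_lt (by positivity) hc
  have ht0 : t ≠ 0 := norm_pos_iff.1 h0
  have h1 : x + t • v = t • (v + t⁻¹ • x) := by rw [smul_add, smul_smul, mul_inv_cancel₀ ht0, one_smul, add_comm]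
  have h2 := (mem_RT hq hv).1 ht
  rw [h1, ev_hom hq] at h2
  refine hb (y := v + t⁻¹ • x) ?_ ((mul_eq_zero.1 h2).resolve_left (pow_ne_zero _ ht0))
  rw [dist_eq_norm, add_sub_cancel_left, norm_smul, norm_inv, inv_mul_lt_iff₀ h0]
  have : δ⁻¹ * ‖x‖ < ‖t‖ := by linarith
  rw [inv_mul_lt_iff₀ hδ] at this
  linarith

theorem br_bd {q : ℛ} {m : ℕ} {v : 𝔼} (hq : q.IsHomogeneous m) {x : 𝔼} {β : ℝ} (hβ : 0 ≤ β)
    (hb : ∀ t, t ∈ RT q v x → ‖t‖ ≤ 1 + β * ‖x‖) (O : Set 𝔼) : ‖br q v O x‖ ≤ (1 + β * ‖x‖) ^ m := by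
  classical
  rw [br, norm_prod]
  calc _ ≤ ∏ t ∈ (RT q v x).filter (fun t => x + t • v ∈ O), (1 + β * ‖x‖) :=
        Finset.prod_le_prod (fun _ _ => norm_nonneg _) fun t ht => by rw [norm_neg]; exact hb t (Finset.mem_filter.1 ht).1
    _ ≤ _ := by
        rw [Finset.prod_const]
        exact pow_le_pow_right₀ (by nlinarith [norm_nonneg x, mul_nonneg hβ (norm_nonneg x)]) ((Finset.card_filter_le _ _).trans (RT_card_le hq x))

theorem br_small {q : ℛ} {m : ℕ} {v : 𝔼} (hq : q.IsHomogeneous m) {x : 𝔼} {β : ℝ} (hβ : 0 ≤ β)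
    (hb : ∀ t, t ∈ RT q v x → ‖t‖ ≤ 1 + β * ‖x‖) {O : Set 𝔼} {t0 : ℂ} (ht : t0 ∈ RT q v x) (hO : x + t0 • v ∈ O) :
    ‖br q v O x‖ ≤ ‖t0‖ * (1 + β * ‖x‖) ^ m := by
  classical
  rw [br, ← Finset.mul_prod_erase _ _ (Finset.mem_filter.2 ⟨ht, hO⟩), norm_mul, norm_neg, norm_prod]
  gcongr
  calc _ ≤ ∏ t ∈ ((RT q v x).filter (fun t => x + t • v ∈ O)).erase t0, (1 + β * ‖x‖) :=
        Finset.prod_le_prod (fun _ _ => norm_nonneg _) fun t ht => by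
          rw [norm_neg]; exact hb t (Finset.mem_filter.1 (Finset.mem_erase.1 ht).2).1
    _ ≤ _ := by
        rw [Finset.prod_const]
        exact pow_le_pow_right₀ (by nlinarith [norm_nonneg x, mul_nonneg hβ (norm_nonneg x)])
          ((Finset.card_erase_le).trans ((Finset.card_filter_le _ _).trans (RT_card_le hq x)))

theorem impl {q : ℛ} {v x0 : 𝔼} {t0 : ℂ} (h0 : ev q (x0 + t0 • v) = 0) (hs : evD q (x0 + t0 • v) v ≠ 0) :
    ∃ τ : 𝔼 → ℂ, DifferentiableAt ℂ τ x0 ∧ τ x0 = t0 ∧ ∀ᶠ x in 𝓝 x0, ev q (x + τ x • v) = 0 := by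
  let Φ : 𝔼 × ℂ →L[ℂ] 𝔼 := ContinuousLinearMap.fst ℂ 𝔼 ℂ + (ContinuousLinearMap.snd ℂ 𝔼 ℂ).smulRight v
  have hd : HasStrictFDerivAt (fun p : 𝔼 × ℂ => ev q (Φ p)) ((evD q (x0 + t0 • v)).comp Φ) (x0, t0) :=
    HasStrictFDerivAt.comp (x0, t0) (g := ev q) (ev_strict q (Φ (x0, t0))) Φ.hasStrictFDerivAt
  have hi : (((evD q (x0 + t0 • v)).comp Φ) ∘L .inr ℂ 𝔼 ℂ).IsInvertible := by
    refine ⟨ContinuousLinearEquiv.smulLeft (Units.mk0 _ hs), ?_⟩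
    ext
    simp [Φ]
  refine ⟨hd.implicitFunctionOfProdDomain hi, (hd.hasStrictFDerivAt_implicitFunctionOfProdDomain hi).differentiableAt, ?_, ?_⟩
  · exact (hd.eventually_apply_eq_iff_implicitFunctionOfProdDomain hi).self_of_nhds.mp rfl
  · filter_upwards [hd.eventually_apply_implicitFunctionOfProdDomain hi] with x hx
    have e : Φ (x0, t0) = x0 + t0 • v := by simp [Φ]
    have e' : ∀ t, Φ (x, t) = x + t • v := by simp [Φ]
    rw [e, h0, e'] at hx
    exact hx

end Alg4

noncomputable section Alg5
variable {n : ℕ}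
local notation "𝔼" => EuclideanSpace ℂ (Fin n)
local notation "ℛ" => MvPolynomial (Fin n) ℂ

structure SepD (q D : ℛ) (v : 𝔼) (m : ℕ) (O1 O2 : Set 𝔼) : Prop where
  hq : q.IsHomogeneous m
  hv : ev q v ≠ 0
  hD : D ≠ 0
  hs : ∀ (x : 𝔼) (t : ℂ), ev D x ≠ 0 → ev q (x + t • v) = 0 → evD q (x + t • v) v ≠ 0
  o1 : IsOpen O1
  o2 : IsOpen O2
  h12 : ∀ (x : 𝔼) (t : ℂ), ev D x ≠ 0 → ev q (x + t • v) = 0 → (x + t • v ∈ O2 ↔ x + t • v ∉ O1)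

theorem SepD.symm {q D : ℛ} {v : 𝔼} {m : ℕ} {O1 O2 : Set 𝔼} (S : SepD q D v m O1 O2) : SepD q D v m O2 O1 :=
  ⟨S.hq, S.hv, S.hD, S.hs, S.o2, S.o1, fun x t h h' => by have := S.h12 x t h h'; tauto⟩

theorem SepD.diff {q D : ℛ} {v : 𝔼} {m : ℕ} {O1 O2 : Set 𝔼} (S : SepD q D v m O1 O2) {x0 : 𝔼} (hx : ev D x0 ≠ 0) :
    DifferentiableAt ℂ (br q v O1) x0 := by
  classical
  have key : ∀ t0 ∈ RT q v x0, ∃ τ : 𝔼 → ℂ, DifferentiableAt ℂ τ x0 ∧ τ x0 = t0 ∧ ∀ᶠ x in 𝓝 x0, ev q (x + τ x • v) = 0 := by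
    intro t0 ht
    have h0 := (mem_RT S.hq S.hv).1 ht
    exact impl h0 (S.hs x0 t0 hx h0)
  choose! τ h1 h2 h3 using key
  have hU : ∀ᶠ x in 𝓝 x0, ev D x ≠ 0 := (ev_cont D).continuousAt.eventually_ne hx
  have hinj : ∀ᶠ x in 𝓝 x0, ∀ a ∈ RT q v x0, ∀ b ∈ RT q v x0, a ≠ b → τ a x ≠ τ b x := by
    refine (Filter.eventually_all_finset _).2 fun a ha => (Filter.eventually_all_finset _).2 fun b hb => ?_
    by_cases hab : a = b
    · simp [hab]
    · have : ∀ᶠ x in 𝓝 x0, τ a x - τ b x ≠ 0 :=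
        ((h1 a ha).continuousAt.sub (h1 b hb).continuousAt).eventually_ne (by
          simp only [Pi.sub_apply]
          rw [h2 a ha, h2 b hb]; exact sub_ne_zero.2 hab)
      filter_upwards [this] with x hx _
      exact sub_ne_zero.1 hx
  have hz : ∀ᶠ x in 𝓝 x0, ∀ a ∈ RT q v x0, ev q (x + τ a x • v) = 0 :=
    (Filter.eventually_all_finset _).2 h3
  have hct : ∀ a ∈ RT q v x0, ContinuousAt (fun x => x + τ a x • v) x0 := fun a ha =>
    continuousAt_id.add ((h1 a ha).continuousAt.smul continuousAt_const)
  have hO : ∀ᶠ x in 𝓝 x0, ∀ a ∈ RT q v x0, (x0 + a • v ∈ O1 → x + τ a x • v ∈ O1) ∧ (x0 + a • v ∈ O2 → x + τ a x • v ∈ O2) := by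
    refine (Filter.eventually_all_finset _).2 fun a ha => ?_
    have hval : x0 + τ a x0 • v = x0 + a • v := by rw [h2 a ha]
    refine Filter.Eventually.and ?_ ?_
    · by_cases h : x0 + a • v ∈ O1
      · filter_upwards [(hct a ha).preimage_mem_nhds (S.o1.mem_nhds (by simpa only [hval] using h))] with x hx _
        exact hx
      · simp [h]
    · by_cases h : x0 + a • v ∈ O2
      · filter_upwards [(hct a ha).preimage_mem_nhds (S.o2.mem_nhds (by simpa only [hval] using h))] with x hx _
        exact hx
      · simp [h]
  have hev : (fun x => ∏ a ∈ (RT q v x0).filter (fun t => x0 + t • v ∈ O1), (-τ a x)) =ᶠ[𝓝 x0] br q v O1 := by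
    filter_upwards [hU, hinj, hz, hO] with x hU hinj hz hO
    have hI : RT q v x = (RT q v x0).image (fun a => τ a x) := by
      symm
      refine Finset.eq_of_subset_of_card_le ?_ ?_
      · intro t ht
        obtain ⟨a, ha, rfl⟩ := Finset.mem_image.1 ht
        exact (mem_RT S.hq S.hv).2 (hz a ha)
      · rw [Finset.card_image_of_injOn, RT_card S.hq S.hv (S.hs x0 · hx)]
        · exact RT_card_le S.hq x
        · intro a ha b hb hab
          by_contra hne
          exact hinj a ha b hb hne hab
    rw [br, hI, Finset.filter_image, Finset.prod_image]
    · refine Finset.prod_congr ?_ fun _ _ => rfl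
      refine Finset.filter_congr fun a ha => ?_
      have hz0 := (mem_RT S.hq S.hv).1 ha
      refine ⟨(hO a ha).1, fun h => ?_⟩
      by_contra hc
      have := (hO a ha).2 ((S.h12 x0 a hx hz0).2 hc)
      exact (S.h12 x _ hU (hz a ha)).1 this h
    · intro a ha b hb hab
      by_contra hne
      exact hinj a (Finset.mem_filter.1 ha).1 b (Finset.mem_filter.1 hb).1 hne hab
  refine hev.differentiableAt_iff.1 ?_
  exact (HasFDerivAt.finsetProd fun a ha => (h1 a (Finset.mem_filter.1 ha).1).neg.hasFDerivAt).differentiableAt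

theorem SepD.line {q D : ℛ} {v : 𝔼} {m : ℕ} {O1 O2 : Set 𝔼} (S : SepD q D v m O1 O2) {x : 𝔼} (hx : ev D x ≠ 0) (w : 𝔼) :
    ∃ P : Polynomial ℂ, P.natDegree ≤ m ∧ ∀ s : ℂ, ev D (x + s • w) ≠ 0 → br q v O1 (x + s • w) = P.eval s := by
  obtain ⟨β, hβ, hb⟩ := root_bd S.hq S.hv
  have hL : LP D x w ≠ 0 := by
    intro h
    have := LP_eval D x w 0
    rw [h] at this
    simp only [Polynomial.eval_zero, zero_smul, add_zero] at this
    exact hx this.symm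
  have hF : ∀ s : ℂ, s ∉ (LP D x w).roots.toFinset ↔ ev D (x + s • w) ≠ 0 := by
    intro s
    rw [Multiset.mem_toFinset, Polynomial.mem_roots hL, Polynomial.IsRoot, LP_eval]
  obtain ⟨P, hP, hP'⟩ := rem_poly (LP D x w).roots.toFinset (fun s => br q v O1 (x + s • w)) (fun s hs => by
      have h1 := S.diff ((hF s).1 hs)
      exact DifferentiableAt.comp (g := br q v O1) (f := fun s : ℂ => x + s • w) s h1 (by fun_prop))
    (A := 1 + β * ‖x‖) (B := β * ‖w‖) (by positivity) (by positivity) m (fun s hs => by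
      refine (br_bd S.hq hβ (hb _) O1).trans ?_
      have : ‖x + s • w‖ ≤ ‖x‖ + ‖s‖ * ‖w‖ := (norm_add_le _ _).trans (by rw [norm_smul])
      refine pow_le_pow_left₀ (by positivity) ?_ m
      nlinarith [mul_le_mul_of_nonneg_left this hβ])
  exact ⟨P, hP, fun s hs => hP' s ((hF s).2 hs)⟩

theorem SepD.poly {q D : ℛ} {v : 𝔼} {m : ℕ} {O1 O2 : Set 𝔼} (S : SepD q D v m O1 O2) :
    ∃ A : ℛ, ∀ x, ev D x ≠ 0 → br q v O1 x = ev A x := by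
  obtain ⟨x0, hx0⟩ := ev_ne S.hD
  have hcont : Continuous fun y : Fin n → ℂ => ev D (WithLp.toLp 2 y) := (ev_cont D).comp (PiLp.continuous_toLp 2 _)
  have hne : ∀ᶠ y in 𝓝 (x0.ofLp), ev D (WithLp.toLp 2 y) ≠ 0 := hcont.continuousAt.eventually_ne hx0
  obtain ⟨δ, hδ, hbox⟩ := Metric.eventually_nhds_iff.1 hne
  have hbox' : ∀ y : Fin n → ℂ, (∀ i, y i ∈ ball (x0 i) δ) → ev D (WithLp.toLp 2 y) ≠ 0 := by
    intro y hy
    exact hbox ((dist_pi_lt_iff hδ).2 hy)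
  obtain ⟨A, hA⟩ := interp (c := x0.ofLp) hδ m Finset.univ (fun y => br q v O1 (WithLp.toLp 2 y)) (by
    intro y hy i
    obtain ⟨P, hP, hP'⟩ := S.line (hbox' y hy) (EuclideanSpace.single i (1 : ℂ))
    refine ⟨P.comp (Polynomial.X - Polynomial.C (y i)), ?_, fun s hs => ?_⟩
    · refine Polynomial.natDegree_comp_le.trans ?_
      rw [Polynomial.natDegree_X_sub_C, mul_one]; exact hP
    · have e : (WithLp.toLp 2 (Function.update y i s) : 𝔼) = WithLp.toLp 2 y + (s - y i) • EuclideanSpace.single i (1 : ℂ) := by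
        ext j
        by_cases h : j = i
        · subst h; simp
        · simp [h]
      have hD : ev D (WithLp.toLp 2 (Function.update y i s)) ≠ 0 := by
        refine hbox' _ fun j => ?_
        by_cases h : j = i
        · subst h; simpa using hs
        · simpa [Function.update_of_ne h] using hy j
      rw [e] at hD
      beta_reduce
      rw [e, hP' _ hD]; simp) (by
    intro x y _ _ h
    have : x = y := funext fun i => h i (Finset.mem_univ i)
    rw [this])
  refine ⟨A, fun y hy => ?_⟩
  obtain ⟨P, hP, hP'⟩ := S.line hx0 (y - x0)
  have hPA : P = LP A x0 (y - x0) := by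
    refine Polynomial.eq_of_infinite_eval_eq _ _ ?_
    have : {s : ℂ | P.eval s = (LP A x0 (y - x0)).eval s} ∈ 𝓝 (0 : ℂ) := by
      have hc : Continuous fun s : ℂ => (x0 + s • (y - x0)).ofLp := (PiLp.continuous_ofLp 2 _).comp (by fun_prop)
      have hb : ball x0.ofLp δ ∈ 𝓝 ((x0 + (0 : ℂ) • (y - x0)).ofLp) := by
        rw [zero_smul, add_zero]; exact ball_mem_nhds _ hδ
      filter_upwards [hc.continuousAt.preimage_mem_nhds hb] with s hs
      have hs' : ∀ i, (x0 + s • (y - x0)).ofLp i ∈ ball (x0 i) δ := fun i => (dist_pi_lt_iff hδ).1 hs i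
      have h1 := hA _ hs'
      have h2 := hbox' _ hs'
      rw [LP_eval, ← hP' s h2]
      exact h1
    exact infinite_of_mem_nhds 0 this
  have e : x0 + (1 : ℂ) • (y - x0) = y := by simp
  have h3 := hP' 1 (by rw [e]; exact hy)
  rw [hPA, LP_eval, e] at h3
  exact h3

theorem SepD.nounit {q D : ℛ} {v : 𝔼} {m : ℕ} {O1 O2 : Set 𝔼} (S : SepD q D v m O1 O2) {x1 : 𝔼} (hx : ev q x1 = 0) (hO : x1 ∈ O1)
    {A : ℛ} (hA : ∀ x, ev D x ≠ 0 → br q v O1 x = ev A x) : ¬ IsUnit A := by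
  intro hu
  obtain ⟨c, hc⟩ := MvPolynomial.isUnit_iff_eq_C_of_isReduced.1 hu
  have hc0 : c ≠ 0 := hc.1.ne_zero
  obtain ⟨β, hβ, hb⟩ := root_bd S.hq S.hv
  obtain ⟨ε, hε, hN⟩ := pt_of_nhds (v := v) (S.o1.mem_nhds hO)
  set M : ℝ := (1 + β * (‖x1‖ + 1)) ^ m with hM
  have hMp : 0 < M := by positivity
  have hcp : 0 < ‖c‖ := norm_pos_iff.2 hc0
  obtain ⟨y, t, h1, h2, h3, h4⟩ := persist S.hq S.hv S.hD hx (ε := min (min ε 1) (‖c‖ / M)) (by positivity)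
  have hO' := hN y t (h1.trans_le ((min_le_left _ _).trans (min_le_left _ _))) (h2.trans_le ((min_le_left _ _).trans (min_le_left _ _)))
  have h5 := br_small S.hq hβ (hb y) ((mem_RT S.hq S.hv).2 h4) hO'
  rw [hA y h3, hc.2, ev_C] at h5
  have hy : ‖y‖ ≤ ‖x1‖ + 1 := by
    have h6 := h1.trans_le ((min_le_left _ _).trans (min_le_right _ _))
    rw [dist_eq_norm] at h6
    have := norm_le_norm_add_norm_sub' y x1
    linarith
  have h6 : ‖t‖ * (1 + β * ‖y‖) ^ m ≤ ‖t‖ * M := by rw [hM]; gcongr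
  have h7 : ‖t‖ < ‖c‖ / M := h2.trans_le (min_le_right _ _)
  rw [lt_div_iff₀ hMp] at h7
  linarith

theorem conn_irr {q b : ℛ} {m : ℕ} (hqi : Irreducible q) (hq : q.IsHomogeneous m) (hm : 1 ≤ m) (hb : ¬ q ∣ b) :
    IsPreconnected {x : 𝔼 | ev q x = 0 ∧ ev b x ≠ 0} := by
  obtain ⟨v, hv⟩ := ev_ne hqi.ne_zero
  have hpr : Prime q := hqi.prime
  have hb' : ¬ q ∣ b * dirP q v := fun h => (hpr.dvd_or_dvd h).elim hb (dirP_self hq hqi.ne_zero hm hv)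
  obtain ⟨D, hD, hDs⟩ := exists_D hqi hb' hv (ev_hom0 hq hm)
  have hD1 : ∀ (x : 𝔼) (t : ℂ), ev D x ≠ 0 → ev q (x + t • v) = 0 → ev b (x + t • v) ≠ 0 ∧ evD q (x + t • v) v ≠ 0 := by
    intro x t h1 h2
    have := hDs x t h1 h2
    rw [ev_mul, ev_dirP] at this
    exact ⟨left_ne_zero_of_mul this, right_ne_zero_of_mul this⟩
  intro O1 O2 o1 o2 hsub h1 h2
  by_contra hc
  obtain ⟨x1, hx1, hx1'⟩ := h1
  obtain ⟨x2, hx2, hx2'⟩ := h2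
  have S : SepD q D v m O1 O2 := by
    refine ⟨hq, hv, hD, fun x t h h' => (hD1 x t h h').2, o1, o2, fun x t h h' => ?_⟩
    have hz : x + t • v ∈ {x : 𝔼 | ev q x = 0 ∧ ev b x ≠ 0} := ⟨h', (hD1 x t h h').1⟩
    constructor
    · intro h3 h4; exact hc ⟨_, hz, h4, h3⟩
    · intro h3; exact (hsub hz).resolve_left h3
  obtain ⟨A, hA⟩ := S.poly
  obtain ⟨B, hB⟩ := S.symm.poly
  have hprod : q = A * (MvPolynomial.C (ev q v) * B) := by
    by_contra hne
    obtain ⟨y, hy⟩ := ev_ne (mul_ne_zero (sub_ne_zero.2 hne) hD)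
    rw [ev_mul] at hy
    have hyD := right_ne_zero_of_mul hy
    apply left_ne_zero_of_mul hy
    have h3 := br_mul hq hv (S.hs y · hyD) (S.h12 y · hyD)
    rw [hA y hyD, hB y hyD] at h3
    have : ev (q - A * (MvPolynomial.C (ev q v) * B)) y = ev q y - ev A y * (ev q v * ev B y) := by simp [ev]
    rw [this, h3]; ring
  rcases hqi.isUnit_or_isUnit hprod with h | h
  · exact S.nounit hx1.1 hx1' hA h
  · exact S.symm.nounit hx2.1 hx2' hB (isUnit_of_mul_isUnit_right h)

end Alg5

noncomputable section Alg6
variable {n : ℕ}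
local notation "𝔼" => EuclideanSpace ℂ (Fin n)
local notation "ℛ" => MvPolynomial (Fin n) ℂ

theorem evD_smul0 {f : ℛ} {N : ℕ} (hf : f.IsHomogeneous N) {c : ℂ} (hc : c ≠ 0) (x : 𝔼) : evD f (c • x) = 0 ↔ evD f x = 0 := by
  rw [evD_eq_zero, evD_eq_zero]
  refine forall_congr' fun i => ?_
  rw [ev_hom (hf.pderiv (i := i))]
  simp [hc]

theorem ev_smul0 {f : ℛ} {N : ℕ} (hf : f.IsHomogeneous N) {c : ℂ} (hc : c ≠ 0) (x : 𝔼) : ev f (c • x) = 0 ↔ ev f x = 0 := by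
  rw [ev_hom hf]; simp [hc]

def Rg (f p : ℛ) : Set 𝔼 := {x | ev p x = 0 ∧ evD f x ≠ 0}

theorem Rg_conn {p f : ℛ} {m : ℕ} (hpi : Irreducible p) (hp : p.IsHomogeneous m) (hm : 1 ≤ m) (hf : Squarefree f) (hpf : p ∣ f) :
    IsPreconnected (Rg f p) := by
  obtain ⟨v, hv⟩ := ev_ne hpi.ne_zero
  have hd := dirP_fac hpi hp hm hf hpf hv
  refine (conn_irr hpi hp hm hd).subset_closure ?_ ?_
  · rintro x ⟨h1, h2⟩
    refine ⟨h1, fun h => h2 ?_⟩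
    rw [ev_dirP, h]; rfl
  · rintro x ⟨h1, h2⟩
    rw [mem_closure_iff_nhds]
    intro N hN
    obtain ⟨y, hy, h3, h4⟩ := dens hpi hp hm hd h1 hN
    exact ⟨y, hy, h3, h4⟩

theorem Rg_conn_ball {p f : ℛ} {m N : ℕ} (hpi : Irreducible p) (hp : p.IsHomogeneous m) (hm : 1 ≤ m) (hf : Squarefree f)
    (hfh : f.IsHomogeneous N) (hpf : p ∣ f) {r : ℝ} (hr : 0 < r) : IsPreconnected (Rg f p ∩ ball 0 r) := by
  have hc : Continuous fun x : 𝔼 => ((r / (1 + ‖x‖) : ℝ) : ℂ) • x := by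
    refine (Complex.continuous_ofReal.comp ?_).smul continuous_id
    exact continuous_const.div (by fun_prop) (fun x => by positivity)
  have hcl : ∀ (c : ℂ) (x : 𝔼), c ≠ 0 → x ∈ Rg f p → c • x ∈ Rg f p := by
    rintro c x h ⟨h1, h2⟩
    exact ⟨(ev_smul0 hp h x).2 h1, fun h3 => h2 ((evD_smul0 hfh h x).1 h3)⟩
  have := (Rg_conn hpi hp hm hf hpf).image _ hc.continuousOn
  convert this using 1
  ext y
  constructor
  · rintro ⟨h1, h2⟩
    have h2 : ‖y‖ < r := by simpa using h2
    have h3 : 0 < r - ‖y‖ := by linarith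
    refine ⟨(((r - ‖y‖)⁻¹ : ℝ) : ℂ) • y, hcl _ _ (by exact_mod_cast (inv_pos.2 h3).ne') h1, ?_⟩
    beta_reduce
    rw [smul_smul, ← Complex.ofReal_mul, norm_smul, Complex.norm_real, Real.norm_of_nonneg (by positivity)]
    have : r / (1 + (r - ‖y‖)⁻¹ * ‖y‖) * (r - ‖y‖)⁻¹ = 1 := by
      field_simp
      rw [sub_add_cancel]
    rw [this]; simp
  · rintro ⟨x, hx, rfl⟩
    refine ⟨hcl _ _ (by exact_mod_cast (by positivity : r / (1 + ‖x‖) ≠ 0)) hx, ?_⟩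
    rw [mem_ball_zero_iff, norm_smul, Complex.norm_real, Real.norm_of_nonneg (by positivity), div_mul_eq_mul_div,
      div_lt_iff₀ (by positivity)]
    nlinarith

theorem facs {f : ℛ} (hf : Squarefree f) : ∃ S : Finset ℛ, (∀ p ∈ S, Irreducible p ∧ p ∣ f) ∧
    (∀ p, Irreducible p → p ∣ f → ∃ p' ∈ S, Associated p p') ∧ (∀ p ∈ S, ∀ p' ∈ S, p ∣ p' → p = p') ∧
    f.totalDegree = ∑ p ∈ S, p.totalDegree := by
  classical
  have hf0 : f ≠ 0 := hf.ne_zero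
  set M := UniqueFactorizationMonoid.factors f with hM
  have hirr : ∀ p ∈ M, Irreducible p := fun p hp => UniqueFactorizationMonoid.irreducible_of_factor p hp
  have hprod : Associated M.prod f := UniqueFactorizationMonoid.factors_prod hf0
  have hass : ∀ p ∈ M, ∀ p' ∈ M.erase p, ¬ p ∣ p' := by
    intro p hp p' hp' h
    apply (hirr p hp).not_isUnit
    apply hf p
    rw [← hprod.dvd_iff_dvd_right, ← Multiset.prod_erase hp]
    exact mul_dvd_mul_left p (h.trans (Multiset.dvd_prod hp'))
  have hnd : M.Nodup := by
    rw [Multiset.nodup_iff_count_le_one]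
    intro p
    by_contra hc
    have h1 : p ∈ M := Multiset.count_pos.1 (by omega)
    have h2 : p ∈ M.erase p := by rw [← Multiset.count_pos, Multiset.count_erase_self]; omega
    exact hass p h1 p h2 dvd_rfl
  have hdeg : ∀ M : Multiset ℛ, (∀ p ∈ M, p ≠ 0) → M.prod.totalDegree = (M.map MvPolynomial.totalDegree).sum := by
    intro M
    induction M using Multiset.induction_on with
    | empty => intro _; simp
    | cons a s ih =>
      intro h
      rw [Multiset.prod_cons, Multiset.map_cons, Multiset.sum_cons, MvPolynomial.totalDegree_mul_of_isDomain (h a (by simp))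
        (Multiset.prod_ne_zero (fun h0 => h 0 (by simp [h0]) rfl)), ih (fun p hp => h p (by simp [hp]))]
  refine ⟨M.toFinset, ?_, ?_, ?_, ?_⟩
  · intro p hp
    rw [Multiset.mem_toFinset] at hp
    exact ⟨hirr p hp, (Multiset.dvd_prod hp).trans hprod.dvd⟩
  · intro p hp hpf
    obtain ⟨p', h1, h2⟩ := UniqueFactorizationMonoid.exists_mem_factors_of_dvd hf0 hp hpf
    exact ⟨p', by simpa using h1, h2⟩
  · intro p hp p' hp' h
    by_contra hne
    rw [Multiset.mem_toFinset] at hp hp'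
    exact hass p hp p' ((Multiset.mem_erase_of_ne (Ne.symm hne)).2 hp') h
  · have h1 : f.totalDegree = M.prod.totalDegree := by
      obtain ⟨u, hu⟩ := hprod
      obtain ⟨c, hc, hc'⟩ := MvPolynomial.isUnit_iff_eq_C_of_isReduced.1 u.isUnit
      rw [← hu, MvPolynomial.totalDegree_mul_of_isDomain (by intro h; rw [h, zero_mul] at hu; exact hf0 hu.symm) u.ne_zero, hc',
        MvPolynomial.totalDegree_C, add_zero]
    rw [h1, hdeg M (fun p hp => (hirr p hp).ne_zero), Finset.sum, Multiset.toFinset_val, Multiset.dedup_eq_self.2 hnd]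

structure Germ (φ : OpenPartialHomeomorph 𝔼 𝔼) (f g : ℛ) : Prop where
  h0 : (0 : 𝔼) ∈ φ.source
  z : φ 0 = 0
  bl : BLip φ
  hz : ∀ z ∈ φ.source, ev f z = 0 ↔ ev g (φ z) = 0

theorem Germ.symm {φ : OpenPartialHomeomorph 𝔼 𝔼} {f g : ℛ} (G : Germ φ f g) : Germ φ.symm g f where
  h0 := by have := φ.map_source G.h0; rw [G.z] at this; exact this
  z := by have := φ.left_inv G.h0; rwa [G.z] at this
  bl := G.bl.symm
  hz z hz := by
    rw [G.hz _ (φ.map_target hz), φ.right_inv hz]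

theorem Germ.reg {φ : OpenPartialHomeomorph 𝔼 𝔼} {f g : ℛ} (G : Germ φ f g) {N : ℕ} (hg : Squarefree g) (hgh : g.IsHomogeneous N)
    {z : 𝔼} (hz : z ∈ φ.source) (h0 : ev f z = 0) (hd : evD f z ≠ 0) : evD g (φ z) ≠ 0 := by
  obtain ⟨Ψ, h1, h2, h3, h4⟩ := straighten (ev_strict f z) h0 hd
  have hg0 : ev g (φ z) = 0 := (G.hz z hz).1 h0
  have ht : (0 : 𝔼) ∈ Ψ.target := by rw [← h2]; exact Ψ.map_source h1
  have hs : Ψ.symm 0 = z := by rw [← h2]; exact Ψ.left_inv h1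
  refine thmA hg.ne_zero hg0 (reg_dense hg hgh hg0) hd (φ := Ψ.symm.trans φ) (h3.symm.trans G.bl) ?_ ?_ ?_
  · rw [OpenPartialHomeomorph.trans_source]
    exact ⟨ht, by rw [mem_preimage, hs]; exact hz⟩
  · simp [hs]
  · intro w hw
    rw [OpenPartialHomeomorph.trans_source] at hw
    have hw1 : w ∈ Ψ.target := hw.1
    rw [OpenPartialHomeomorph.coe_trans, Function.comp_apply, ← G.hz _ hw.2, ← h4 _ (Ψ.map_target hw1), Ψ.right_inv hw1]

theorem Germ.match1 {φ : OpenPartialHomeomorph 𝔼 𝔼} {f g : ℛ} (G : Germ φ f g) {N N' : ℕ} (hf : Squarefree f) (hfh : f.IsHomogeneous N')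
    (hg : Squarefree g) (hgh : g.IsHomogeneous N) {p : ℛ} (hp : Irreducible p) (hpf : p ∣ f) :
    ∃ q, Irreducible q ∧ q ∣ g ∧ ∀ᶠ z in 𝓝 (0 : 𝔼), ev p z = 0 → ev q (φ z) = 0 := by
  have hph := hom_of_dvd hfh hf.ne_zero hpf
  have hpm := irr_deg hp
  obtain ⟨r, hr, hb⟩ := Metric.mem_nhds_iff.1 (φ.open_source.mem_nhds G.h0)
  obtain ⟨z0, hz0, hz0p, hz0d⟩ := dens_reg hp hph hpm hf hpf (ev_hom0 hph hpm) (ball_mem_nhds 0 hr)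
  have hff : ∀ z, ev p z = 0 → ev f z = 0 := by
    obtain ⟨h, rfl⟩ := hpf
    intro z hz; rw [ev_mul, hz, zero_mul]
  have hRg : ∀ z ∈ Rg f p ∩ ball 0 r, ev g (φ z) = 0 ∧ evD g (φ z) ≠ 0 := by
    rintro z ⟨⟨h1, h2⟩, h3⟩
    exact ⟨(G.hz z (hb h3)).1 (hff z h1), G.reg hg hgh (hb h3) (hff z h1) h2⟩
  obtain ⟨q, hq, hqg, hq0⟩ := fac_zero hg.ne_zero (hRg z0 ⟨⟨hz0p, hz0d⟩, hz0⟩).1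
  obtain ⟨h, hh⟩ := id hqg
  have hex : ∀ y, evD g y ≠ 0 → ev q y = 0 → ev h y ≠ 0 := by
    intro y hy h1 h2
    apply hy
    rw [evD_eq_zero]
    intro i
    rw [hh, MvPolynomial.pderiv_mul]
    simp [h1, h2]
  have hK := (Rg_conn_ball hp hph hpm hf hfh hpf hr).image φ (φ.continuousOn.mono (inter_subset_right.trans hb))
  have hsub : ∀ z ∈ Rg f p ∩ ball 0 r, ev q (φ z) = 0 := by
    intro z hz
    by_contra hc
    obtain ⟨y, ⟨w, hw, rfl⟩, h1, h2⟩ := hK {y | ev h y ≠ 0} {y | ev q y ≠ 0} (isOpen_ne_fun (ev_cont h) continuous_const)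
      (isOpen_ne_fun (ev_cont q) continuous_const) (by
        rintro _ ⟨w, hw, rfl⟩
        by_cases h1 : ev q (φ w) = 0
        · exact Or.inl (hex _ (hRg w hw).2 h1)
        · exact Or.inr h1)
      ⟨φ z0, ⟨z0, ⟨⟨hz0p, hz0d⟩, hz0⟩, rfl⟩, hex _ (hRg z0 ⟨⟨hz0p, hz0d⟩, hz0⟩).2 hq0⟩
      ⟨φ z, ⟨z, hz, rfl⟩, hc⟩
    have := (hRg w hw).1
    rw [hh, ev_mul] at this
    exact (mul_ne_zero h2 h1) this
  refine ⟨q, hq, hqg, ?_⟩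
  filter_upwards [ball_mem_nhds 0 hr] with z hz hzp
  by_contra hc
  have hct : ContinuousAt (fun z => ev q (φ z)) z := (ev_cont q).continuousAt.comp (φ.continuousAt (hb hz))
  obtain ⟨y, hy, h1, h2⟩ := dens_reg hp hph hpm hf hpf hzp (inter_mem (hct.eventually_ne hc) (isOpen_ball.mem_nhds hz))
  exact hy.1 (hsub y ⟨⟨h1, h2⟩, hy.2⟩)

end Alg6

noncomputable section Alg7
variable {n : ℕ}
local notation "𝔼" => EuclideanSpace ℂ (Fin n)
local notation "ℛ" => MvPolynomial (Fin n) ℂ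

def RelG (φ : OpenPartialHomeomorph 𝔼 𝔼) (p q : ℛ) : Prop := ∀ᶠ z in 𝓝 (0 : 𝔼), ev p z = 0 ↔ ev q (φ z) = 0

def IsoP (p : ℛ) : Prop := ∀ x : 𝔼, x ≠ 0 → ev p x = 0 → evD p x ≠ 0

theorem dvd_of_zero {p p' : ℛ} {m : ℕ} (hp : Irreducible p) (hph : p.IsHomogeneous m) (hm : 1 ≤ m)
    (h : ∀ᶠ z in 𝓝 (0 : 𝔼), ev p z = 0 → ev p' z = 0) : p ∣ p' := by
  by_contra hc
  obtain ⟨y, hy, h1, h2⟩ := dens hp hph hm hc (ev_hom0 hph hm) h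
  exact h2 (hy h1)

theorem ev_dvd {p p' : ℛ} (h : p ∣ p') {z : 𝔼} (hz : ev p z = 0) : ev p' z = 0 := by
  obtain ⟨c, rfl⟩ := h
  rw [ev_mul, hz, zero_mul]

theorem Germ.tend {φ : OpenPartialHomeomorph 𝔼 𝔼} {f g : ℛ} (G : Germ φ f g) : Tendsto φ (𝓝 0) (𝓝 0) := by
  have := (φ.continuousAt G.h0).tendsto
  rwa [G.z] at this

theorem Germ.pair {φ : OpenPartialHomeomorph 𝔼 𝔼} {f g : ℛ} (G : Germ φ f g) {N N' : ℕ} (hf : Squarefree f) (hfh : f.IsHomogeneous N')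
    (hg : Squarefree g) (hgh : g.IsHomogeneous N) {p : ℛ} (hp : Irreducible p) (hpf : p ∣ f) :
    ∃ q, Irreducible q ∧ q ∣ g ∧ RelG φ p q := by
  obtain ⟨q, hq, hqg, h1⟩ := G.match1 hf hfh hg hgh hp hpf
  obtain ⟨p', hp', hpf', h2⟩ := G.symm.match1 hg hgh hf hfh hq hqg
  have hph := hom_of_dvd hfh hf.ne_zero hpf
  have h3 : ∀ᶠ z in 𝓝 (0 : 𝔼), ev q (φ z) = 0 → ev p' z = 0 := by
    filter_upwards [G.tend.eventually h2, φ.open_source.mem_nhds G.h0] with z h3 h4 h5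
    have := h3 h5
    rwa [φ.left_inv h4] at this
  have hd : p ∣ p' := dvd_of_zero hp hph (irr_deg hp) (by filter_upwards [h1, h3] with z h4 h5 h6; exact h5 (h4 h6))
  have hd' : p' ∣ p := (hp.associated_of_dvd hp' hd).symm.dvd
  refine ⟨q, hq, hqg, ?_⟩
  filter_upwards [h1, h3] with z h4 h5
  exact ⟨h4, fun h6 => ev_dvd hd' (h5 h6)⟩

theorem Germ.rel_symm {φ : OpenPartialHomeomorph 𝔼 𝔼} {f g : ℛ} (G : Germ φ f g) {p q : ℛ} (h : RelG φ.symm q p) : RelG φ p q := by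
  filter_upwards [G.tend.eventually h, φ.open_source.mem_nhds G.h0] with z h3 h4
  rw [φ.left_inv h4] at h3
  exact h3.symm

theorem Germ.rel_symm' {φ : OpenPartialHomeomorph 𝔼 𝔼} {f g : ℛ} (G : Germ φ f g) {p q : ℛ} (h : RelG φ p q) : RelG φ.symm q p := by
  refine G.symm.rel_symm (p := q) (q := p) ?_
  rw [OpenPartialHomeomorph.symm_symm]; exact h

theorem rel_dvd {φ : OpenPartialHomeomorph 𝔼 𝔼} {p p' q : ℛ} {m : ℕ} (hp : Irreducible p) (hph : p.IsHomogeneous m) (hm : 1 ≤ m)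
    (h : RelG φ p q) (h' : RelG φ p' q) : p ∣ p' :=
  dvd_of_zero hp hph hm (by filter_upwards [h, h'] with z h1 h2 h3; exact h2.2 (h1.1 h3))

theorem Germ.restr {φ : OpenPartialHomeomorph 𝔼 𝔼} {f g : ℛ} (G : Germ φ f g) {p q : ℛ} (h : RelG φ p q) : ∃ φ', Germ φ' p q := by
  obtain ⟨r, hr, hb⟩ := Metric.eventually_nhds_iff_ball.1 h
  refine ⟨φ.restr (ball 0 r), ?_, G.z, G.bl.restr _, ?_⟩
  · rw [OpenPartialHomeomorph.restr_source, isOpen_ball.interior_eq]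
    exact ⟨G.h0, mem_ball_self hr⟩
  · intro z hz
    rw [OpenPartialHomeomorph.restr_source, isOpen_ball.interior_eq] at hz
    exact hb z hz.2

theorem Germ.iso {φ : OpenPartialHomeomorph 𝔼 𝔼} {p q : ℛ} (G : Germ φ p q) {m : ℕ} (hq : Irreducible q) (hqh : q.IsHomogeneous m)
    (hp : IsoP p) : IsoP q := by
  intro x hx hx0 hd
  have hc : Continuous fun c : ℂ => c • x := by fun_prop
  have ht : (0 : 𝔼) ∈ φ.target := G.symm.h0
  have hU : φ.target ∈ 𝓝 ((0 : ℂ) • x) := by rw [zero_smul]; exact φ.open_target.mem_nhds ht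
  have h1 : ∀ᶠ c in 𝓝[≠] (0 : ℂ), c • x ∈ φ.target := mem_nhdsWithin_of_mem_nhds (hc.continuousAt.preimage_mem_nhds hU)
  obtain ⟨c, hc1, hc2⟩ := (h1.and self_mem_nhdsWithin).exists
  have hc2 : c ≠ 0 := hc2
  have hs := φ.map_target hc1
  have hr := φ.right_inv hc1
  have hpz : ev p (φ.symm (c • x)) = 0 := by
    rw [G.hz _ hs, hr]; exact (ev_smul0 hqh hc2 x).2 hx0
  have hne : φ.symm (c • x) ≠ 0 := by
    intro h
    rw [h, G.z] at hr
    exact (smul_ne_zero hc2 hx) hr.symm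
  have := G.reg hq.squarefree hqh hs hpz (hp _ hne hpz)
  rw [hr] at this
  exact this ((evD_smul0 hqh hc2 x).2 hd)

theorem final_red (hdeg : ∀ (φ : OpenPartialHomeomorph 𝔼 𝔼) (p q : ℛ), Germ φ p q → Irreducible p → Irreducible q →
      p.IsHomogeneous p.totalDegree → q.IsHomogeneous q.totalDegree → IsoP p → IsoP q → ¬ p.totalDegree < q.totalDegree)
    {φ : OpenPartialHomeomorph 𝔼 𝔼} {f g : ℛ} (G : Germ φ f g) {N N' : ℕ} (hf : Squarefree f) (hfh : f.IsHomogeneous N')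
    (hg : Squarefree g) (hgh : g.IsHomogeneous N) (hI : ∀ p, Irreducible p → p ∣ f → IsoP p) :
    (∀ q, Irreducible q → q ∣ g → IsoP q) ∧ f.totalDegree = g.totalDegree := by
  have hh : ∀ p, p ∣ f → p.IsHomogeneous p.totalDegree := fun p hp => hom_of_dvd hfh hf.ne_zero hp
  have hh' : ∀ p, p ∣ g → p.IsHomogeneous p.totalDegree := fun p hp => hom_of_dvd hgh hg.ne_zero hp
  have hq : ∀ q, Irreducible q → q ∣ g → IsoP q := by
    intro q hq hqg
    obtain ⟨p, hp, hpf, hR⟩ := G.symm.pair hg hgh hf hfh hq hqg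
    obtain ⟨φ', G'⟩ := G.restr (G.rel_symm hR)
    exact G'.iso hq (hh' q hqg) (hI p hp hpf)
  have hde : ∀ p q, Irreducible p → p ∣ f → Irreducible q → q ∣ g → RelG φ p q → p.totalDegree = q.totalDegree := by
    intro p q hp hpf hqi hqg hR
    obtain ⟨φ', G'⟩ := G.restr hR
    have h1 := hdeg φ' p q G' hp hqi (hh p hpf) (hh' q hqg) (hI p hp hpf) (hq q hqi hqg)
    have h2 := hdeg φ'.symm q p G'.symm hqi hp (hh' q hqg) (hh p hpf) (hq q hqi hqg) (hI p hp hpf)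
    omega
  refine ⟨hq, ?_⟩
  obtain ⟨S, s1, s2, s3, s4⟩ := facs hf
  obtain ⟨T, t1, t2, t3, t4⟩ := facs hg
  have hass : ∀ {q q' : ℛ} {p : ℛ}, Associated q q' → RelG φ p q → RelG φ p q' := by
    intro q q' p h hR
    filter_upwards [hR] with z hz
    rw [hz]
    exact ⟨fun h1 => ev_dvd h.dvd h1, fun h1 => ev_dvd h.symm.dvd h1⟩
  have hσ : ∀ p ∈ S, ∃ q ∈ T, RelG φ p q := by
    intro p hp
    obtain ⟨q, hq, hqg, hR⟩ := G.pair hf hfh hg hgh (s1 p hp).1 (s1 p hp).2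
    obtain ⟨q', hq', ha⟩ := t2 q hq hqg
    exact ⟨q', hq', hass ha hR⟩
  choose! σ hσT hσR using hσ
  rw [s4, t4]
  refine Finset.sum_bij (fun p _ => σ p) hσT ?_ ?_ ?_
  · intro p hp p' hp' h
    refine s3 p hp p' hp' (rel_dvd (s1 p hp).1 (hh p (s1 p hp).2) (irr_deg (s1 p hp).1) (hσR p hp) ?_)
    have := hσR p' hp'
    rwa [← show σ p = σ p' from h] at this
  · intro q hqT
    obtain ⟨p, hp, hpf, hR⟩ := G.symm.pair hg hgh hf hfh (t1 q hqT).1 (t1 q hqT).2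
    have hR' := G.rel_symm hR
    obtain ⟨p', hp', ha⟩ := s2 p hp hpf
    have hR2 : RelG φ p' q := by
      filter_upwards [hR'] with z hz
      rw [← hz]
      exact ⟨fun h1 => ev_dvd ha.symm.dvd h1, fun h1 => ev_dvd ha.dvd h1⟩
    refine ⟨p', hp', ?_⟩
    have h3 := G.rel_symm' hR2
    have h4 := G.rel_symm' (hσR p' hp')
    exact (t3 q hqT _ (hσT p' hp') (rel_dvd (t1 q hqT).1 (hh' q (t1 q hqT).2) (irr_deg (t1 q hqT).1) h3 h4)).symm
  · intro p hp
    exact hde p (σ p) (s1 p hp).1 (s1 p hp).2 (t1 _ (hσT p hp)).1 (t1 _ (hσT p hp)).2 (hσR p hp)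

end Alg7

noncomputable section Alg8

theorem patch (F : Finset ℂ) : ∀ v : ℂ → ℂ, ContinuousOn v (closedBall 0 1 \ F) → (∀ z ∈ closedBall 0 1 \ (F : Set ℂ), v z ≠ 0) →
    (∀ c ∈ F, ‖c‖ < 1 ∧ ∃ N ∈ 𝓝 c, ∃ s : ℂ → ℂ, ContinuousOn s (N \ {c}) ∧ ∀ z ∈ N \ {c}, v z = Complex.exp (s z)) →
    ∃ s : ℂ → ℂ, ContinuousOn s (sphere 0 1) ∧ ∀ z ∈ sphere (0:ℂ) 1, v z = Complex.exp (s z) := by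
  classical
  induction F using Finset.induction_on with
  | empty =>
    intro v h1 h2 _
    obtain ⟨L, hL, hL'⟩ := starlog (x0 := (0:ℂ)) (S := closedBall (0:ℂ) 1) (u := v)
      ((convex_closedBall _ _).starConvex (by simp)) (by simpa using h1) (by simpa using h2)
    exact ⟨L, hL.mono sphere_subset_closedBall, fun z hz => hL' z (sphere_subset_closedBall hz)⟩
  | insert c F hc ih =>
    intro v h1 h2 h3
    obtain ⟨hc1, N, hN, s, hs, hs'⟩ := h3 c (Finset.mem_insert_self _ _)
    have hN2 : N ∩ ball 0 1 ∩ (F : Set ℂ)ᶜ ∈ 𝓝 c := by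
      refine inter_mem (inter_mem hN (isOpen_ball.mem_nhds (by simpa using hc1))) ?_
      exact F.finite_toSet.isClosed.isOpen_compl.mem_nhds (by simpa using hc)
    obtain ⟨r, hr, hrN⟩ := Metric.mem_nhds_iff.1 hN2
    set χ : ℂ → ℝ := fun z => max 0 (min 1 (4 * dist z c / r - 1)) with hχ
    have hχc : Continuous χ := by simp only [hχ]; fun_prop
    have hχ1 : ∀ z, r / 2 ≤ dist z c → χ z = 1 := by
      intro z hz
      have : 1 ≤ 4 * dist z c / r - 1 := by rw [le_sub_iff_add_le, le_div_iff₀ hr]; linarith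
      simp [hχ, min_eq_left this]
    have hχ0 : ∀ z, dist z c < r / 4 → χ z = 0 := by
      intro z hz
      have : 4 * dist z c / r - 1 ≤ 0 := by rw [sub_nonpos, div_le_iff₀ hr]; linarith
      simp only [hχ]; exact max_eq_left ((min_le_right _ _).trans this)
    set w : ℂ → ℂ := fun z => if dist z c < r / 2 then Complex.exp (χ z * s z) else v z with hw
    have hwv : ∀ z, r / 2 ≤ dist z c → w z = v z := fun z hz => if_neg (not_lt.2 hz)
    have hws : ∀ z ∈ ball c r \ {c}, w z = Complex.exp (χ z * s z) := by
      intro z hz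
      simp only [hw]
      split_ifs with h
      · rfl
      · rw [hχ1 z (not_lt.1 h), Complex.ofReal_one, one_mul]
        exact hs' z ⟨(hrN hz.1).1.1, hz.2⟩
    have hw1 : ∀ z, dist z c < r / 4 → w z = 1 := by
      intro z hz
      simp only [hw]
      rw [if_pos (by linarith), hχ0 z hz]; simp
    have hev : ∀ z, r / 2 < dist z c → w =ᶠ[𝓝 z] v := by
      intro z hz
      filter_upwards [(isOpen_lt continuous_const (continuous_id.dist continuous_const)).mem_nhds hz] with x hx
      exact hwv x hx.le
    refine (ih w ?_ ?_ ?_).elim fun S h => ?_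
    · intro z hz
      rcases lt_or_ge (r / 2) (dist z c) with h | h
      · have hzc : z ≠ c := by rintro rfl; simp at h; linarith
        refine ContinuousWithinAt.congr_of_eventuallyEq (f := v) ?_ ((hev z h).filter_mono nhdsWithin_le_nhds) (hev z h).self_of_nhds
        have := h1 z ⟨hz.1, by simp [hzc]; exact hz.2⟩
        refine this.mono_of_mem_nhdsWithin ?_
        have h5 : {c}ᶜ ∈ 𝓝[closedBall 0 1 \ (F : Set ℂ)] z := mem_nhdsWithin_of_mem_nhds (isOpen_compl_singleton.mem_nhds hzc)
        filter_upwards [h5, self_mem_nhdsWithin] with x hx hx'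
        refine ⟨hx'.1, ?_⟩
        have : x ≠ c := hx
        simp [this]; exact hx'.2
      · apply ContinuousAt.continuousWithinAt
        by_cases hzc : z = c
        · subst hzc
          refine (continuousAt_const (y := (1:ℂ))).congr ?_
          filter_upwards [ball_mem_nhds z (by positivity : 0 < r / 4)] with x hx using (hw1 x hx).symm
        · have hO : IsOpen (ball c r \ {c}) := isOpen_ball.sdiff isClosed_singleton
          have hzO : z ∈ ball c r \ {c} := ⟨by rw [mem_ball]; linarith, hzc⟩
          have : ContinuousOn (fun z => Complex.exp (χ z * s z)) (ball c r \ {c}) := by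
            refine ContinuousOn.cexp (ContinuousOn.mul ?_ ?_)
            · exact (Complex.continuous_ofReal.comp hχc).continuousOn
            · exact hs.mono fun x hx => ⟨(hrN hx.1).1.1, hx.2⟩
          refine (this.continuousAt (hO.mem_nhds hzO)).congr ?_
          filter_upwards [hO.mem_nhds hzO] with x hx using (hws x hx).symm
    · intro z hz
      simp only [hw]
      split_ifs with h
      · exact Complex.exp_ne_zero _
      · refine h2 z ⟨hz.1, ?_⟩
        have : z ≠ c := by rintro rfl; simp at h; linarith
        simp [this]; exact hz.2
    · intro c' hc'
      obtain ⟨h4, N', hN', s', h5, h6⟩ := h3 c' (Finset.mem_insert_of_mem hc')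
      have hd : r / 2 < dist c' c := by
        by_contra hlt
        have := (hrN (show c' ∈ ball c r by rw [mem_ball]; linarith)).2
        exact this hc'
      refine ⟨h4, N' ∩ {x | w x = v x}, inter_mem hN' (hev c' hd), s', h5.mono fun x hx => ⟨hx.1.1, hx.2⟩, ?_⟩
      intro z hz
      rw [show w z = v z from hz.1.2]
      exact h6 z ⟨hz.1.1, hz.2⟩
    · refine ⟨S, h.1, fun z hz => ?_⟩
      rw [← h.2 z hz, hwv]
      by_contra hlt
      have := (hrN (show z ∈ ball c r by rw [mem_ball]; linarith)).1.2
      rw [mem_sphere_zero_iff_norm] at hz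
      rw [mem_ball_zero_iff] at this
      linarith

end Alg8

noncomputable section Alg9
variable {n : ℕ}
local notation "𝔼" => EuclideanSpace ℂ (Fin n)
local notation "ℛ" => MvPolynomial (Fin n) ℂ

theorem cln_open {u h : 𝔼 → ℂ} {k : ℤ} : IsOpen {z | Cln u h k z} := by
  rw [isOpen_iff_mem_nhds]
  rintro z ⟨N, hN, hc⟩
  filter_upwards [eventually_mem_nhds_iff.2 hN] with x hx using ⟨N, hx, hc⟩

theorem Germ.sgn {φ : OpenPartialHomeomorph 𝔼 𝔼} {p q : ℛ} (G : Germ φ p q) (hp : Irreducible p) (hq : Irreducible q)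
    {d e : ℕ} (hd : 1 ≤ d) (hph : p.IsHomogeneous d) (hqh : q.IsHomogeneous e) {r : ℝ} (hr : 0 < r) (hrs : ball 0 r ⊆ φ.source) :
    ∃ k : ℤ, (k = 1 ∨ k = -1) ∧ ∀ z ∈ ball (0 : 𝔼) r, ev p z = 0 → evD p z ≠ 0 → Cln (ev q ∘ φ) (ev p) k z := by
  have hc := Rg_conn_ball hp hph hd hp.squarefree hph dvd_rfl hr
  have hl : ∀ z ∈ Rg p p ∩ ball 0 r, ∃ k : ℤ, (k = 1 ∨ k = -1) ∧ Cln (ev q ∘ φ) (ev p) k z := fun z hz =>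
    cln_loc (ev_strict p z) hz.1.1 hz.1.2 (ev_strict q (φ z)) ((G.hz z (hrs hz.2)).1 hz.1.1)
      (G.reg hq.squarefree hqh (hrs hz.2) hz.1.1 hz.1.2) (hrs hz.2) rfl G.hz
  by_cases h1 : ∀ z ∈ Rg p p ∩ ball 0 r, Cln (ev q ∘ φ) (ev p) 1 z
  · exact ⟨1, Or.inl rfl, fun z hz h2 h3 => h1 z ⟨⟨h2, h3⟩, hz⟩⟩
  · push Not at h1
    obtain ⟨z0, hz0, hn⟩ := h1
    refine ⟨-1, Or.inr rfl, fun z hz h2 h3 => ?_⟩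
    have hz' : z ∈ Rg p p ∩ ball 0 r := ⟨⟨h2, h3⟩, hz⟩
    by_contra hcon
    have hz1 : Cln (ev q ∘ φ) (ev p) 1 z := by
      obtain ⟨k, rfl | rfl, hk⟩ := hl z hz'
      · exact hk
      · exact absurd hk hcon
    have hz2 : Cln (ev q ∘ φ) (ev p) (-1) z0 := by
      obtain ⟨k, rfl | rfl, hk⟩ := hl z0 hz0
      · exact absurd hk hn
      · exact hk
    obtain ⟨x, hx, hx1, hx2⟩ := hc _ _ (cln_open (u := ev q ∘ φ) (h := ev p) (k := 1)) (cln_open (u := ev q ∘ φ) (h := ev p) (k := -1))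
      (fun z hz => by
        obtain ⟨k, rfl | rfl, hk⟩ := hl z hz
        · exact Or.inl hk
        · exact Or.inr hk) ⟨z, hz', hz1⟩ ⟨z0, hz0, hz2⟩
    have := cln_unique (ev_strict p x) hx.1.1 hx.1.2 hx1 hx2
    norm_num at this

theorem Germ.circ {φ : OpenPartialHomeomorph 𝔼 𝔼} {p q : ℛ} (G : Germ φ p q) {d : ℕ} (hd : 1 ≤ d) (hph : p.IsHomogeneous d)
    (hI : IsoP p) {r : ℝ} (hrs : ball 0 r ⊆ φ.source) {k : ℤ}
    (hk : ∀ z ∈ ball (0 : 𝔼) r, ev p z = 0 → evD p z ≠ 0 → Cln (ev q ∘ φ) (ev p) k z)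
    {y1 : 𝔼} (hy1 : ev p y1 = 0) (hy1' : y1 ≠ 0) {y : 𝔼} (hy : ‖y‖ < r) (hpy : ev p y ≠ 0) :
    ∃ s : ℂ → ℂ, ContinuousOn s (sphere 0 1) ∧
      ∀ l ∈ sphere (0:ℂ) 1, ev q (φ (l • y)) = ev p (l • y) ^ k * Complex.exp (s l) := by
  classical
  obtain ⟨δ, hδ, hδ'⟩ : ∃ δ > 0, ∀ t : ℂ, ‖t‖ < δ → ev p (y + t • y1) ≠ 0 := by
    have h1 : ContinuousAt (fun t : ℂ => ev p (y + t • y1)) 0 := (line_diff p y y1).continuous.continuousAt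
    have h2 := h1.eventually_ne (y := 0) (by simpa using hpy)
    obtain ⟨δ, h3, h4⟩ := Metric.eventually_nhds_iff.1 h2
    exact ⟨δ, h3, fun t ht => h4 (by simpa using ht)⟩
  obtain ⟨η, hη, hη1, hη2⟩ : ∃ η : ℝ, 0 < η ∧ η < δ ∧ η * ‖y1‖ < r - ‖y‖ := by
    have h0 : 0 < ‖y1‖ := norm_pos_iff.2 hy1'
    have hm : 0 < min δ ((r - ‖y‖) / ‖y1‖) := lt_min hδ (div_pos (by linarith) h0)
    refine ⟨min δ ((r - ‖y‖) / ‖y1‖) / 2, by linarith, ?_, ?_⟩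
    · linarith [min_le_left δ ((r - ‖y‖) / ‖y1‖)]
    · rw [← lt_div_iff₀ h0]
      linarith [min_le_right δ ((r - ‖y‖) / ‖y1‖)]
  set g : ℝ → ℂ → 𝔼 := fun t l => ((t * η : ℝ) : ℂ) • y1 + l • y with hg
  have hgc : Continuous fun x : ℝ × ℂ => g x.1 x.2 := by simp only [hg]; fun_prop
  have hgb : ∀ t ∈ Icc (0:ℝ) 1, ∀ l : ℂ, ‖l‖ ≤ 1 → g t l ∈ ball (0 : 𝔼) r := by
    intro t ht l hl
    rw [mem_ball_zero_iff]
    calc ‖g t l‖ ≤ ‖((t * η : ℝ) : ℂ) • y1‖ + ‖l • y‖ := norm_add_le _ _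
      _ = t * (η * ‖y1‖) + ‖l‖ * ‖y‖ := by
        rw [norm_smul, norm_smul, Complex.norm_real, Real.norm_of_nonneg (mul_nonneg ht.1 hη.le), mul_assoc]
      _ ≤ 1 * (η * ‖y1‖) + 1 * ‖y‖ := by gcongr; exact ht.2
      _ < r := by linarith
  have hgn : ∀ t ∈ Icc (0:ℝ) 1, ∀ l ∈ sphere (0:ℂ) 1, ev p (g t l) ≠ 0 := by
    intro t ht l hl
    rw [mem_sphere_zero_iff_norm] at hl
    have hl0 : l ≠ 0 := by rintro rfl; simp at hl
    have h1 : g t l = l • (y + (((t * η : ℝ) : ℂ) / l) • y1) := by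
      simp only [hg]
      rw [smul_add, smul_smul, mul_div_cancel₀ _ hl0, add_comm]
    rw [h1, Ne, ev_smul0 hph hl0]
    apply hδ'
    rw [norm_div, hl, div_one, Complex.norm_real, Real.norm_of_nonneg (mul_nonneg ht.1 hη.le)]
    nlinarith [ht.2]
  set w : 𝔼 → ℂ := fun z => ev q (φ z) * (ev p z ^ k)⁻¹ with hw
  have hwc : ContinuousOn w (ball 0 r ∩ {z | ev p z ≠ 0}) := by
    refine ContinuousOn.mul ((ev_cont q).comp_continuousOn (φ.continuousOn.mono fun z hz => hrs hz.1)) ?_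
    refine ContinuousOn.inv₀ ((ev_cont p).continuousOn.zpow₀ k fun z hz => Or.inl hz.2) fun z hz => zpow_ne_zero _ hz.2
  have hwn : ∀ z ∈ ball 0 r ∩ {z | ev p z ≠ 0}, w z ≠ 0 := fun z hz =>
    mul_ne_zero (fun h => hz.2 ((G.hz z (hrs hz.1)).2 h)) (inv_ne_zero (zpow_ne_zero _ hz.2))
  have o1 : (1:ℝ) ∈ Icc (0:ℝ) 1 := by simp
  have o0 : (0:ℝ) ∈ Icc (0:ℝ) 1 := by simp
  have hg1 : Continuous fun l : ℂ => g 1 l := by simp only [hg]; fun_prop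
  have hroot : ∀ l : ℂ, l ∈ RT p y (((1 * η : ℝ) : ℂ) • y1) ↔ ev p (g 1 l) = 0 := fun l => mem_RT hph hpy
  set F := (RT p y (((1 * η : ℝ) : ℂ) • y1)).filter fun l => ‖l‖ < 1 with hF
  have hFm : ∀ l ∈ closedBall (0:ℂ) 1 \ (F : Set ℂ), g 1 l ∈ ball 0 r ∩ {z | ev p z ≠ 0} := by
    intro l hl
    have hl1 : ‖l‖ ≤ 1 := by simpa using hl.1
    refine ⟨hgb 1 o1 l hl1, fun h0 => ?_⟩
    rcases hl1.lt_or_eq with h | h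
    · exact hl.2 (by rw [hF, Finset.mem_coe, Finset.mem_filter]; exact ⟨(hroot l).2 h0, h⟩)
    · exact hgn 1 o1 l (by simpa using h) h0
  obtain ⟨s, hs, hs'⟩ := patch F (fun l => w (g 1 l)) (hwc.comp hg1.continuousOn hFm) (fun l hl => hwn _ (hFm l hl)) (by
    intro c hc
    rw [hF, Finset.mem_filter, hroot] at hc
    refine ⟨hc.2, ?_⟩
    have hne : g 1 c ≠ 0 := by
      intro h0
      by_cases hc0 : c = 0
      · rw [hc0] at h0
        simp only [hg, zero_smul, add_zero, one_mul, smul_eq_zero] at h0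
        exact h0.elim (by exact_mod_cast hη.ne') hy1'
      · have h1 : c • y = (-((1 * η : ℝ) : ℂ)) • y1 := by
          rw [neg_smul, eq_neg_iff_add_eq_zero, add_comm]; exact h0
        have h2 : ev p (c • y) = 0 := by
          rw [h1, ev_smul0 hph (neg_ne_zero.2 (by exact_mod_cast (by linarith : (1 * η : ℝ) ≠ 0)))]; exact hy1
        exact hpy ((ev_smul0 hph hc0 y).1 h2)
    obtain ⟨N, hN, S, hS, hS'⟩ := hk _ (hgb 1 o1 c hc.2.le) hc.1 (hI _ hne hc.1)
    have hN' : (fun l => g 1 l) ⁻¹' N ∩ (((RT p y (((1 * η : ℝ) : ℂ) • y1)).erase c : Finset ℂ) : Set ℂ)ᶜ ∈ 𝓝 c := by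
      refine inter_mem (hg1.continuousAt hN) ?_
      exact (Finset.finite_toSet _).isClosed.isOpen_compl.mem_nhds (by simp)
    have hm : ∀ l ∈ ((fun l => g 1 l) ⁻¹' N ∩ (((RT p y (((1 * η : ℝ) : ℂ) • y1)).erase c : Finset ℂ) : Set ℂ)ᶜ) \ {c},
        g 1 l ∈ N ∩ {z | ev p z ≠ 0} := by
      intro l hl
      refine ⟨hl.1.1, fun h0 => hl.1.2 ?_⟩
      rw [Finset.mem_coe, Finset.mem_erase]
      exact ⟨hl.2, (hroot l).2 h0⟩
    refine ⟨_, hN', fun l => S (g 1 l), hS.comp hg1.continuousOn hm, fun l hl => ?_⟩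
    have h5 := hS' _ (hm l hl)
    have h6 := zpow_ne_zero k (hm l hl).2
    simp only [hw]
    rw [Function.comp_apply] at h5
    rw [h5]; field_simp)
  obtain ⟨L, hL, -, hL'⟩ := hlog (S := sphere (0:ℂ) 1) (u := fun t l => w (g t l))
    (hwc.comp hgc.continuousOn fun x hx => ⟨hgb _ hx.1 _ (by have := hx.2; rw [mem_sphere_zero_iff_norm] at this; exact this.le), hgn _ hx.1 _ hx.2⟩)
    (fun t ht l hl => hwn _ ⟨hgb _ ht _ (by rw [mem_sphere_zero_iff_norm] at hl; exact hl.le), hgn _ ht _ hl⟩)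
  refine ⟨fun l => s l - L 1 l, hs.sub (hL.comp (f := fun l : ℂ => ((1:ℝ), l)) (by fun_prop) fun l hl => ⟨o1, hl⟩), fun l hl => ?_⟩
  have h1 := hL' 1 o1 l hl
  have h2 := hs' l hl
  have h3 : g 0 l = l • y := by simp [hg]
  have h4 := hgn 0 o0 l hl
  beta_reduce at h1 h2
  rw [h2, h3] at h1
  rw [h3] at h4
  have h6 := zpow_ne_zero k h4
  rw [Complex.exp_sub, h1]
  simp only [hw]
  have := Complex.exp_ne_zero (L 1 l)
  field_simp

end Alg9

noncomputable section Alg10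
variable {n : ℕ}
local notation "𝔼" => EuclideanSpace ℂ (Fin n)
local notation "ℛ" => MvPolynomial (Fin n) ℂ

theorem evD_zero {p : ℛ} {m : ℕ} (hp : p.IsHomogeneous m) (hm : 2 ≤ m) : evD p (0 : 𝔼) = 0 := by
  rw [evD_eq_zero]
  exact fun i => ev_hom0 (hp.pderiv (i := i)) (by omega)

theorem evD_zero1 {p : ℛ} (hp : p.IsHomogeneous 1) (h0 : p ≠ 0) : evD p (0 : 𝔼) ≠ 0 := by
  intro h
  obtain ⟨v, hv⟩ := ev_ne h0
  have h1 : evD p v = 0 := by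
    rw [evD_eq_zero] at h ⊢
    intro i
    have := ev_hom (hp.pderiv (i := i)) (0:ℂ) v
    rw [zero_smul, h i] at this
    simpa using this.symm
  have := ev_euler hp v
  rw [h1] at this
  simp at this
  exact hv this.symm

theorem homIso {q : ℛ} {e : ℕ} (hq : q.IsHomogeneous e) (he : 1 ≤ e) (hI : IsoP q) : HomIso (ev q : 𝔼 → ℂ) e where
  cd := (ev_contDiff q).of_le le_top
  he := he
  hom c x := ev_hom hq c x
  nd x hx := by
    rw [ev_fderiv]
    intro h
    have := ev_euler hq x
    rw [h] at this
    simp only [ContinuousLinearMap.zero_apply, zero_eq_mul, Nat.cast_eq_zero] at this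
    exact hI x hx (this.resolve_left (by omega)) h

theorem hdeg (φ : OpenPartialHomeomorph 𝔼 𝔼) (p q : ℛ) (G : Germ φ p q) (hp : Irreducible p) (hq : Irreducible q)
    (hph : p.IsHomogeneous p.totalDegree) (hqh : q.IsHomogeneous q.totalDegree) (hIp : IsoP p) (hIq : IsoP q) :
    ¬ p.totalDegree < q.totalDegree := by
  intro hlt
  have hd1 := irr_deg hp
  generalize p.totalDegree = d at *
  generalize q.totalDegree = e at *
  have hd2 : 2 ≤ d := by
    by_contra hc
    obtain rfl : d = 1 := by omega
    have := G.reg hq.squarefree hqh G.h0 (ev_hom0 hph le_rfl) (evD_zero1 hph hp.ne_zero)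
    rw [G.z] at this
    exact this (evD_zero hqh (by omega))
  have he0 : (e:ℂ) ≠ 0 := by exact_mod_cast (by omega : e ≠ 0)
  obtain ⟨r, hr, hrs⟩ := Metric.mem_nhds_iff.1 (φ.open_source.mem_nhds G.h0)
  obtain ⟨k, hk1, hk⟩ := G.sgn hp hq hd1 hph hqh hr hrs
  obtain ⟨y1, -, hy1, hy1'⟩ := dens_reg hp hph hd1 hp.squarefree dvd_rfl (ev_hom0 hph hd1) (univ_mem (f := 𝓝 (0 : 𝔼)))
  have hy10 : y1 ≠ 0 := by rintro rfl; exact hy1' (evD_zero hph hd2)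
  set ζ : ℂ := Complex.exp (-(2 * Real.pi * Complex.I * (k * d)) / e) with hζ
  have hζe : ζ ^ e = 1 := by
    rw [hζ, ← Complex.exp_nat_mul, mul_div_cancel₀ _ he0, Complex.exp_eq_one_iff]
    exact ⟨-(k * d), by push_cast; ring⟩
  have hζ1 : ζ ≠ 1 := by
    rw [hζ, Ne, Complex.exp_eq_one_iff]
    rintro ⟨m, hm⟩
    rw [div_eq_iff he0] at hm
    have h1 : (2 * Real.pi * Complex.I) * (k * d + m * e) = 0 := by linear_combination -hm
    have h2 := (mul_eq_zero.1 h1).resolve_left Complex.two_pi_I_ne_zero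
    have h3 : k * d + m * e = 0 := by exact_mod_cast h2
    have h4 : (e : ℤ) ∣ d := by
      rcases hk1 with rfl | rfl
      · exact ⟨-m, by linarith⟩
      · exact ⟨m, by linarith⟩
    have := Nat.le_of_dvd (by omega) (Int.natCast_dvd_natCast.1 h4)
    omega
  obtain ⟨v, hv⟩ := ev_ne hq.ne_zero
  obtain ⟨R, hR, hno⟩ := no_rotate (homIso hqh (by omega) hIq) (by omega) hζe hζ1 (by
    obtain ⟨c, hc⟩ := IsAlgClosed.exists_pow_nat_eq (ev q v)⁻¹ (by omega : 0 < e)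
    exact ⟨c • v, by rw [ev_hom hqh, hc, inv_mul_cancel₀ hv]⟩)
  have ht : φ.symm.source ∩ φ.symm ⁻¹' ball 0 r ∈ 𝓝 (0 : 𝔼) :=
    have h2 := tendsto_def.1 (Germ.tend (Germ.symm G)) _ (ball_mem_nhds _ hr)
    inter_mem (φ.symm.open_source.mem_nhds (Germ.symm G).h0) h2
  obtain ⟨δ, hδ, hδ'⟩ := Metric.mem_nhds_iff.1 ht
  set s0 : ℝ := δ / (2 * R) with hs0
  have hs0p : 0 < s0 := by positivity
  have hs0c : (s0 : ℂ) ≠ 0 := by exact_mod_cast hs0p.ne'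
  have hin : ∀ x ∈ FK (ev q) R, (s0 : ℂ) • x ∈ φ.symm.source ∩ φ.symm ⁻¹' ball (0 : 𝔼) r := by
    rintro x ⟨-, hx⟩
    apply hδ'
    rw [mem_ball_zero_iff, norm_smul, Complex.norm_real, Real.norm_of_nonneg hs0p.le]
    calc s0 * ‖x‖ ≤ s0 * R := by gcongr
      _ = δ / 2 := by rw [hs0]; field_simp
      _ < δ := by linarith
  set ψ : 𝔼 → 𝔼 := fun x => φ.symm ((s0 : ℂ) • x) with hψ
  have hψc : ContinuousOn ψ (FK (ev q) R) := φ.symm.continuousOn.comp (by fun_prop) fun x hx => (hin x hx).1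
  have hψr : ∀ x ∈ FK (ev q) R, ‖ψ x‖ < r := fun x hx => mem_ball_zero_iff.1 (hin x hx).2
  have hφψ : ∀ x ∈ FK (ev q) R, φ (ψ x) = (s0 : ℂ) • x := fun x hx => φ.right_inv (hin x hx).1
  have hpψ : ∀ x ∈ FK (ev q) R, ev p (ψ x) ≠ 0 := by
    intro x hx h0
    rw [G.hz _ (hrs (by simpa using hψr x hx)), hφψ x hx, ev_smul0 hqh hs0c, hx.1] at h0
    exact one_ne_zero h0
  set rot : ℝ → ℂ := fun t => Complex.exp (2 * Real.pi * Complex.I * t) with hrot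
  have hrn : ∀ t, ‖rot t‖ = 1 := by
    intro t
    simp only [hrot]
    rw [show 2 * Real.pi * Complex.I * t = ((2 * Real.pi * t : ℝ) : ℂ) * Complex.I by push_cast; ring, Complex.norm_exp_ofReal_mul_I]
  have hr0 : ∀ t, rot t ≠ 0 := fun t => Complex.exp_ne_zero _
  have hrc : Continuous rot := by simp only [hrot]; fun_prop
  have rot0 : rot 0 = 1 := by simp [hrot]
  have rot1 : rot 1 = 1 := by simp [hrot, Complex.exp_two_pi_mul_I]
  have hAs : ∀ t, ∀ x ∈ FK (ev q) R, rot t • ψ x ∈ φ.source := fun t x hx => hrs (by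
    rw [mem_ball_zero_iff, norm_smul, hrn, one_mul]; exact hψr x hx)
  set A : ℝ → 𝔼 → 𝔼 := fun t x => φ (rot t • ψ x) with hA
  have hAc : ContinuousOn (fun z : ℝ × 𝔼 => A z.1 z.2) (Icc 0 1 ×ˢ FK (ev q) R) := by
    refine φ.continuousOn.comp ?_ fun z hz => hAs _ _ hz.2
    exact (hrc.comp continuous_fst).continuousOn.smul (hψc.comp continuousOn_snd fun z hz => hz.2)
  obtain ⟨L, hL, hL0, hL1⟩ := hlog (S := FK (ev q) R) (u := fun t x => ev q (A t x)) ((ev_cont q).comp_continuousOn hAc) (by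
    intro t _ x hx h0
    simp only [hA] at h0
    rw [← G.hz _ (hAs t x hx), ev_smul0 hph (hr0 t)] at h0
    exact hpψ x hx h0)
  have hA0 : ∀ x ∈ FK (ev q) R, A 0 x = (s0 : ℂ) • x := fun x hx => by
    simp only [hA]; rw [rot0, one_smul, hφψ x hx]
  have hA1 : ∀ x ∈ FK (ev q) R, A 1 x = (s0 : ℂ) • x := fun x hx => by
    simp only [hA]; rw [rot1, one_smul, hφψ x hx]
  have hqA : ∀ t ∈ Icc (0:ℝ) 1, ∀ x ∈ FK (ev q) R, ev q (A t x) = (s0:ℂ) ^ e * Complex.exp (L t x) := by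
    intro t ht x hx
    have := hL1 t ht x hx
    beta_reduce at this
    rw [this, hA0 x hx, ev_hom hqh, hx.1, mul_one]
  have hLe : ∀ x ∈ FK (ev q) R, L 1 x = 2 * Real.pi * Complex.I * (k * d) := by
    intro x hx
    obtain ⟨s, hs, hs'⟩ := G.circ hd1 hph hIp hrs hk hy1 hy10 (hψr x hx) (hpψ x hx)
    have hsph : ∀ t, rot t ∈ sphere (0:ℂ) 1 := fun t => by simpa using hrn t
    have hsc : Continuous fun t : ℝ => s (rot t) := hs.comp_continuous hrc hsph
    have hLc : ContinuousOn (fun t : ℝ => L t x) (Icc 0 1) :=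
      hL.comp (f := fun t : ℝ => (t, x)) (by fun_prop) fun t ht => ⟨ht, hx⟩
    have hz : ∀ t ∈ Icc (0:ℝ) 1, Complex.exp (L t x - 2 * Real.pi * Complex.I * t * (k * d) - s (rot t) + s 1) = 1 := by
      intro t ht
      have e1 := hs' _ (hsph t)
      have e0 := hs' _ (hsph 0)
      change ev q (A t x) = _ at e1
      change ev q (A 0 x) = _ at e0
      rw [hqA t ht x hx, ev_hom hph] at e1
      rw [hqA 0 (by simp) x hx, hL0 x hx, rot0, one_smul, Complex.exp_zero, mul_one] at e0
      rw [e0] at e1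
      have e2 : (rot t ^ d) ^ k = Complex.exp (2 * Real.pi * Complex.I * t * (k * d)) := by
        simp only [hrot]
        rw [← Complex.exp_nat_mul, ← Complex.exp_int_mul]; congr 1; ring
      rw [mul_zpow, e2] at e1
      have h7 := zpow_ne_zero k (hpψ x hx)
      rw [Complex.exp_add, Complex.exp_sub, Complex.exp_sub]
      have := Complex.exp_ne_zero (s (rot t))
      have := Complex.exp_ne_zero (2 * Real.pi * Complex.I * t * (k * d))
      rw [div_div, div_mul_eq_mul_div, div_eq_one_iff_eq (by positivity)]
      apply mul_left_cancel₀ h7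
      linear_combination e1
    have := exp_eq_one_const (isPreconnected_Icc)
      (f := fun t : ℝ => L t x - 2 * Real.pi * Complex.I * t * (k * d) - s (rot t) + s 1) (((hLc.sub (Continuous.continuousOn (by fun_prop))).sub hsc.continuousOn).add continuousOn_const) hz (x := 1) (y := 0) (by simp) (by simp)
    rw [hL0 x hx, rot0, rot1] at this
    simp only [Complex.ofReal_one, Complex.ofReal_zero] at this
    linear_combination this
  refine hno (fun t x => ((s0 : ℂ)⁻¹ * Complex.exp (-L t x / e)) • A t x) ?_ ?_ ?_ ?_
  · exact (continuousOn_const.mul ((hL.neg.div_const _).cexp)).smul hAc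
  · intro t ht x hx
    rw [ev_hom hqh, hqA t ht x hx, mul_pow, ← Complex.exp_nat_mul, mul_div_cancel₀ _ he0, inv_pow, Complex.exp_neg]
    have := Complex.exp_ne_zero (L t x)
    field_simp
  · intro x hx
    beta_reduce
    rw [hL0 x hx, hA0 x hx, smul_smul]
    simp [hs0c]
  · intro x hx
    beta_reduce
    rw [hLe x hx, hA1 x hx, smul_smul, mul_right_comm, inv_mul_cancel₀ hs0c, one_mul]

theorem SingV_iff {p : ℛ} : SingV p ⊆ {0} ↔ IsoP p := by
  constructor
  · intro h x hx h0 hd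
    exact hx (h ⟨h0, evD_eq_zero.1 hd⟩)
  · rintro h x ⟨h0, hd⟩
    by_contra hx
    exact h x hx h0 (evD_eq_zero.2 hd)

theorem germ_of {f g : ℛ} (h : BiLipGermHomeo (pV f) (pV g)) : ∃ φ, Germ φ f g := by
  obtain ⟨U, U', φ, ψ, K, hU, hU', h0, h0', hz, hm, hm', hl, hr, hL, hL', him⟩ := h
  let Φ : OpenPartialHomeomorph 𝔼 𝔼 :=
    { toFun := φ, invFun := ψ, source := U, target := U', map_source' := hm, map_target' := hm', left_inv' := hl, right_inv' := hr
      open_source := hU, open_target := hU', continuousOn_toFun := hL.continuousOn, continuousOn_invFun := hL'.continuousOn }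
  refine ⟨Φ, h0, hz, ⟨K, hL, hL'⟩, fun z hzU => ⟨fun h => ?_, fun h => ?_⟩⟩
  · have : φ z ∈ pV g ∩ U' := by rw [← him]; exact ⟨z, ⟨h, hzU⟩, rfl⟩
    exact this.1
  · have : φ z ∈ pV g ∩ U' := ⟨h, hm hzU⟩
    rw [← him] at this
    obtain ⟨w, hw, hwz⟩ := this
    rw [← hl.injOn hw.2 hzU hwz]
    exact hw.1

end Alg10

/-- Theorem: let `f, g` be nonconstant square-free homogeneous polynomials such that
every irreducible factor `p` of `f` satisfies `Sing V(p) ⊆ {0}`. If there is a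
bi-Lipschitz homeomorphism `(ℂⁿ, V(f), 0) → (ℂⁿ, V(g), 0)`, then every irreducible
factor `q` of `g` satisfies `Sing V(q) ⊆ {0}` and `deg f = deg g`. -/
theorem bilip_invariance_degree_squarefree_homogeneous_isolated_sing
    (n : ℕ) (f g : MvPolynomial (Fin n) ℂ)
    (hfdeg : 0 < f.totalDegree) (hgdeg : 0 < g.totalDegree)
    (hfsf : Squarefree f) (hgsf : Squarefree g)
    (hfhom : f.IsHomogeneous f.totalDegree) (hghom : g.IsHomogeneous g.totalDegree)
    (hfsing : ∀ p : MvPolynomial (Fin n) ℂ, Irreducible p → p ∣ f → SingV p ⊆ {0})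
    (hφ : BiLipGermHomeo (pV f) (pV g)) :
    (∀ q : MvPolynomial (Fin n) ℂ, Irreducible q → q ∣ g → SingV q ⊆ {0}) ∧
      f.totalDegree = g.totalDegree := by
  obtain ⟨φ, G⟩ := germ_of hφ
  obtain ⟨h1, h2⟩ := final_red hdeg G hfsf hfhom hgsf hghom fun p hp hpf => SingV_iff.1 (hfsing p hp hpf)
  exact ⟨fun q hq hqg => SingV_iff.2 (h1 q hq hqg), h2⟩
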